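/- There is a positive absolute constant C such that the following holds. For every ψ ∈ Ψ₁ (modulo p) and every zero ρ of s ↦ L(s,ψ)L(s,χψ) lying in Ω, one has Z̃(ρ,ψ) ≠ 0 and |Z̃(ρ,ψ)^{-1} + G(ρ,ψ)·F(1−ρ, ψ̄)| ≤ C·𝓛^{-100}, where F(1−ρ, ψ̄) = Σ_{n≤D⁴} ν(n)·conj(ψ(n))·n^{ρ−1}. -/

import Mathlib

open scoped Classical

noncomputable section

/-- The Dirichlet L-function of `χ` (extended to modulus `0` by `0`, a case never used below). -/
def Lfun {N : ℕ} (χ : DirichletCharacter ℂ N) (s : ℂ) : ℂ :=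
  if h : N = 0 then 0
  else
    haveI : NeZero N := ⟨h⟩
    DirichletCharacter.LFunction χ s

/-- A Dirichlet character is *real* if all of its values are real numbers. -/
def IsRealChar {N : ℕ} (χ : DirichletCharacter ℂ N) : Prop :=
  ∀ a : ZMod N, (χ a).im = 0

/-- `𝓛 = log D`. -/
def bigL (D : ℕ) : ℝ := Real.log D

/-- `P = exp (𝓛 ^ 9)`. -/
def bigP (D : ℕ) : ℝ := Real.exp (bigL D ^ 9)

/-- Assumption (A): `L(1, χ) < 𝓛 ^ (-2022)`. -/
def AssumptionA (D : ℕ) (χ : DirichletCharacter ℂ D) : Prop :=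
  (Lfun χ 1).re < bigL D ^ (-2022 : ℤ)

/-- `p ~ P`, i.e. `p` is a prime with `P < p < P * (1 + 𝓛 ^ (-68))`. -/
def SimP (D p : ℕ) : Prop :=
  p.Prime ∧ bigP D < (p : ℝ) ∧ (p : ℝ) < bigP D * (1 + bigL D ^ (-68 : ℤ))

/-- The finite set of primes `p ~ P`. -/
def primesP (D : ℕ) : Finset ℕ :=
  (Finset.range ⌈2 * bigP D⌉₊).filter (SimP D)

/-- `𝒫 = ∑_{p ~ P} p`. -/
def calP (D : ℕ) : ℝ := ∑ p ∈ primesP D, (p : ℝ)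

/-- `ν(n) = ∑_{d ∣ n} χ(d)`. -/
def nuF (D : ℕ) (χ : DirichletCharacter ℂ D) (n : ℕ) : ℂ :=
  ∑ d ∈ n.divisors, χ (d : ZMod D)

/-- `υ(n) = ∑_{ab = n} μ(a) μ(b) χ(b)`. -/
def upsF (D : ℕ) (χ : DirichletCharacter ℂ D) (n : ℕ) : ℂ :=
  ∑ d ∈ n.divisors,
    ((ArithmeticFunction.moebius (n / d) : ℤ) : ℂ) * ((ArithmeticFunction.moebius d : ℤ) : ℂ) *
      χ (d : ZMod D)

/-- `t₀ = 𝓛 ^ 519`. -/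
def t0 (D : ℕ) : ℝ := bigL D ^ 519

/-- `s₀ = 1/2 + 2 π i t₀`. -/
def s0 (D : ℕ) : ℂ := 1 / 2 + 2 * (Real.pi : ℂ) * Complex.I * (t0 D : ℂ)

/-- `𝓛₁ = 𝓛 ^ 405`. -/
def bigL1 (D : ℕ) : ℝ := bigL D ^ 405

/-- `ν` truncated to `n ≤ D ^ 4`, as an arithmetic function. -/
def nuT (D : ℕ) (χ : DirichletCharacter ℂ D) : ArithmeticFunction ℂ :=
  ⟨fun n => if n = 0 then 0 else if n ≤ D ^ 4 then nuF D χ n else 0, by simp⟩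

/-- `υ` truncated to `n ≤ D ^ 4`, as an arithmetic function. -/
def upsT (D : ℕ) (χ : DirichletCharacter ℂ D) : ArithmeticFunction ℂ :=
  ⟨fun n => if n = 0 then 0 else if n ≤ D ^ 4 then upsF D χ n else 0, by simp⟩

/-- `ν₂₀`, the 20-fold Dirichlet convolution of the truncation of `ν`. -/
def nu20 (D : ℕ) (χ : DirichletCharacter ℂ D) (n : ℕ) : ℂ := (nuT D χ ^ 20) n

/-- `υ₂₀`, the 20-fold Dirichlet convolution of the truncation of `υ`. -/
def ups20 (D : ℕ) (χ : DirichletCharacter ℂ D) (n : ℕ) : ℂ := (upsT D χ ^ 20) n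

/-- `ς(n) = ∑_{lm = n, l ≤ D⁴, m ≤ D⁴} ν(l) υ(m)`. -/
def sigF (D : ℕ) (χ : DirichletCharacter ℂ D) (n : ℕ) : ℂ :=
  ∑ d ∈ n.divisors,
    if d ≤ D ^ 4 ∧ n / d ≤ D ^ 4 then nuF D χ d * upsF D χ (n / d) else 0

/-- `X₁(x, ψ) = ∑_{n ≤ x} ν₂₀(n) ψ(n) n^{-s₀}`. -/
def X1 (D : ℕ) (χ : DirichletCharacter ℂ D) {p : ℕ} (ψ : DirichletCharacter ℂ p) (x : ℝ) : ℂ :=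
  ∑ n ∈ Finset.Icc 1 ⌊x⌋₊, nu20 D χ n * ψ (n : ZMod p) * (n : ℂ) ^ (-s0 D)

/-- `X₂(x, ψ) = ∑_{n ≤ x} υ₂₀(n) ψ(n) n^{-s₀}`. -/
def X2 (D : ℕ) (χ : DirichletCharacter ℂ D) {p : ℕ} (ψ : DirichletCharacter ℂ p) (x : ℝ) : ℂ :=
  ∑ n ∈ Finset.Icc 1 ⌊x⌋₊, ups20 D χ n * ψ (n : ZMod p) * (n : ℂ) ^ (-s0 D)

/-- `X₃(x, ψ) = ∑_{D⁴ < n ≤ x} ν(n) ψ(n) n^{-s₀}`. -/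
def X3 (D : ℕ) (χ : DirichletCharacter ℂ D) {p : ℕ} (ψ : DirichletCharacter ℂ p) (x : ℝ) : ℂ :=
  ∑ n ∈ Finset.Ioc (D ^ 4) ⌊x⌋₊, nuF D χ n * ψ (n : ZMod p) * (n : ℂ) ^ (-s0 D)

/-- `X₄(x, ψ) = ∑_{D⁴ < n ≤ x} ς(n) ψ(n) n^{-s₀}`. -/
def X4 (D : ℕ) (χ : DirichletCharacter ℂ D) {p : ℕ} (ψ : DirichletCharacter ℂ p) (x : ℝ) : ℂ :=
  ∑ n ∈ Finset.Ioc (D ^ 4) ⌊x⌋₊, sigF D χ n * ψ (n : ZMod p) * (n : ℂ) ^ (-s0 D)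

/-- Inequality (3.4). -/
def Ineq1 (D : ℕ) (χ : DirichletCharacter ℂ D) {p : ℕ} (ψ : DirichletCharacter ℂ p) : Prop :=
  ‖X1 D χ ψ ((D : ℝ) ^ 80)‖ + ‖X2 D χ ψ ((D : ℝ) ^ 80)‖ +
      (∫ x in (1 : ℝ)..((D : ℝ) ^ 80), (‖X1 D χ ψ x‖ + ‖X2 D χ ψ x‖) / x) <
    bigL D ^ 1171

/-- Inequality (3.5). -/
def Ineq2 (D : ℕ) (χ : DirichletCharacter ℂ D) {p : ℕ} (ψ : DirichletCharacter ℂ p) : Prop :=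
  ‖X3 D χ ψ (bigP D ^ 2)‖ + (∫ x in ((D : ℝ) ^ 4)..(bigP D ^ 2), ‖X3 D χ ψ x‖ / x) <
    bigL D ^ (-585 : ℤ)

/-- Inequality (3.6). -/
def Ineq3 (D : ℕ) (χ : DirichletCharacter ℂ D) {p : ℕ} (ψ : DirichletCharacter ℂ p) : Prop :=
  ‖X4 D χ ψ ((D : ℝ) ^ 8)‖ + (∫ x in ((D : ℝ) ^ 4)..((D : ℝ) ^ 8), ‖X4 D χ ψ x‖ / x) <
    bigL D ^ (-633 : ℤ)

/-- Membership in `Ψ₁`: `ψ` is a primitive character mod `p` with `p ~ P` satisfying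
(3.4), (3.5) and (3.6). -/
def MemPsi1 (D : ℕ) (χ : DirichletCharacter ℂ D) {p : ℕ} (ψ : DirichletCharacter ℂ p) : Prop :=
  SimP D p ∧ ψ.IsPrimitive ∧ Ineq1 D χ ψ ∧ Ineq2 D χ ψ ∧ Ineq3 D χ ψ

/-- `F(s, ψ) = ∑_{n ≤ D⁴} ν(n) ψ(n) n^{-s}`. -/
def Ffun (D : ℕ) (χ : DirichletCharacter ℂ D) {p : ℕ} (ψ : DirichletCharacter ℂ p) (s : ℂ) : ℂ :=
  ∑ n ∈ Finset.Icc 1 (D ^ 4), nuF D χ n * ψ (n : ZMod p) * (n : ℂ) ^ (-s)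

/-- `G(s, ψ) = ∑_{n ≤ D⁴} υ(n) ψ(n) n^{-s}`. -/
def Gfun (D : ℕ) (χ : DirichletCharacter ℂ D) {p : ℕ} (ψ : DirichletCharacter ℂ p) (s : ℂ) : ℂ :=
  ∑ n ∈ Finset.Icc 1 (D ^ 4), upsF D χ n * ψ (n : ZMod p) * (n : ℂ) ^ (-s)

/-- `F'(s, ψ) = -∑_{n ≤ D⁴} ν(n) ψ(n) (log n) n^{-s}`, the derivative of `F` in `s`. -/
def Ffun' (D : ℕ) (χ : DirichletCharacter ℂ D) {p : ℕ} (ψ : DirichletCharacter ℂ p) (s : ℂ) : ℂ :=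
  -∑ n ∈ Finset.Icc 1 (D ^ 4),
    nuF D χ n * ψ (n : ZMod p) * ((Real.log n : ℝ) : ℂ) * (n : ℂ) ^ (-s)

/-- `F(1 - s, ψ̄) = ∑_{n ≤ D⁴} ν(n) conj(ψ(n)) n^{s - 1}`, as a function of `s`. -/
def FfunBar (D : ℕ) (χ : DirichletCharacter ℂ D) {p : ℕ} (ψ : DirichletCharacter ℂ p)
    (s : ℂ) : ℂ :=
  ∑ n ∈ Finset.Icc 1 (D ^ 4),
    nuF D χ n * (starRingEnd ℂ) (ψ (n : ZMod p)) * (n : ℂ) ^ (s - 1)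

/-- The region `Ω`. -/
def InOmega (D : ℕ) (s : ℂ) : Prop :=
  |(s - s0 D).re| < 1 / 2 ∧ |(s - s0 D).im| < bigL1 D + 2

/-- The region `Ω₁`. -/
def InOmega1 (D : ℕ) (s : ℂ) : Prop :=
  1 / 2 - Real.log (bigL D) / (100 * bigL D) < s.re ∧
    s.re < 1 + Real.log (bigL D) / (100 * bigL D) ∧
    |s.im - 2 * Real.pi * t0 D| < bigL1 D + 5

/-- The region `Ω₂`. -/
def InOmega2 (D : ℕ) (s : ℂ) : Prop :=
  1 / 2 - (bigL D)⁻¹ < s.re ∧ s.re < 1 + (bigL D)⁻¹ ∧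
    |s.im - 2 * Real.pi * t0 D| < bigL1 D + 4

/-- `α = π / log P`. -/
def alphaD (D : ℕ) : ℝ := Real.pi / Real.log (bigP D)

/-- The region `Ω₃`. -/
def InOmega3 (D : ℕ) (s : ℂ) : Prop :=
  1 / 2 - alphaD D < s.re ∧ s.re < 1 + alphaD D ∧
    |s.im - 2 * Real.pi * t0 D| < bigL1 D + 3

/-- The Gauss sum `τ(θ) = ∑_{a mod k} θ(a) e(a/k)`. -/
def tauSum {k : ℕ} (θ : DirichletCharacter ℂ k) : ℂ :=
  ∑ a ∈ Finset.range k,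
    θ (a : ZMod k) * Complex.exp (2 * (Real.pi : ℂ) * Complex.I * (a : ℂ) / (k : ℂ))

/-- The factor `Z(s, θ)` from the functional equation. -/
def Zfun {k : ℕ} (θ : DirichletCharacter ℂ k) (s : ℂ) : ℂ :=
  if θ (-1) = 1 then
    tauSum θ * (Real.pi : ℂ) ^ (s - 1 / 2) * (k : ℂ) ^ (-s) *
      Complex.Gamma ((1 - s) / 2) / Complex.Gamma (s / 2)
  else
    -Complex.I * tauSum θ * (Real.pi : ℂ) ^ (s - 1 / 2) * (k : ℂ) ^ (-s) *
      Complex.Gamma ((2 - s) / 2) / Complex.Gamma ((1 + s) / 2)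

/-- The product character `χψ` modulo `D * p`, i.e. `n ↦ χ(n) ψ(n)`. -/
def chiPsi (D : ℕ) (χ : DirichletCharacter ℂ D) {p : ℕ} (ψ : DirichletCharacter ℂ p) :
    DirichletCharacter ℂ (D * p) :=
  DirichletCharacter.changeLevel (dvd_mul_right D p) χ *
    DirichletCharacter.changeLevel (dvd_mul_left p D) ψ

/-- `Z̃(s, ψ) = Z(s, ψ) Z(s, χψ)`. -/
def Ztilde (D : ℕ) (χ : DirichletCharacter ℂ D) {p : ℕ} (ψ : DirichletCharacter ℂ p)
    (s : ℂ) : ℂ :=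
  Zfun ψ s * Zfun (chiPsi D χ ψ) s

/-- `T = exp (𝓛 ^ 1.1)`. -/
def bigT (D : ℕ) : ℝ := Real.exp (bigL D ^ (1.1 : ℝ))

/-- `P₄ = P T⁻² t₀`. -/
def P4 (D : ℕ) : ℝ := bigP D * bigT D ^ (-2 : ℤ) * t0 D

/-- The smooth weight `g(x) = π^{-1/2} ∫_{-∞}^{𝓛^{15} log x} e^{-u²} du`. -/
def gfun (D : ℕ) (x : ℝ) : ℝ :=
  Real.pi ^ (-(1 : ℝ) / 2) * ∫ u in Set.Iio (bigL D ^ 15 * Real.log x), Real.exp (-u ^ 2)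

/-- `g*(y) = g(y)` for `y > 1/2`, and `0` otherwise. -/
def gstar (D : ℕ) (y : ℝ) : ℝ := if 1 / 2 < y then gfun D y else 0

/-- `K(s, ψ) = ∑_n ψ(n) n^{-s} g*(P₄ / n)`. -/
def Kfun (D : ℕ) {p : ℕ} (ψ : DirichletCharacter ℂ p) (s : ℂ) : ℂ :=
  ∑' n : ℕ, ψ (n : ZMod p) * (n : ℂ) ^ (-s) * ((gstar D (P4 D / n) : ℝ) : ℂ)

/-- `N(1 - s, ψ̄) = ∑_n conj(ψ(n)) n^{s-1} g*(T² / n)`, as a function of `s`. -/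
def Nfun (D : ℕ) {p : ℕ} (ψ : DirichletCharacter ℂ p) (s : ℂ) : ℂ :=
  ∑' n : ℕ,
    (starRingEnd ℂ) (ψ (n : ZMod p)) * (n : ℂ) ^ (s - 1) * ((gstar D (bigT D ^ 2 / n) : ℝ) : ℂ)

/-- `𝔞 = (6/π²) L'(1,χ)² ∏_{q ∣ D} q/(q+1)`. -/
def fraka (D : ℕ) (χ : DirichletCharacter ℂ D) : ℂ :=
  6 / (Real.pi : ℂ) ^ 2 * deriv (Lfun χ) 1 ^ 2 * ∏ q ∈ D.primeFactors, (q : ℂ) / ((q : ℂ) + 1)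

section PartNo1

def kap (j : ℕ) : ℝ := 1 / ((j:ℝ)^2 + 1)

lemma kap_summable : Summable kap := by
  have h : Summable (fun j : ℕ => 1 / ((j:ℝ))^2) := by
    exact Real.summable_one_div_nat_pow.mpr (one_lt_two)
  refine Summable.of_norm_bounded_eventually_nat h ?_
  filter_upwards [Filter.eventually_gt_atTop 0] with j hj
  have : (0:ℝ) < j := by exact_mod_cast hj
  rw [kap, Real.norm_of_nonneg (by positivity)]
  gcongr
  linarith

lemma logquad_convex (j : ℕ) (y : ℝ) (hy : 10 ≤ |y|) (e : ℝ) (he : e = 1 ∨ e = -1) :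
    ConvexOn ℝ (Set.Icc (-5:ℝ) 5) (fun x => kap j * x^2 + e * (1/2 * Real.log ((x + j)^2 + y^2))) := by
  have hy2 : 100 ≤ y^2 := by
    have := sq_abs y
    nlinarith [abs_nonneg y]
  have hpos : ∀ x : ℝ, 0 < (x + j)^2 + y^2 := fun x => by positivity
  have hd1 : ∀ x : ℝ, HasDerivAt (fun x => kap j * x^2 + e * (1/2 * Real.log ((x + j)^2 + y^2)))
      (kap j * (2 * x) + e * ((x + j) / ((x + j)^2 + y^2))) x := by
    intro x
    have h1 : HasDerivAt (fun x : ℝ => (x + j)^2 + y^2) (2 * (x + j)) x := by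
      have := (((hasDerivAt_id x).add_const (j:ℝ)).pow 2).add_const (y^2)
      simpa using this
    have h2 := h1.log (hpos x).ne'
    have h3 : HasDerivAt (fun x : ℝ => kap j * x^2) (kap j * (2 * x)) x := by
      have := ((hasDerivAt_id x).pow 2).const_mul (kap j)
      simpa using this
    have h4 := h3.add ((h2.const_mul (1/2)).const_mul e)
    refine h4.congr_deriv ?_
    ring
  have hd2 : ∀ x : ℝ, HasDerivAt (fun x => kap j * (2 * x) + e * ((x + j) / ((x + j)^2 + y^2)))
      (kap j * 2 + e * ((y^2 - (x + j)^2) / ((x + j)^2 + y^2)^2)) x := by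
    intro x
    have h1 : HasDerivAt (fun x : ℝ => (x + j)^2 + y^2) (2 * (x + j)) x := by
      have := (((hasDerivAt_id x).add_const (j:ℝ)).pow 2).add_const (y^2)
      simpa using this
    have h0 : HasDerivAt (fun x : ℝ => x + j) 1 x := (hasDerivAt_id x).add_const (j:ℝ)
    have h2 := h0.div h1 (hpos x).ne'
    have h3 : HasDerivAt (fun x : ℝ => kap j * (2 * x)) (kap j * 2) x := by
      have := ((hasDerivAt_id x).const_mul 2).const_mul (kap j)
      simpa using this
    have h4 := h3.add (h2.const_mul e)
    refine h4.congr_deriv ?_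
    congr 3
    ring
  refine convexOn_of_hasDerivWithinAt2_nonneg (convex_Icc _ _)
    (fun x _ => (hd1 x).continuousAt.continuousWithinAt)
    (fun x _ => (hd1 x).hasDerivWithinAt) (fun x _ => (hd2 x).hasDerivWithinAt) ?_
  intro x hx
  rw [interior_Icc] at hx
  have hx2 : x^2 ≤ 25 := by nlinarith [hx.1, hx.2]
  set q := (x + j)^2 + y^2 with hq
  have hq0 : 0 < q := hpos x
  have hqj : ((j:ℝ)^2 + 1) / 2 ≤ q := by
    rw [hq]; nlinarith [sq_nonneg (2 * x + j)]
  have hb : |(y^2 - (x + j)^2) / q^2| ≤ 2 * kap j := by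
    rw [abs_div, abs_of_pos (by positivity : 0 < q^2), div_le_iff₀ (by positivity)]
    have h1 : |y^2 - (x+j)^2| ≤ q := by
      rw [abs_le]; constructor <;> rw [hq] <;> nlinarith [sq_nonneg (x+j), sq_nonneg y]
    have h2 : 1 ≤ 2 * kap j * q := by
      rw [kap]
      have : (0:ℝ) < (j:ℝ)^2 + 1 := by positivity
      rw [mul_one_div, div_mul_eq_mul_div, le_div_iff₀ this]
      linarith
    nlinarith
  rcases he with rfl | rfl
  · linarith [(abs_le.mp hb).1]
  · linarith [(abs_le.mp hb).2]

def KK : ℝ := ∑' j, kap j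

lemma KK_nonneg : 0 ≤ KK := tsum_nonneg fun j => by rw [kap]; positivity

lemma log_GammaSeq (x y : ℝ) (hy : y ≠ 0) (n : ℕ) (hn : n ≠ 0) :
    Real.log ‖Complex.GammaSeq (x + y * Complex.I) n‖ =
      x * Real.log n + Real.log (n.factorial) -
        ∑ j ∈ Finset.range (n + 1), 1/2 * Real.log ((x + j)^2 + y^2) := by
  have hnp : (0:ℝ) < n := by exact_mod_cast Nat.pos_of_ne_zero hn
  have h1 : ∀ j : ℕ, ‖(x:ℂ) + y * Complex.I + j‖ = Real.sqrt ((x + j)^2 + y^2) := by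
    intro j
    rw [show (x:ℂ) + y * Complex.I + j = ((x + j : ℝ) : ℂ) + (y:ℝ) * Complex.I by push_cast; ring,
      Complex.norm_add_mul_I]
  have h0 : ∀ j : ℕ, 0 < (x + j)^2 + y^2 := fun j => by positivity
  rw [Complex.GammaSeq, norm_div, norm_mul, norm_prod]
  simp only [h1]
  have h2 : ‖((n:ℂ) ^ ((x:ℂ) + y * Complex.I))‖ = (n:ℝ) ^ x := by
    rw [← Complex.ofReal_natCast, Complex.norm_cpow_eq_rpow_re_of_pos hnp]; simp
  rw [h2]
  have h3 : ‖((n.factorial : ℕ) : ℂ)‖ = (n.factorial : ℝ) := by simp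
  rw [h3]
  have hf : (0:ℝ) < n.factorial := by exact_mod_cast n.factorial_pos
  rw [Real.log_div (by positivity) (Finset.prod_ne_zero_iff.mpr fun j _ => (Real.sqrt_pos.mpr (h0 j)).ne'),
    Real.log_mul (by positivity) hf.ne', Real.log_rpow hnp, Real.log_prod  (fun j _ => (Real.sqrt_pos.mpr (h0 j)).ne')]
  congr 1
  refine Finset.sum_congr rfl fun j _ => ?_
  rw [Real.log_sqrt (h0 j).le]; ring

lemma Gamma_ne (x y : ℝ) (hy : y ≠ 0) : Complex.Gamma (x + y * Complex.I) ≠ 0 := by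
  refine Complex.Gamma_ne_zero fun m h => hy ?_
  have := congrArg Complex.im h
  simpa using this

lemma logGamma_convex (y : ℝ) (hy : 10 ≤ |y|) (e : ℝ) (he : e = 1 ∨ e = -1) :
    ConvexOn ℝ (Set.Icc (-5:ℝ) 5)
      (fun x => KK * x^2 + e * Real.log ‖Complex.Gamma (x + y * Complex.I)‖) := by
  have hy0 : y ≠ 0 := by rintro rfl; simp at hy; linarith
  have hlim : ∀ x : ℝ, Filter.Tendsto (fun n => KK * x^2 + e * Real.log ‖Complex.GammaSeq (x + y * Complex.I) n‖)
      Filter.atTop (nhds (KK * x^2 + e * Real.log ‖Complex.Gamma (x + y * Complex.I)‖)) := by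
    intro x
    refine Filter.Tendsto.const_add _ (Filter.Tendsto.const_mul _ ?_)
    exact (Complex.GammaSeq_tendsto_Gamma _).norm.log (norm_ne_zero_iff.mpr (Gamma_ne x y hy0))
  have hn : ∀ n : ℕ, n ≠ 0 → ConvexOn ℝ (Set.Icc (-5:ℝ) 5)
      (fun x => KK * x^2 + e * Real.log ‖Complex.GammaSeq (x + y * Complex.I) n‖) := by
    intro n hn
    have h1 : ConvexOn ℝ (Set.Icc (-5:ℝ) 5) (fun x => ∑ j ∈ Finset.range (n+1),
        (kap j * x^2 + (-e) * (1/2 * Real.log ((x + j)^2 + y^2)))) := by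
      have : ∀ s : Finset ℕ, ConvexOn ℝ (Set.Icc (-5:ℝ) 5) (fun x => ∑ j ∈ s,
        (kap j * x^2 + (-e) * (1/2 * Real.log ((x + j)^2 + y^2)))) := by
        intro s
        induction s using Finset.induction_on with
        | empty => simpa using convexOn_const (0:ℝ) (convex_Icc (-5:ℝ) 5)
        | insert a s ha ih =>
          simp only [Finset.sum_insert ha]
          exact (logquad_convex a y hy (-e) (by rcases he with rfl | rfl <;> simp)).add ih
      exact this _
    have h2 : 0 ≤ KK - ∑ j ∈ Finset.range (n+1), kap j := by
      have := kap_summable.sum_le_tsum (Finset.range (n+1)) (fun j _ => by rw [kap]; positivity)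
      rw [KK]; linarith
    have h3 : ConvexOn ℝ (Set.Icc (-5:ℝ) 5) (fun x => (KK - ∑ j ∈ Finset.range (n+1), kap j) * x^2) := by
      have := (even_two.convexOn_pow (𝕜 := ℝ)).subset (Set.subset_univ (Set.Icc (-5:ℝ) 5)) (convex_Icc _ _)
      exact this.smul h2
    have h4 : ConvexOn ℝ (Set.Icc (-5:ℝ) 5) (fun x : ℝ => (e * Real.log n) * x) := by
      refine ⟨convex_Icc _ _, fun a _ b _ s t _ _ _ => le_of_eq ?_⟩
      simp only [smul_eq_mul]; ring
    have h5 := ((h1.add h3).add h4).add (convexOn_const (e * Real.log (n.factorial)) (convex_Icc (-5:ℝ) 5))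
    refine h5.congr fun x _ => ?_
    simp only [Pi.add_apply]
    rw [log_GammaSeq x y hy0 n hn, Finset.sum_add_distrib, ← Finset.sum_mul, ← Finset.mul_sum]
    ring
  refine ⟨convex_Icc _ _, fun a ha b hb s t hs ht hst => ?_⟩
  refine le_of_tendsto_of_tendsto (hlim _) (((hlim a).const_smul s).add ((hlim b).const_smul t)) ?_
  filter_upwards [Filter.eventually_ne_atTop 0] with n hn0
  exact (hn n hn0).2 ha hb hs ht hst

/-- Slope bound for `log |Γ|` on horizontal lines. -/
lemma logGamma_slope (y : ℝ) (hy : 10 ≤ |y|) (x₁ x₂ : ℝ) (h1 : -4 ≤ x₁) (h12 : x₁ ≤ x₂) (h2 : x₂ ≤ 4) :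
    |Real.log ‖Complex.Gamma (x₂ + y * Complex.I)‖ - Real.log ‖Complex.Gamma (x₁ + y * Complex.I)‖|
      ≤ (x₂ - x₁) * (Real.log (|y| + 4) + 20 * KK) := by
  have hy0 : y ≠ 0 := by rintro rfl; simp at hy; linarith
  rcases h12.eq_or_lt with rfl | hlt
  · simp
  have hrec : Real.log ‖Complex.Gamma ((x₂ + 1 : ℝ) + y * Complex.I)‖ =
      Real.log ‖(x₂:ℂ) + y * Complex.I‖ + Real.log ‖Complex.Gamma (x₂ + y * Complex.I)‖ := by
    have hz : (x₂:ℂ) + y * Complex.I ≠ 0 := by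
      intro h; apply hy0; have := congrArg Complex.im h; simpa using this
    rw [show ((x₂ + 1 : ℝ) : ℂ) + y * Complex.I = (x₂ + y * Complex.I) + 1 by push_cast; ring,
      Complex.Gamma_add_one _ hz, norm_mul, Real.log_mul (norm_ne_zero_iff.mpr hz)
        (norm_ne_zero_iff.mpr (Gamma_ne _ _ hy0))]
  have hl0 : 0 ≤ Real.log ‖(x₂:ℂ) + y * Complex.I‖ := by
    apply Real.log_nonneg
    have := Complex.abs_im_le_norm ((x₂:ℂ) + y * Complex.I)
    simp at this; linarith
  have hl1 : Real.log ‖(x₂:ℂ) + y * Complex.I‖ ≤ Real.log (|y| + 4) := by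
    apply Real.log_le_log
    · have := Complex.abs_im_le_norm ((x₂:ℂ) + y * Complex.I)
      simp at this; linarith
    · refine (norm_add_le _ _).trans ?_
      have : |x₂| ≤ 4 := abs_le.mpr ⟨by linarith, h2⟩
      simp; linarith
  have hK := KK_nonneg
  have key : ∀ e : ℝ, e = 1 ∨ e = -1 →
      e * (Real.log ‖Complex.Gamma (x₂ + y * Complex.I)‖ - Real.log ‖Complex.Gamma (x₁ + y * Complex.I)‖)
        ≤ (x₂ - x₁) * (e * Real.log ‖(x₂:ℂ) + y * Complex.I‖ + 20 * KK) := by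
    intro e he
    have hc := (logGamma_convex y hy e he).slope_mono_adjacent (x := x₁) (y := x₂) (z := x₂ + 1)
      ⟨by linarith, by linarith⟩ ⟨by linarith, by linarith⟩ hlt (by linarith)
    rw [hrec] at hc
    rw [div_le_iff₀ (by linarith)] at hc
    have : x₂ + 1 - x₂ = 1 := by ring
    rw [this, div_one] at hc
    nlinarith [mul_nonneg hK (sub_nonneg.mpr h12), mul_nonneg (mul_nonneg hK (sub_nonneg.mpr h12)) (by linarith : 0 ≤ x₂ + 4), mul_nonneg (mul_nonneg hK (sub_nonneg.mpr h12)) (by linarith : 0 ≤ 4 - x₂),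
      mul_nonneg (mul_nonneg hK (sub_nonneg.mpr h12)) (by linarith : 0 ≤ 4 - x₁), mul_nonneg (mul_nonneg hK (sub_nonneg.mpr h12)) (by linarith : 0 ≤ x₁ + 4)]
  have k1 := key 1 (Or.inl rfl)
  have k2 := key (-1) (Or.inr rfl)
  have hd : 0 ≤ x₂ - x₁ := by linarith
  rw [abs_le]
  constructor <;> nlinarith [mul_nonneg hd hl0, mul_nonneg hd hK, mul_le_mul_of_nonneg_left hl1 hd]

end PartNo1

section PartNo2

lemma inv_factorsThrough {k d : ℕ} {θ : DirichletCharacter ℂ k} (h : θ.FactorsThrough d) :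
    (θ⁻¹).FactorsThrough d := by
  obtain ⟨hd, χ0, h0⟩ := h
  refine ⟨hd, χ0⁻¹, ?_⟩
  rw [h0, map_inv]

lemma inv_primitive {k : ℕ} {θ : DirichletCharacter ℂ k} (h : θ.IsPrimitive) :
    (θ⁻¹).IsPrimitive := by
  have : (θ⁻¹).conductorSet = θ.conductorSet := by
    ext d
    simp only [DirichletCharacter.mem_conductorSet_iff]
    constructor
    · intro h
      have := inv_factorsThrough h
      rwa [inv_inv] at this
    · exact inv_factorsThrough
  rw [DirichletCharacter.isPrimitive_def] at h ⊢
  unfold DirichletCharacter.conductor at h ⊢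
  rw [this, h]

lemma tauSum_eq {k : ℕ} [NeZero k] (θ : DirichletCharacter ℂ k) :
    tauSum θ = gaussSum θ ZMod.stdAddChar := by
  unfold tauSum gaussSum
  refine Finset.sum_nbij' (fun a => (a : ZMod k)) (fun a => a.val) ?_ ?_ ?_ ?_ ?_
  · simp
  · intro a _; simpa using ZMod.val_lt a
  · intro a ha; simpa using ZMod.val_cast_of_lt (by simpa using ha)
  · intro a _; simp
  · intro a _
    have := ZMod.stdAddChar_coe (N := k) (a : ℤ)
    push_cast at this
    rw [this]

lemma even_iff {k : ℕ} (θ : DirichletCharacter ℂ k) : θ.Even ↔ θ (-1) = 1 := Iff.rfl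

lemma even_inv {k : ℕ} (θ : DirichletCharacter ℂ k) : (θ⁻¹).Even ↔ θ.Even := by
  rw [DirichletCharacter.Even, DirichletCharacter.Even, MulChar.inv_apply_eq_inv']
  exact inv_eq_one

lemma norm_gauss_inv {k : ℕ} [NeZero k] (θ : DirichletCharacter ℂ k) :
    ‖gaussSum θ⁻¹ ZMod.stdAddChar‖ = ‖gaussSum θ ZMod.stdAddChar‖ := by
  have h1 := star_gaussSum_eq θ (ZMod.stdAddChar (N := k))
  have h2 := gaussSum_mulShift θ⁻¹ (ZMod.stdAddChar (N := k)) (-1 : (ZMod k)ˣ)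
  have h3 : AddChar.mulShift (ZMod.stdAddChar (N := k)) ((-1 : (ZMod k)ˣ) : ZMod k) =
      (ZMod.stdAddChar (N := k))⁻¹ := by
    ext a
    simp [AddChar.mulShift_apply, AddChar.inv_apply]
  rw [h3, ← h1] at h2
  rw [← h2, norm_mul, norm_star]
  have : ‖θ⁻¹ ((-1 : (ZMod k)ˣ) : ZMod k)‖ = 1 := DirichletCharacter.unit_norm_eq_one _ _
  rw [this, one_mul]

lemma prim_ne_one {k : ℕ} (hk : 1 < k) {θ : DirichletCharacter ℂ k} (h : θ.IsPrimitive) : θ ≠ 1 := by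
  haveI : NeZero k := ⟨by omega⟩
  rintro rfl
  rw [DirichletCharacter.isPrimitive_def, DirichletCharacter.conductor_one] at h
  omega

lemma completed_ne {k : ℕ} [NeZero k] (hk : 1 < k) {θ : DirichletCharacter ℂ k} (h : θ.IsPrimitive) :
    DirichletCharacter.completedLFunction θ 2 ≠ 0 := by
  intro h0
  have h1 := DirichletCharacter.LFunction_eq_completed_div_gammaFactor θ 2 (Or.inl two_ne_zero)
  rw [h0, zero_div] at h1
  exact DirichletCharacter.LFunction_ne_zero_of_one_le_re θ (Or.inl (prim_ne_one hk h)) (by norm_num) h1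

lemma root_mul {k : ℕ} [NeZero k] (hk : 1 < k) {θ : DirichletCharacter ℂ k} (h : θ.IsPrimitive) :
    θ.rootNumber * θ⁻¹.rootNumber = 1 := by
  have h1 := DirichletCharacter.IsPrimitive.completedLFunction_one_sub h 2
  have h2 := DirichletCharacter.IsPrimitive.completedLFunction_one_sub (inv_primitive h) (1 - 2)
  rw [inv_inv, h1, sub_sub_cancel] at h2
  have h3 := completed_ne hk (inv_primitive h)
  have hk0 : (k : ℂ) ≠ 0 := by exact_mod_cast NeZero.ne k
  have h4 : (k : ℂ) ^ ((1 - 2 : ℂ) - 1 / 2) * (k : ℂ) ^ ((2 : ℂ) - 1 / 2) = 1 := by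
    rw [← Complex.cpow_add _ _ hk0]; norm_num
  have : θ⁻¹.completedLFunction 2 * (θ.rootNumber * θ⁻¹.rootNumber) = θ⁻¹.completedLFunction 2 := by
    conv_rhs => rw [h2]
    linear_combination (-(θ.rootNumber * θ⁻¹.rootNumber) * θ⁻¹.completedLFunction 2) * h4
  exact mul_left_cancel₀ h3 (by rw [this, mul_one])

lemma norm_root_eq {k : ℕ} [NeZero k] (θ : DirichletCharacter ℂ k) :
    ‖θ.rootNumber‖ = ‖gaussSum θ ZMod.stdAddChar‖ / Real.sqrt k := by
  have : ‖(k : ℂ) ^ (1 / 2 : ℂ)‖ = Real.sqrt k := by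
    rw [Complex.norm_natCast_cpow_of_pos (NeZero.pos k), Real.sqrt_eq_rpow]; simp
  rw [DirichletCharacter.rootNumber, norm_div, norm_div, this]
  split_ifs <;> simp

lemma norm_tau {k : ℕ} [NeZero k] (hk : 1 < k) {θ : DirichletCharacter ℂ k} (h : θ.IsPrimitive) :
    ‖tauSum θ‖ = Real.sqrt k := by
  have h1 := congrArg norm (root_mul hk h)
  rw [norm_mul, norm_root_eq, norm_root_eq, norm_gauss_inv, norm_one, ← tauSum_eq] at h1
  have h2 : 0 < Real.sqrt k := Real.sqrt_pos.mpr (by exact_mod_cast NeZero.pos k)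
  have h3 : (‖tauSum θ‖ / Real.sqrt k) = 1 := by
    have : 0 ≤ ‖tauSum θ‖ / Real.sqrt k := by positivity
    nlinarith
  rwa [div_eq_one_iff_eq h2.ne'] at h3

/-- Parity parameter. -/
def par {k : ℕ} (θ : DirichletCharacter ℂ k) : ℝ := if θ (-1) = 1 then 0 else 1

lemma par_cases {k : ℕ} (θ : DirichletCharacter ℂ k) : par θ = 0 ∨ par θ = 1 := by
  unfold par; split_ifs <;> simp

lemma gammaFactor_eq {k : ℕ} (θ : DirichletCharacter ℂ k) (s : ℂ) :
    θ.gammaFactor s = (Real.pi : ℂ) ^ (-(s + par θ) / 2) * Complex.Gamma ((s + par θ) / 2) := by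
  rcases θ.even_or_odd with h | h
  · have h' : par θ = 0 := by rw [par, if_pos (show θ (-1) = 1 from h)]
    rw [h.gammaFactor_def, h', Complex.Gammaℝ_def]; simp
  · have hne : ¬ θ (-1) = 1 := by
      rw [show θ (-1) = -1 from h]; norm_num
    have h' : par θ = 1 := by rw [par, if_neg hne]
    rw [h.gammaFactor_def, h', Complex.Gammaℝ_def]; simp

lemma Zfun_eq {k : ℕ} (θ : DirichletCharacter ℂ k) (s : ℂ) :
    Zfun θ s = (-Complex.I) ^ (if θ.Even then 0 else 1) * tauSum θ * (Real.pi : ℂ) ^ (s - 1 / 2) * (k : ℂ) ^ (-s) *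
      Complex.Gamma ((1 - s + par θ) / 2) / Complex.Gamma ((s + par θ) / 2) := by
  unfold Zfun par
  by_cases h : θ (-1) = 1
  · have h' : θ.Even := h
    rw [if_pos h, if_pos h, if_pos h']; simp
  · have h' : ¬ θ.Even := h
    rw [if_neg h, if_neg h, if_neg h']; push_cast
    rw [pow_one, show 1 - s + 1 = 2 - s by ring, add_comm s 1]

lemma Gamma_ne' (z : ℂ) (h : z.im ≠ 0) : Complex.Gamma z ≠ 0 := by
  have := Gamma_ne z.re z.im h
  rwa [Complex.re_add_im] at this

lemma FE {k : ℕ} [NeZero k] {θ : DirichletCharacter ℂ k} (h : θ.IsPrimitive) (s : ℂ)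
    (hs : s.im ≠ 0) :
    DirichletCharacter.LFunction θ s = Zfun θ s * DirichletCharacter.LFunction θ⁻¹ (1 - s) := by
  have h1 := DirichletCharacter.IsPrimitive.completedLFunction_one_sub h (1 - s)
  rw [sub_sub_cancel] at h1
  have hs0 : s ≠ 0 := by rintro rfl; simp at hs
  have hs1 : 1 - s ≠ 0 := by
    intro h; apply hs; have := congrArg Complex.im h; simpa using this
  rw [DirichletCharacter.LFunction_eq_completed_div_gammaFactor θ s (Or.inl hs0),
    DirichletCharacter.LFunction_eq_completed_div_gammaFactor θ⁻¹ (1 - s) (Or.inl hs1), h1,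
    gammaFactor_eq, gammaFactor_eq, Zfun_eq, DirichletCharacter.rootNumber, ← tauSum_eq]
  have hp : par θ⁻¹ = par θ := by
    unfold par
    have := even_inv θ
    rw [DirichletCharacter.Even, DirichletCharacter.Even] at this
    simp only [this]
  rw [hp]
  have hk0 : (k : ℂ) ≠ 0 := by exact_mod_cast NeZero.ne k
  have hpi : (Real.pi : ℂ) ≠ 0 := by exact_mod_cast Real.pi_ne_zero
  have hG1 : Complex.Gamma ((s + par θ) / 2) ≠ 0 := Gamma_ne' _ (by simpa using hs)
  have hG2 : Complex.Gamma ((1 - s + par θ) / 2) ≠ 0 := Gamma_ne' _ (by simpa using hs)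
  have e1 : (k : ℂ) ^ (1 - s - 1 / 2) = (k : ℂ) ^ (-s) * (k : ℂ) ^ (1 / 2 : ℂ) := by
    rw [← Complex.cpow_add _ _ hk0]; ring_nf
  have e2 : (Real.pi : ℂ) ^ (-(1 - s + par θ) / 2) = (Real.pi : ℂ) ^ (s - 1 / 2) * (Real.pi : ℂ) ^ (-(s + par θ) / 2) := by
    rw [← Complex.cpow_add _ _ hpi]; ring_nf
  have n1 : (Real.pi : ℂ) ^ (s - 1 / 2) ≠ 0 := by simp [Complex.cpow_eq_zero_iff, hpi]
  have n2 : (Real.pi : ℂ) ^ (-(s + par θ) / 2) ≠ 0 := by simp [Complex.cpow_eq_zero_iff, hpi]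
  have n3 : (k : ℂ) ^ (1 / 2 : ℂ) ≠ 0 := by simp [Complex.cpow_eq_zero_iff, hk0]
  have e3 : (-Complex.I) ^ (if θ.Even then 0 else 1) = 1 / Complex.I ^ (if θ.Even then 0 else 1) := by
    split_ifs <;> simp
  have n4 : Complex.I ^ (if θ.Even then 0 else 1) ≠ 0 := pow_ne_zero _ Complex.I_ne_zero
  rw [e1, e2, e3]
  field_simp

lemma Zfun_ne {k : ℕ} [NeZero k] (hk : 1 < k) {θ : DirichletCharacter ℂ k} (h : θ.IsPrimitive) (s : ℂ)
    (hs : s.im ≠ 0) : Zfun θ s ≠ 0 := by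
  have hk0 : (k : ℂ) ≠ 0 := by exact_mod_cast NeZero.ne k
  have hpi : (Real.pi : ℂ) ≠ 0 := by exact_mod_cast Real.pi_ne_zero
  have hG1 : Complex.Gamma ((s + par θ) / 2) ≠ 0 := Gamma_ne' _ (by simpa using hs)
  have hG2 : Complex.Gamma ((1 - s + par θ) / 2) ≠ 0 := Gamma_ne' _ (by simpa using hs)
  have n1 : (Real.pi : ℂ) ^ (s - 1 / 2) ≠ 0 := by simp [Complex.cpow_eq_zero_iff, hpi]
  have n3 : (k : ℂ) ^ (-s) ≠ 0 := by simp [Complex.cpow_eq_zero_iff, hk0]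
  have ht : tauSum θ ≠ 0 := by
    rw [← norm_pos_iff, norm_tau hk h, Real.sqrt_pos]
    exact_mod_cast NeZero.pos k
  have n4 : (-Complex.I) ^ (if θ.Even then 0 else 1) ≠ 0 := pow_ne_zero _ (by simp)
  rw [Zfun_eq]
  positivity

lemma Zfun_diff {k : ℕ} [NeZero k] (θ : DirichletCharacter ℂ k) (s : ℂ)
    (hs : s.im ≠ 0) : DifferentiableAt ℂ (Zfun θ) s := by
  have hk0 : (k : ℂ) ≠ 0 := by exact_mod_cast NeZero.ne k
  have hpi : (Real.pi : ℂ) ≠ 0 := by exact_mod_cast Real.pi_ne_zero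
  have hG1 : Complex.Gamma ((s + par θ) / 2) ≠ 0 := Gamma_ne' _ (by simpa using hs)
  rw [show Zfun θ = fun s => _ from funext (Zfun_eq θ)]
  have aux : ∀ z : ℂ, z.im ≠ 0 → DifferentiableAt ℂ Complex.Gamma z := by
    intro z hz
    apply Complex.differentiableAt_Gamma
    intro m hm
    apply hz; rw [hm]; simp
  have d1 : DifferentiableAt ℂ (fun s : ℂ => Complex.Gamma ((s + par θ) / 2)) s :=
    (aux _ (by simpa using hs)).comp s (by fun_prop : DifferentiableAt ℂ (fun s : ℂ => (s + par θ) / 2) s)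
  have d2 : DifferentiableAt ℂ (fun s : ℂ => Complex.Gamma ((1 - s + par θ) / 2)) s :=
    (aux _ (by simpa using hs)).comp s (by fun_prop : DifferentiableAt ℂ (fun s : ℂ => (1 - s + par θ) / 2) s)
  have d3 : DifferentiableAt ℂ (fun s : ℂ => (Real.pi : ℂ) ^ (s - 1 / 2)) s :=
    DifferentiableAt.const_cpow (by fun_prop) (Or.inl hpi)
  have d4 : DifferentiableAt ℂ (fun s : ℂ => (k : ℂ) ^ (-s)) s :=
    DifferentiableAt.const_cpow (by fun_prop) (Or.inl hk0)
  exact ((((d3.const_mul _).mul d4).mul d2).div d1 hG1)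

lemma Zfun_norm {k : ℕ} [NeZero k] (hk : 1 < k) {θ : DirichletCharacter ℂ k} (h : θ.IsPrimitive) (s : ℂ)
    (hs : 20 ≤ |s.im|) (hσ : |s.re - 1 / 2| ≤ 6) :
    |Real.log ‖Zfun θ s‖ + (s.re - 1 / 2) * Real.log (k / Real.pi)| ≤
      |s.re - 1 / 2| * (Real.log (|s.im| / 2 + 4) + 20 * KK) := by
  have hs0 : s.im ≠ 0 := by rintro h; rw [h] at hs; norm_num at hs
  have hkp : (0:ℝ) < k := by exact_mod_cast NeZero.pos k
  have hG1 : Complex.Gamma ((s + par θ) / 2) ≠ 0 := Gamma_ne' _ (by simpa using hs0)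
  have hG2 : Complex.Gamma ((1 - s + par θ) / 2) ≠ 0 := Gamma_ne' _ (by simpa using hs0)
  have e0 : ‖(-Complex.I) ^ (if θ.Even then 0 else 1)‖ = 1 := by split_ifs <;> simp
  have n1 : ‖(Real.pi : ℂ) ^ (s - 1 / 2)‖ = Real.pi ^ (s.re - 1 / 2) := by
    rw [Complex.norm_cpow_eq_rpow_re_of_pos Real.pi_pos]; simp
  have n3 : ‖(k : ℂ) ^ (-s)‖ = (k:ℝ) ^ (-s.re) := by
    rw [Complex.norm_natCast_cpow_of_pos (NeZero.pos k)]; simp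
  set a := par θ with ha
  have ha01 : 0 ≤ a ∧ a ≤ 1 := by rcases par_cases θ with h | h <;> rw [ha, h] <;> norm_num
  have g1 : ‖Complex.Gamma ((s + a) / 2)‖ = ‖Complex.Gamma (((s.re + a) / 2 : ℝ) + (s.im / 2 : ℝ) * Complex.I)‖ := by
    congr 2
    apply Complex.ext <;> simp
  have g2 : ‖Complex.Gamma ((1 - s + a) / 2)‖ = ‖Complex.Gamma (((1 - s.re + a) / 2 : ℝ) + (s.im / 2 : ℝ) * Complex.I)‖ := by
    rw [← Complex.norm_conj, ← Complex.Gamma_conj]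
    congr 2
    have h2 : (starRingEnd ℂ) 2 = 2 := Complex.conj_eq_iff_real.mpr ⟨2, by simp⟩
    apply Complex.ext <;> simp [h2]
  have hlog : Real.log ‖Zfun θ s‖ + (s.re - 1 / 2) * Real.log (k / Real.pi) =
      Real.log ‖Complex.Gamma ((1 - s + a) / 2)‖ - Real.log ‖Complex.Gamma ((s + a) / 2)‖ := by
    have p1 : ‖Complex.Gamma ((1 - s + a) / 2)‖ ≠ 0 := by simpa using hG2
    have p2 : ‖Complex.Gamma ((s + a) / 2)‖ ≠ 0 := by simpa using hG1
    have p3 : Real.pi ^ (s.re - 1 / 2) ≠ 0 := (Real.rpow_pos_of_pos Real.pi_pos _).ne'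
    have p4 : (k:ℝ) ^ (-s.re) ≠ 0 := (Real.rpow_pos_of_pos hkp _).ne'
    have p5 : Real.sqrt k ≠ 0 := (Real.sqrt_pos.mpr hkp).ne'
    rw [Zfun_eq, norm_div, norm_mul, norm_mul, norm_mul, norm_mul, e0, n1, n3, norm_tau hk h, one_mul,
      Real.log_div (by positivity) p2, Real.log_mul (by positivity) p1, Real.log_mul (by positivity) p4,
      Real.log_mul p5 p3, Real.log_rpow Real.pi_pos, Real.log_rpow hkp, Real.log_sqrt hkp.le,
      Real.log_div hkp.ne' Real.pi_ne_zero]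
    ring
  rw [hlog, g1, g2]
  have hy : 10 ≤ |s.im / 2| := by rw [abs_div, abs_two]; linarith
  obtain ⟨hσ1, hσ2⟩ := abs_le.mp hσ
  have hab : |s.im / 2| = |s.im| / 2 := by rw [abs_div, abs_two]
  rcases le_total (1/2) s.re with hc | hc
  · have := logGamma_slope (s.im / 2) hy ((1 - s.re + a) / 2) ((s.re + a) / 2) (by linarith) (by linarith) (by linarith)
    rw [hab] at this
    rw [abs_sub_comm, abs_of_nonneg (by linarith : 0 ≤ s.re - 1 / 2)]
    refine this.trans (le_of_eq ?_)
    ring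
  · have := logGamma_slope (s.im / 2) hy ((s.re + a) / 2) ((1 - s.re + a) / 2) (by linarith) (by linarith) (by linarith)
    rw [hab] at this
    rw [abs_of_nonpos (by linarith : s.re - 1 / 2 ≤ 0)]
    refine this.trans (le_of_eq ?_)
    ring
end PartNo2

section PartNo3

lemma theta_zero {k : ℕ} (hk : 1 < k) (θ : DirichletCharacter ℂ k) : θ 0 = 0 := by
  have : Fact (1 < k) := ⟨hk⟩
  have : Nontrivial (ZMod k) := inferInstance
  exact MulChar.map_zero θ

lemma sum_period {k : ℕ} [NeZero k] {θ : DirichletCharacter ℂ k} (h1 : θ ≠ 1) :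
    ∑ a ∈ Finset.range k, θ (a : ZMod k) = 0 := by
  rw [← MulChar.sum_eq_zero_of_ne_one h1]
  refine Finset.sum_nbij' (fun a => (a : ZMod k)) (fun a => a.val) ?_ ?_ ?_ ?_ ?_
  · simp
  · intro a _; simpa using ZMod.val_lt a
  · intro a ha; simpa using ZMod.val_cast_of_lt (by simpa using ha)
  · intro a _; simp
  · intro a _; rfl

lemma sum_range_bound {k : ℕ} [NeZero k] {θ : DirichletCharacter ℂ k} (h1 : θ ≠ 1) (N : ℕ) :
    ‖∑ a ∈ Finset.range N, θ (a : ZMod k)‖ ≤ k := by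
  induction N using Nat.strong_induction_on with
  | _ N ih =>
    by_cases h : N < k
    · refine (norm_sum_le _ _).trans ?_
      refine (Finset.sum_le_card_nsmul _ _ 1 (fun a _ => θ.norm_le_one _)).trans ?_
      simp; omega
    · obtain ⟨M, rfl⟩ := Nat.exists_eq_add_of_le (not_lt.mp h)
      rw [Finset.sum_range_add, sum_period h1, zero_add]
      have := ih M (by have := NeZero.pos k; omega)
      simpa using this

lemma sum_Icc_bound {k : ℕ} [NeZero k] (hk : 1 < k) {θ : DirichletCharacter ℂ k} (h1 : θ ≠ 1) (N : ℕ) :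
    ‖∑ a ∈ Finset.Icc 1 N, θ (a : ZMod k)‖ ≤ k := by
  have : ∑ a ∈ Finset.Icc 1 N, θ (a : ZMod k) = ∑ a ∈ Finset.range (N+1), θ (a : ZMod k) := by
    rw [Finset.sum_range_succ', Nat.cast_zero, theta_zero hk, add_zero]
    rw [Finset.range_eq_Ico, Finset.sum_Ico_add' (fun a : ℕ => θ (a : ZMod k)) 0 N 1]
    rfl
  rw [this]; exact sum_range_bound h1 _

open Filter Topology Asymptotics MeasureTheory in
lemma L_rep {k : ℕ} [NeZero k] (hk : 1 < k) {θ : DirichletCharacter ℂ k} (h1 : θ ≠ 1) (s : ℂ) (hs : 0 < s.re) :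
    DirichletCharacter.LFunction θ s =
      s * mellin (fun t : ℝ => ∑ a ∈ Finset.Icc 1 ⌊t⌋₊, θ (a : ZMod k)) (-s) := by
  set S : ℝ → ℂ := fun t : ℝ => ∑ a ∈ Finset.Icc 1 ⌊t⌋₊, θ (a : ZMod k) with hS
  have hSb : ∀ t, ‖S t‖ ≤ k := fun t => sum_Icc_bound hk h1 _
  have hmeas : Measurable S :=
    (measurable_of_countable (f := fun n : ℕ => ∑ a ∈ Finset.Icc 1 n, θ (a : ZMod k))).comp Nat.measurable_floor
  have hS0 : ∀ t < 1, S t = 0 := by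
    intro t ht
    simp [hS, Nat.floor_eq_zero.mpr ht]
  have hloc : LocallyIntegrableOn S (Set.Ioi 0) := by
    apply LocallyIntegrable.locallyIntegrableOn
    have : LocallyIntegrable (fun _ : ℝ => (k:ℝ)) := locallyIntegrable_const _
    exact this.mono hmeas.aestronglyMeasurable (ae_of_all _ fun t => by simpa using hSb t)
  have hU : IsOpen {z : ℂ | 0 < z.re} := isOpen_lt continuous_const Complex.continuous_re
  have hd : DifferentiableOn ℂ (fun s => s * mellin S (-s)) {z : ℂ | 0 < z.re} := by
    intro z hz
    have : DifferentiableAt ℂ (mellin S) (-z) := by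
      refine mellin_differentiableAt_of_isBigO_rpow (a := 0) (b := -z.re - 1) hloc ?_ ?_ ?_ ?_
      · simp only [neg_zero, Real.rpow_zero]
        exact IsBigO.of_bound k (Eventually.of_forall fun t => by simpa using hSb t)
      · simpa using hz
      · refine IsBigO.of_bound 1 ?_
        have : Set.Iio (1:ℝ) ∈ 𝓝[>] (0:ℝ) := mem_nhdsWithin_of_mem_nhds (Iio_mem_nhds one_pos)
        filter_upwards [this] with t ht
        rw [hS0 t ht]; simp
      · simp
    have h2 : DifferentiableAt ℂ (fun s => s * mellin S (-s)) z :=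
      differentiableAt_id.mul (this.comp z differentiableAt_id.neg)
    exact h2.differentiableWithinAt
  have hpc : IsPreconnected {z : ℂ | 0 < z.re} := (convex_halfSpace_re_gt 0).isPreconnected
  refine AnalyticOnNhd.eqOn_of_preconnected_of_eventuallyEq (z₀ := 2)
    ((DirichletCharacter.differentiable_LFunction h1).differentiableOn.analyticOnNhd hU)
    (hd.analyticOnNhd hU) hpc (by simp) ?_ hs
  have : {z : ℂ | 1 < z.re} ∈ 𝓝 (2:ℂ) := (isOpen_lt continuous_const Complex.continuous_re).mem_nhds (by simp)
  filter_upwards [this] with z hz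
  have hz : 1 < z.re := hz
  rw [DirichletCharacter.LFunction_eq_LSeries θ hz,
    LSeries_eq_mul_integral (r := 0) (fun n => θ (n : ZMod k)) le_rfl (by linarith)
      (DirichletCharacter.LSeriesSummable_of_one_lt_re θ hz)]
  · congr 1
    symm
    rw [mellin, setIntegral_eq_of_subset_of_forall_sdiff_eq_zero (s := Set.Ici (1:ℝ)) measurableSet_Ioi, integral_Ici_eq_integral_Ioi]
    · apply setIntegral_congr_fun measurableSet_Ioi
      intro t ht
      show _ • _ = _
      rw [smul_eq_mul, mul_comm, show -(z + 1) = -z - 1 by ring]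
    · intro t ht
      have : (1:ℝ) ≤ t := ht
      show 0 < t
      linarith
    · intro t ht
      have : t < 1 := by simpa using ht.2
      rw [hS0 t this, smul_zero]
  · simp only [Real.rpow_zero]
    exact IsBigO.of_bound k (Eventually.of_forall fun t => by simpa using sum_Icc_bound hk h1 t)

open MeasureTheory in
lemma L_bound {k : ℕ} [NeZero k] (hk : 1 < k) {θ : DirichletCharacter ℂ k} (h1 : θ ≠ 1) (s : ℂ) (hs : 1/2 ≤ s.re) :
    ‖DirichletCharacter.LFunction θ s‖ ≤ 2 * k * ‖s‖ := by
  rw [L_rep hk h1 s (by linarith), norm_mul, mul_comm]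
  refine mul_le_mul_of_nonneg_right ?_ (norm_nonneg _)
  rw [mellin, setIntegral_eq_of_subset_of_forall_sdiff_eq_zero (s := Set.Ici (1:ℝ)) measurableSet_Ioi, integral_Ici_eq_integral_Ioi]
  · have hintg : IntegrableOn (fun t : ℝ => t ^ (-s.re - 1)) (Set.Ioi 1) :=
      integrableOn_Ioi_rpow_of_lt (by linarith) one_pos
    refine (norm_integral_le_of_norm_le (g := fun t : ℝ => k * t ^ (-s.re - 1)) (hintg.const_mul _) ?_).trans ?_
    · filter_upwards [ae_restrict_mem measurableSet_Ioi] with t ht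
      have ht0 : (0:ℝ) < t := lt_trans one_pos ht
      rw [norm_smul, Complex.norm_cpow_eq_rpow_re_of_pos ht0, mul_comm]
      simp only [Complex.sub_re, Complex.neg_re, Complex.one_re]
      exact mul_le_mul_of_nonneg_right (sum_Icc_bound hk h1 _) (by positivity)
    · rw [integral_const_mul, integral_Ioi_rpow_of_lt (by linarith) one_pos]
      have : (0:ℝ) ≤ k := by positivity
      rw [mul_comm (2:ℝ)]
      refine mul_le_mul_of_nonneg_left ?_ this
      simp only [sub_add_cancel, Real.one_rpow, neg_div_neg_eq]
      rw [div_le_iff₀ (by linarith)]; linarith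
  · intro t ht
    have : (1:ℝ) ≤ t := ht
    show 0 < t
    linarith
  · intro t ht
    have : t < 1 := by simpa using ht.2
    simp [Nat.floor_eq_zero.mpr this]

lemma char_inv_conj {k : ℕ} (θ : DirichletCharacter ℂ k) (a : ZMod k) :
    θ⁻¹ a = (starRingEnd ℂ) (θ a) := by
  rw [← MulChar.star_eq_inv, MulChar.star_apply]; rfl

lemma conj_nat_cpow (n : ℕ) (z : ℂ) :
    (n : ℂ) ^ ((starRingEnd ℂ) z) = (starRingEnd ℂ) ((n : ℂ) ^ z) := by
  rw [Complex.cpow_conj _ _ (by rw [Complex.natCast_arg]; exact Real.pi_pos.ne), Complex.conj_natCast]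

open Filter Topology in
lemma L_conj {k : ℕ} [NeZero k] {θ : DirichletCharacter ℂ k} (h1 : θ ≠ 1) (s : ℂ) :
    (starRingEnd ℂ) (DirichletCharacter.LFunction θ ((starRingEnd ℂ) s)) = DirichletCharacter.LFunction θ⁻¹ s := by
  have h2 : θ⁻¹ ≠ 1 := by simpa using h1
  have hd : Differentiable ℂ (fun s => (starRingEnd ℂ) (DirichletCharacter.LFunction θ ((starRingEnd ℂ) s))) := by
    intro z
    have := (DirichletCharacter.differentiable_LFunction h1) ((starRingEnd ℂ) z)
    have h := this.conj_conj
    rw [Complex.conj_conj] at h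
    exact h
  have := AnalyticOnNhd.eq_of_eventuallyEq (z₀ := (2:ℂ))
    (hd.differentiableOn.analyticOnNhd isOpen_univ)
    ((DirichletCharacter.differentiable_LFunction h2).differentiableOn.analyticOnNhd isOpen_univ) ?_
  · exact congrFun this s
  have : {z : ℂ | 1 < z.re} ∈ 𝓝 (2:ℂ) := (isOpen_lt continuous_const Complex.continuous_re).mem_nhds (by simp)
  filter_upwards [this] with z hz
  have hz : 1 < z.re := hz
  rw [DirichletCharacter.LFunction_eq_LSeries θ (by simpa using hz), DirichletCharacter.LFunction_eq_LSeries θ⁻¹ hz,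
    LSeries, LSeries, Complex.conj_tsum]
  congr 1
  ext n
  rcases eq_or_ne n 0 with rfl | hn
  · simp
  · rw [LSeries.term_of_ne_zero hn, LSeries.term_of_ne_zero hn, map_div₀, char_inv_conj, ← conj_nat_cpow, Complex.conj_conj]
end PartNo3

section PartNo4

open Complex in
lemma rect_identity (f : ℂ → ℂ) (a b H : ℝ) (hab : a ≤ b) (hH : 0 ≤ H)
    (hd : DifferentiableOn ℂ f (Set.Icc a b ×ℂ Set.Icc (-H) H)) :
    (∫ x in a..b, f (x + ((-H : ℝ) : ℂ) * I)) - (∫ x in a..b, f (x + (H : ℂ) * I)) +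
      I * (∫ y in (-H)..H, f (b + y * I)) - I * (∫ y in (-H)..H, f (a + y * I)) = 0 := by
  have := integral_boundary_rect_eq_zero_of_differentiableOn f ⟨a, -H⟩ ⟨b, H⟩ (by
    simpa [Set.uIcc_of_le hab, Set.uIcc_of_le (by linarith : -H ≤ H)] using hd)
  simpa using this

open Complex in
lemma horiz_bound (f : ℂ → ℂ) (a b H M : ℝ) (hab : a ≤ b)
    (hM : ∀ x ∈ Set.Icc a b, ‖f (x + ((-H : ℝ) : ℂ) * I)‖ ≤ M ∧ ‖f (x + (H : ℂ) * I)‖ ≤ M) :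
    ‖(∫ x in a..b, f (x + ((-H : ℝ) : ℂ) * I)) - (∫ x in a..b, f (x + (H : ℂ) * I))‖ ≤ 2 * (b - a) * M := by
  have h1 : ‖∫ x in a..b, f (x + ((-H : ℝ) : ℂ) * I)‖ ≤ M * |b - a| :=
    intervalIntegral.norm_integral_le_of_norm_le_const fun x hx => by
      rw [Set.uIoc_of_le hab] at hx
      exact (hM x ⟨hx.1.le, hx.2⟩).1
  have h2 : ‖∫ x in a..b, f (x + (H : ℂ) * I)‖ ≤ M * |b - a| :=
    intervalIntegral.norm_integral_le_of_norm_le_const fun x hx => by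
      rw [Set.uIoc_of_le hab] at hx
      exact (hM x ⟨hx.1.le, hx.2⟩).2
  rw [abs_of_nonneg (by linarith)] at h1 h2
  refine (norm_sub_le _ _).trans ?_
  linarith

open Complex in
lemma rect_shift (f : ℂ → ℂ) (a b H M : ℝ) (hab : a ≤ b) (hH : 0 ≤ H)
    (hd : DifferentiableOn ℂ f (Set.Icc a b ×ℂ Set.Icc (-H) H))
    (hM : ∀ x ∈ Set.Icc a b, ‖f (x + ((-H : ℝ) : ℂ) * I)‖ ≤ M ∧ ‖f (x + (H : ℂ) * I)‖ ≤ M) :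
    ‖(∫ y in (-H)..H, f (b + y * I)) - (∫ y in (-H)..H, f (a + y * I))‖ ≤ 2 * (b - a) * M := by
  have h1 := rect_identity f a b H hab hH hd
  have h2 := horiz_bound f a b H M hab hM
  have h3 : I * ((∫ y in (-H)..H, f (b + y * I)) - (∫ y in (-H)..H, f (a + y * I))) =
    -((∫ x in a..b, f (x + ((-H : ℝ) : ℂ) * I)) - (∫ x in a..b, f (x + (H : ℂ) * I))) := by
    linear_combination h1
  have h4 := congrArg norm h3
  rw [norm_mul, norm_I, one_mul, norm_neg] at h4
  rw [h4]; exact h2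

open Complex in
lemma log_neg_up (w : ℂ) (hw : 0 < w.im) : Complex.log (-w) = Complex.log w - Real.pi * I := by
  rw [Complex.log, Complex.log, norm_neg, arg_neg_eq_arg_sub_pi_of_im_pos hw]; push_cast; ring

open Complex in
lemma log_neg_down (w : ℂ) (hw : w.im < 0) : Complex.log (-w) = Complex.log w + Real.pi * I := by
  rw [Complex.log, Complex.log, norm_neg, arg_neg_eq_arg_add_pi_of_im_neg hw]; push_cast; ring

open Complex in
lemma ftc_log (u v : ℝ) (z w : ℂ) (huv : u ≤ v) (h : ∀ x ∈ Set.Icc u v, z + x * w ∈ slitPlane) :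
    ∫ x in u..v, w / (z + x * w) = Complex.log (z + v * w) - Complex.log (z + u * w) := by
  have hder : ∀ x ∈ Set.uIcc u v, HasDerivAt (fun x : ℝ => Complex.log (z + x * w)) (w / (z + x * w)) x := by
    intro x hx
    rw [Set.uIcc_of_le huv] at hx
    have h1 : HasDerivAt (fun x : ℝ => z + (x:ℂ) * w) w x := by
      have := ((hasDerivAt_id x).ofReal_comp.mul_const w).const_add z
      simpa using this
    exact h1.clog_real (h x hx)
  have hcont : IntervalIntegrable (fun x : ℝ => w / (z + x * w)) MeasureTheory.volume u v := by
    apply ContinuousOn.intervalIntegrable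
    rw [Set.uIcc_of_le huv]
    apply ContinuousOn.div continuousOn_const (by fun_prop)
    intro x hx
    exact slitPlane_ne_zero (h x hx)
  exact intervalIntegral.integral_eq_sub_of_hasDerivAt hder hcont

open Complex in
lemma rect_inv (a b H : ℝ) (ha : a < 0) (hb : 0 < b) (hH : 0 < H) :
    (∫ x in a..b, 1 / ((x : ℂ) + ((-H : ℝ) : ℂ) * I)) - (∫ x in a..b, 1 / ((x : ℂ) + (H : ℂ) * I)) +
      I * (∫ y in (-H)..H, 1 / ((b : ℂ) + y * I)) - I * (∫ y in (-H)..H, 1 / ((a : ℂ) + y * I)) = 2 * Real.pi * I := by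
  have h1 := ftc_log a b (((-H : ℝ) : ℂ) * I) 1 (by linarith) (fun x _ => by
    right; simp; linarith)
  have h2 := ftc_log a b ((H : ℂ) * I) 1 (by linarith) (fun x _ => by
    right; simp; linarith)
  have h3 := ftc_log (-H) H b I (by linarith) (fun x _ => by left; simpa using hb)
  have h4 := ftc_log (-H) H (-a) (-I) (by linarith) (fun x _ => by left; simpa using ha)
  simp only [mul_one] at h1 h2
  have e1 : ∫ x in a..b, 1 / ((x : ℂ) + ((-H : ℝ) : ℂ) * I) = Complex.log (((-H : ℝ) : ℂ) * I + b) - Complex.log (((-H : ℝ) : ℂ) * I + a) := by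
    rw [← h1]; simp_rw [add_comm]
  have e2 : ∫ x in a..b, 1 / ((x : ℂ) + ((H : ℝ) : ℂ) * I) = Complex.log ((H : ℂ) * I + b) - Complex.log ((H : ℂ) * I + a) := by
    rw [← h2]; simp_rw [add_comm]
  have e3 : I * (∫ y in (-H)..H, 1 / ((b : ℂ) + y * I)) = Complex.log (b + H * I) - Complex.log (b + ((-H : ℝ) : ℂ) * I) := by
    rw [← intervalIntegral.integral_const_mul]
    simp_rw [mul_one_div]; exact h3
  have e4 : I * (∫ y in (-H)..H, 1 / ((a : ℂ) + y * I)) = Complex.log (-a + H * (-I)) - Complex.log (-a + ((-H : ℝ) : ℂ) * (-I)) := by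
    rw [← intervalIntegral.integral_const_mul]
    simp_rw [mul_one_div]
    rw [← h4]
    congr 1; ext y
    rw [← neg_div_neg_eq]; congr 1; ring
  rw [e1, e2, e3, e4]
  have l1 := log_neg_up (a + H * I) (by simpa using hH)
  have l2 := log_neg_down (a - H * I) (by simpa using hH)
  rw [show -(a:ℂ) + (H:ℂ) * (-I) = -(a + H * I) by ring, l1,
    show -(a:ℂ) + ((-H:ℝ):ℂ) * (-I) = -(a - H * I) by push_cast; ring, l2,
    show (((-H:ℝ):ℂ) * I + b) = b + ((-H:ℝ):ℂ) * I by ring,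
    show (((-H:ℝ):ℂ) * I + a) = a - H * I by push_cast; ring,
    show ((H:ℂ) * I + b) = b + H * I by ring, show ((H:ℂ) * I + a) = a + H * I by ring]
  ring

open Complex in
lemma rect_pole (φ : ℂ → ℂ) (a b H M : ℝ) (ha : a < 0) (hb : 0 < b) (hH : 0 < H)
    (hd : DifferentiableOn ℂ φ (Set.Icc a b ×ℂ Set.Icc (-H) H))
    (hM : ∀ x ∈ Set.Icc a b, ‖φ (x + ((-H : ℝ) : ℂ) * I) / (x + ((-H : ℝ) : ℂ) * I)‖ ≤ M ∧
       ‖φ (x + (H : ℂ) * I) / (x + (H : ℂ) * I)‖ ≤ M) :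
    ‖(∫ y in (-H)..H, φ (b + y * I) / (b + y * I)) - (∫ y in (-H)..H, φ (a + y * I) / (a + y * I)) - 2 * Real.pi * φ 0‖
      ≤ 2 * (b - a) * M := by
  have hab : a ≤ b := by linarith
  set R := Set.Icc a b ×ℂ Set.Icc (-H) H with hR
  have hnhds : R ∈ nhds (0:ℂ) := by
    have : Set.Ioo a b ×ℂ Set.Ioo (-H) H ∈ nhds (0:ℂ) :=
      (isOpen_Ioo.reProdIm isOpen_Ioo).mem_nhds (by simp [mem_reProdIm, ha, hb, hH])
    exact Filter.mem_of_superset this (reProdIm_subset_iff.mpr (Set.prod_mono Set.Ioo_subset_Icc_self Set.Ioo_subset_Icc_self))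
  have hds : DifferentiableOn ℂ (dslope φ 0) R := (differentiableOn_dslope hnhds).mpr hd
  have h0 := rect_identity _ a b H hab hH.le hds
  have h1 := rect_inv a b H ha hb hH
  have key : ∀ w : ℂ, w ≠ 0 → φ w / w = dslope φ 0 w + φ 0 * (1 / w) := by
    intro w hw
    rw [dslope_of_ne _ hw, slope_def_field, sub_zero]; field_simp; ring
  have hsplit : ∀ (u v : ℝ) (z w : ℂ), (∀ x ∈ Set.uIcc u v, z + x * w ≠ 0) → (∀ x ∈ Set.uIcc u v, z + x * w ∈ R) →
      ∫ x in u..v, φ (z + x * w) / (z + x * w) =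
        (∫ x in u..v, dslope φ 0 (z + x * w)) + φ 0 * ∫ x in u..v, 1 / (z + x * w) := by
    intro u v z w hz hzR
    rw [← intervalIntegral.integral_const_mul, ← intervalIntegral.integral_add]
    · apply intervalIntegral.integral_congr
      intro x hx
      exact key _ (hz x hx)
    · apply ContinuousOn.intervalIntegrable
      exact hds.continuousOn.comp (by fun_prop) hzR
    · apply ContinuousOn.intervalIntegrable
      apply ContinuousOn.mul continuousOn_const
      exact ContinuousOn.div continuousOn_const (by fun_prop) hz
  have s1 := hsplit a b (((-H:ℝ):ℂ) * I) 1 (fun x _ h => by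
      have := congrArg Complex.im h; simp at this; linarith) (fun x hx => by
      rw [Set.uIcc_of_le hab] at hx
      simp [hR, mem_reProdIm, hx.1, hx.2, hH.le])
  have s2 := hsplit a b ((H:ℂ) * I) 1 (fun x _ h => by
      have := congrArg Complex.im h; simp at this; linarith) (fun x hx => by
      rw [Set.uIcc_of_le hab] at hx
      simp [hR, mem_reProdIm, hx.1, hx.2, hH.le])
  have s3 := hsplit (-H) H b I (fun x _ h => by
      have := congrArg Complex.re h; simp at this; linarith) (fun x hx => by
      rw [Set.uIcc_of_le (by linarith)] at hx
      simp [hR, mem_reProdIm, hx.1, hx.2, hab])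
  have s4 := hsplit (-H) H a I (fun x _ h => by
      have := congrArg Complex.re h; simp at this; linarith) (fun x hx => by
      rw [Set.uIcc_of_le (by linarith)] at hx
      simp [hR, mem_reProdIm, hx.1, hx.2, hab])
  simp only [mul_one] at s1 s2
  have hb' := horiz_bound (fun w => φ w / w) a b H M hab hM
  simp only [add_comm (_ * I)] at s1 s2
  rw [s1, s2] at hb'
  rw [s3, s4]
  set A1 := ∫ x in a..b, dslope φ 0 (x + ((-H : ℝ) : ℂ) * I)
  set A2 := ∫ x in a..b, dslope φ 0 (x + (H : ℂ) * I)
  set A3 := ∫ y in (-H)..H, dslope φ 0 (b + y * I)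
  set A4 := ∫ y in (-H)..H, dslope φ 0 (a + y * I)
  set B1 := ∫ x in a..b, 1 / ((x:ℂ) + ((-H : ℝ) : ℂ) * I)
  set B2 := ∫ x in a..b, 1 / ((x:ℂ) + (H : ℂ) * I)
  set B3 := ∫ y in (-H)..H, 1 / ((b:ℂ) + y * I)
  set B4 := ∫ y in (-H)..H, 1 / ((a:ℂ) + y * I)
  have h3 : I * ((A3 + φ 0 * B3) - (A4 + φ 0 * B4) - 2 * Real.pi * φ 0) =
      -((A1 + φ 0 * B1) - (A2 + φ 0 * B2)) := by
    linear_combination h0 + φ 0 * h1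
  have h4 := congrArg norm h3
  rw [norm_mul, norm_I, one_mul, norm_neg] at h4
  rw [h4]; exact hb'
end PartNo4

section PartNo5

lemma changeLevel_nat {k K : ℕ} (h : k ∣ K) (θ : DirichletCharacter ℂ k) (n : ℕ) (hn : n.Coprime K) :
    DirichletCharacter.changeLevel h θ (n : ZMod K) = θ (n : ZMod k) := by
  have := DirichletCharacter.changeLevel_eq_cast_of_dvd θ h (ZMod.unitOfCoprime n hn)
  rw [ZMod.coe_unitOfCoprime] at this
  rw [this, ZMod.cast_natCast h]

lemma factor_aux (K M N : ℕ) [NeZero M] [NeZero K] (hM : M ∣ K) (hN : N ∣ K) (hcop : M.Coprime N) (hK : K = M * N)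
    (χ : DirichletCharacter ℂ M) (ψ : DirichletCharacter ℂ N) (hχ : χ.IsPrimitive) (d : ℕ)
    (hd : (DirichletCharacter.changeLevel hM χ * DirichletCharacter.changeLevel hN ψ).FactorsThrough d) :
    M ∣ d := by
  obtain ⟨hdK, χ0, h0⟩ := hd
  have hg : Nat.gcd d M ∣ M := Nat.gcd_dvd_right d M
  have hfac : χ.FactorsThrough (Nat.gcd d M) := by
    rw [DirichletCharacter.factorsThrough_iff_ker_unitsMap hg]
    intro a ha
    rw [MonoidHom.mem_ker] at ha ⊢
    set a' := (a : ZMod M).val with ha'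
    have haM : ((a' : ℕ) : ZMod M) = a := ZMod.natCast_zmod_val _
    obtain ⟨n, hn1, hn2⟩ := Nat.chineseRemainder hcop a' 1
    have hcopM : n.Coprime M := by
      have : a'.Coprime M := ZMod.val_coe_unit_coprime a
      exact (hn1.gcd_eq).trans this
    have hcopN : n.Coprime N := by
      have : Nat.gcd n N = Nat.gcd 1 N := hn2.gcd_eq
      rw [Nat.Coprime, this]; simp
    have hcopK : n.Coprime K := by rw [hK]; exact Nat.Coprime.mul_right hcopM hcopN
    have ha1 : a' ≡ 1 [MOD Nat.gcd d M] := by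
      rw [← ZMod.natCast_eq_natCast_iff]
      have h1 := congrArg Units.val ha
      rw [ZMod.unitsMap_val, Units.val_one] at h1
      rw [← haM, ZMod.cast_natCast hg] at h1
      simpa using h1
    have hnd : n ≡ 1 [MOD d] := by
      have hd' : d = Nat.gcd d M * Nat.gcd d N := by
        rw [← Nat.Coprime.gcd_mul d hcop, ← hK, Nat.gcd_eq_left hdK]
      have hc : (Nat.gcd d M).Coprime (Nat.gcd d N) :=
        Nat.Coprime.coprime_dvd_left hg (Nat.Coprime.coprime_dvd_right (Nat.gcd_dvd_right d N) hcop)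
      rw [hd', ← Nat.modEq_and_modEq_iff_modEq_mul hc]
      exact ⟨(hn1.of_dvd hg).trans ha1, hn2.of_dvd (Nat.gcd_dvd_right d N)⟩
    have e1 : (n : ZMod M) = a := by rw [← haM]; exact (ZMod.natCast_eq_natCast_iff _ _ _).mpr hn1
    have e2 : (n : ZMod N) = 1 := by
      have := (ZMod.natCast_eq_natCast_iff _ _ _).mpr hn2; simpa using this
    have e3 : (n : ZMod d) = 1 := by
      have := (ZMod.natCast_eq_natCast_iff _ _ _).mpr hnd; simpa using this
    have h2 := congrArg (fun θ => θ (n : ZMod K)) h0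
    simp only [MulChar.mul_apply] at h2
    rw [changeLevel_nat hM _ n hcopK, changeLevel_nat hN _ n hcopK, changeLevel_nat hdK _ n hcopK, e1, e2, e3,
      map_one, map_one, mul_one] at h2
    ext
    rw [MulChar.coe_toUnitHom, h2]; rfl
  have h3 : χ.conductor ∣ Nat.gcd d M := DirichletCharacter.conductor_dvd_of_mem_conductorSet _ hfac
  rw [(DirichletCharacter.isPrimitive_def χ).mp hχ] at h3
  exact h3.trans (Nat.gcd_dvd_left d M)

lemma chiPsi_primitive {D p : ℕ} [NeZero D] [NeZero p] (hcop : D.Coprime p) {χ : DirichletCharacter ℂ D}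
    {ψ : DirichletCharacter ℂ p} (hχ : χ.IsPrimitive) (hψ : ψ.IsPrimitive) : (chiPsi D χ ψ).IsPrimitive := by
  have : NeZero (D * p) := ⟨mul_ne_zero (NeZero.ne D) (NeZero.ne p)⟩
  have h := DirichletCharacter.factorsThrough_conductor (chiPsi D χ ψ)
  have h1 : D ∣ (chiPsi D χ ψ).conductor :=
    factor_aux (D * p) D p _ _ hcop rfl χ ψ hχ _ h
  have h2 : p ∣ (chiPsi D χ ψ).conductor := by
    refine factor_aux (D * p) p D (dvd_mul_left p D) (dvd_mul_right D p) hcop.symm (mul_comm _ _) ψ χ hψ _ ?_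
    have e : DirichletCharacter.changeLevel (dvd_mul_left p D) ψ * DirichletCharacter.changeLevel (dvd_mul_right D p) χ = chiPsi D χ ψ := mul_comm (DirichletCharacter.changeLevel (dvd_mul_left p D) ψ) _
    rw [e]; exact h
  have h3 := Nat.Coprime.mul_dvd_of_dvd_of_dvd hcop h1 h2
  exact Nat.dvd_antisymm (DirichletCharacter.conductor_dvd_level _) h3

lemma chiPsi_nat {D p : ℕ} [NeZero D] [NeZero p] (χ : DirichletCharacter ℂ D)
    (ψ : DirichletCharacter ℂ p) (n : ℕ) : chiPsi D χ ψ (n : ZMod (D * p)) = χ (n : ZMod D) * ψ (n : ZMod p) := by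
  by_cases h : n.Coprime (D * p)
  · rw [chiPsi, MulChar.mul_apply, changeLevel_nat _ _ _ h, changeLevel_nat _ _ _ h]
  · rw [MulChar.map_nonunit _ (by rwa [ZMod.isUnit_iff_coprime])]
    rw [Nat.coprime_mul_iff_right, not_and_or] at h
    rcases h with h | h
    · rw [MulChar.map_nonunit χ (by rwa [ZMod.isUnit_iff_coprime]), zero_mul]
    · rw [MulChar.map_nonunit ψ (by rwa [ZMod.isUnit_iff_coprime]), mul_zero]

lemma real_inv {D : ℕ} {χ : DirichletCharacter ℂ D} (h : IsRealChar χ) : χ⁻¹ = χ := by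
  ext a
  rw [char_inv_conj, Complex.conj_eq_iff_im.mpr (h a)]

lemma chiPsi_inv {D p : ℕ} {χ : DirichletCharacter ℂ D} (h : IsRealChar χ) (ψ : DirichletCharacter ℂ p) :
    (chiPsi D χ ψ)⁻¹ = chiPsi D χ ψ⁻¹ := by
  rw [chiPsi, chiPsi, mul_inv, ← map_inv, ← map_inv, real_inv h]

lemma Lfun_eq {N : ℕ} [h : NeZero N] (θ : DirichletCharacter ℂ N) : Lfun θ = DirichletCharacter.LFunction θ := by
  funext s
  rw [Lfun, dif_neg (NeZero.ne N)]

/-- the product of the two L-functions -/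
def LL (D : ℕ) (χ : DirichletCharacter ℂ D) {p : ℕ} (ψ : DirichletCharacter ℂ p) (s : ℂ) : ℂ :=
  Lfun ψ s * Lfun (chiPsi D χ ψ) s

/-- the long sum -/
def Tfun (D : ℕ) (χ : DirichletCharacter ℂ D) {p : ℕ} (ψ : DirichletCharacter ℂ p) (s : ℂ) : ℂ :=
  ∑ n ∈ Finset.Ioc (D ^ 4) ⌊bigP D ^ 2⌋₊, nuF D χ n * ψ (n : ZMod p) * (n : ℂ) ^ (-s)

/-- basic hypotheses -/
structure Hyp (D : ℕ) (χ : DirichletCharacter ℂ D) {p : ℕ} (ψ : DirichletCharacter ℂ p) : Prop where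
  hD : 1 < D
  hp : 1 < p
  hcop : D.Coprime p
  hreal : IsRealChar χ
  hχ : χ.IsPrimitive
  hψ : ψ.IsPrimitive

variable {D p : ℕ} {χ : DirichletCharacter ℂ D} {ψ : DirichletCharacter ℂ p}

lemma Hyp.inv (h : Hyp D χ ψ) : Hyp D χ ψ⁻¹ :=
  ⟨h.hD, h.hp, h.hcop, h.hreal, h.hχ, inv_primitive h.hψ⟩

lemma Hyp.neD (h : Hyp D χ ψ) : NeZero D := ⟨by have := h.hD; omega⟩
lemma Hyp.nep (h : Hyp D χ ψ) : NeZero p := ⟨by have := h.hp; omega⟩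
lemma Hyp.neDp (h : Hyp D χ ψ) : NeZero (D * p) := ⟨mul_ne_zero h.neD.1 h.nep.1⟩
lemma Hyp.hDp (h : Hyp D χ ψ) : 1 < D * p := by have := h.hD; have := h.hp; nlinarith
lemma Hyp.prim (h : Hyp D χ ψ) : (chiPsi D χ ψ).IsPrimitive := by
  have := h.neD; have := h.nep
  exact chiPsi_primitive h.hcop h.hχ h.hψ

lemma LL_FE (h : Hyp D χ ψ) (s : ℂ) (hs : s.im ≠ 0) :
    LL D χ ψ s = Ztilde D χ ψ s * LL D χ ψ⁻¹ (1 - s) := by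
  have := h.neD; have := h.nep; have := h.neDp
  rw [LL, LL, Ztilde, Lfun_eq, Lfun_eq, Lfun_eq, Lfun_eq, FE h.hψ s hs, FE h.prim s hs, chiPsi_inv h.hreal]
  ring

lemma LL_diff (h : Hyp D χ ψ) : Differentiable ℂ (LL D χ ψ) := by
  have := h.neD; have := h.nep; have := h.neDp
  have e : LL D χ ψ = fun s => Lfun ψ s * Lfun (chiPsi D χ ψ) s := rfl
  rw [e, Lfun_eq, Lfun_eq]
  exact (DirichletCharacter.differentiable_LFunction (prim_ne_one h.hp h.hψ)).mul
    (DirichletCharacter.differentiable_LFunction (prim_ne_one h.hDp h.prim))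

lemma LL_conj (h : Hyp D χ ψ) (s : ℂ) :
    (starRingEnd ℂ) (LL D χ ψ ((starRingEnd ℂ) s)) = LL D χ ψ⁻¹ s := by
  have := h.neD; have := h.nep; have := h.neDp
  rw [LL, LL, map_mul, Lfun_eq, Lfun_eq, Lfun_eq, Lfun_eq, L_conj (prim_ne_one h.hp h.hψ),
    L_conj (prim_ne_one h.hDp h.prim), chiPsi_inv h.hreal]

lemma LL_bound (h : Hyp D χ ψ) (s : ℂ) (hs : 1/2 ≤ s.re) :
    ‖LL D χ ψ s‖ ≤ 4 * D * p ^ 2 * ‖s‖ ^ 2 := by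
  have := h.neD; have := h.nep; have := h.neDp
  rw [LL, Lfun_eq, Lfun_eq, norm_mul]
  have h1 := L_bound h.hp (prim_ne_one h.hp h.hψ) s hs
  have h2 := L_bound h.hDp (prim_ne_one h.hDp h.prim) s hs
  refine (mul_le_mul h1 h2 (norm_nonneg _) (by positivity)).trans (le_of_eq ?_)
  push_cast; ring

lemma Zt_ne (h : Hyp D χ ψ) (s : ℂ) (hs : s.im ≠ 0) : Ztilde D χ ψ s ≠ 0 := by
  have := h.neD; have := h.nep; have := h.neDp
  exact mul_ne_zero (Zfun_ne h.hp h.hψ s hs) (Zfun_ne h.hDp h.prim s hs)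

lemma Zt_diff (h : Hyp D χ ψ) (s : ℂ) (hs : s.im ≠ 0) : DifferentiableAt ℂ (Ztilde D χ ψ) s := by
  have := h.neD; have := h.nep; have := h.neDp
  exact (Zfun_diff ψ s hs).mul (Zfun_diff _ s hs)

lemma Zt_norm (h : Hyp D χ ψ) (s : ℂ) (hs : 20 ≤ |s.im|) (hσ : |s.re - 1 / 2| ≤ 6) :
    |Real.log ‖Ztilde D χ ψ s‖ + (s.re - 1 / 2) * (Real.log D + 2 * Real.log p)| ≤
      |s.re - 1 / 2| * (2 * Real.log (|s.im| / 2 + 4) + 40 * KK + 2 * Real.log Real.pi) := by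
  have := h.neD; have := h.nep; have := h.neDp
  have hs0 : s.im ≠ 0 := by rintro h; rw [h] at hs; norm_num at hs
  have h1 := Zfun_norm h.hp h.hψ s hs hσ
  have h2 := Zfun_norm h.hDp h.prim s hs hσ
  have hp0 : (p:ℝ) ≠ 0 := by exact_mod_cast NeZero.ne p
  have hD0 : (D:ℝ) ≠ 0 := by exact_mod_cast NeZero.ne D
  rw [Real.log_div hp0 Real.pi_ne_zero] at h1
  rw [Real.log_div (by exact_mod_cast NeZero.ne (D*p)) Real.pi_ne_zero] at h2
  push_cast at h2
  rw [Real.log_mul hD0 hp0] at h2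
  rw [Ztilde, norm_mul, Real.log_mul (norm_ne_zero_iff.mpr (Zfun_ne h.hp h.hψ s hs0))
    (norm_ne_zero_iff.mpr (Zfun_ne h.hDp h.prim s hs0))]
  set l1 := Real.log ‖Zfun ψ s‖
  set l2 := Real.log ‖Zfun (chiPsi D χ ψ) s‖
  set u := s.re - 1/2
  have e : l1 + l2 + u * (Real.log D + 2 * Real.log p) = (l1 + u * (Real.log p - Real.log Real.pi)) +
    (l2 + u * (Real.log D + Real.log p - Real.log Real.pi)) + u * (2 * Real.log Real.pi) := by ring
  rw [e]
  have hpi : 0 ≤ 2 * Real.log Real.pi := by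
    have := Real.log_nonneg (by linarith [Real.pi_gt_three] : 1 ≤ Real.pi); linarith
  have h3 : |u * (2 * Real.log Real.pi)| = |u| * (2 * Real.log Real.pi) := by
    rw [abs_mul, abs_of_nonneg hpi]
  have h4 := abs_add_le (l1 + u * (Real.log p - Real.log Real.pi) +
    (l2 + u * (Real.log D + Real.log p - Real.log Real.pi))) (u * (2 * Real.log Real.pi))
  have h5 := abs_add_le (l1 + u * (Real.log p - Real.log Real.pi))
    (l2 + u * (Real.log D + Real.log p - Real.log Real.pi))
  rw [h3] at h4
  linarith

lemma nuF_real (h : IsRealChar χ) (n : ℕ) : (starRingEnd ℂ) (nuF D χ n) = nuF D χ n := by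
  rw [nuF, map_sum]
  refine Finset.sum_congr rfl fun d _ => Complex.conj_eq_iff_im.mpr (h _)

lemma nuF_bound (χ : DirichletCharacter ℂ D) (n : ℕ) : ‖nuF D χ n‖ ≤ n := by
  rw [nuF]
  refine (norm_sum_le _ _).trans ((Finset.sum_le_card_nsmul _ _ 1 (fun a _ => χ.norm_le_one _)).trans ?_)
  rw [nsmul_eq_mul, mul_one]
  exact_mod_cast Nat.card_divisors_le_self n

lemma cf_bound (χ : DirichletCharacter ℂ D) (ψ : DirichletCharacter ℂ p) (n : ℕ) :
    ‖nuF D χ n * ψ (n : ZMod p)‖ ≤ n := by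
  rw [norm_mul]
  calc _ ≤ (n:ℝ) * 1 := mul_le_mul (nuF_bound χ n) (ψ.norm_le_one _) (norm_nonneg _) (by positivity)
    _ = n := mul_one _

lemma LL_series (h : Hyp D χ ψ) (s : ℂ) (hs : 1 < s.re) :
    HasSum (fun n : ℕ => nuF D χ n * ψ (n : ZMod p) * (n : ℂ) ^ (-s)) (LL D χ ψ s) := by
  have := h.neD; have := h.nep; have := h.neDp
  have s1 := DirichletCharacter.LSeriesSummable_of_one_lt_re ψ hs
  have s2 := DirichletCharacter.LSeriesSummable_of_one_lt_re (chiPsi D χ ψ) hs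
  have h1 := LSeriesHasSum.convolution s1.LSeriesHasSum s2.LSeriesHasSum
  rw [← DirichletCharacter.LFunction_eq_LSeries _ hs, ← DirichletCharacter.LFunction_eq_LSeries _ hs, ← Lfun_eq, ← Lfun_eq] at h1
  have e : LSeries.term (LSeries.convolution (fun n : ℕ => ψ (n : ZMod p)) (fun n : ℕ => chiPsi D χ ψ (n : ZMod (D*p)))) s =
      (fun n : ℕ => nuF D χ n * ψ (n : ZMod p) * (n : ℂ) ^ (-s)) := by
    funext n
    rcases eq_or_ne n 0 with rfl | hn
    · simp [nuF]
    · rw [LSeries.term_of_ne_zero hn, LSeries.convolution_def, Complex.cpow_neg, div_eq_mul_inv]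
      congr 1
      beta_reduce
      rw [Nat.sum_divisorsAntidiagonal' (fun a b => ψ (a : ZMod p) * chiPsi D χ ψ (b : ZMod (D*p))), nuF, Finset.sum_mul]
      refine Finset.sum_congr rfl fun d hd => ?_
      rw [chiPsi_nat]
      have : (n : ZMod p) = ((n / d : ℕ) : ZMod p) * (d : ZMod p) := by
        rw [← Nat.cast_mul, Nat.div_mul_cancel (Nat.dvd_of_mem_divisors hd)]
      rw [this, map_mul]; ring
  rw [LSeriesHasSum, e] at h1
  exact h1

lemma Ffun_conj (h : IsRealChar χ) (s : ℂ) :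
    Ffun D χ ψ⁻¹ s = (starRingEnd ℂ) (Ffun D χ ψ ((starRingEnd ℂ) s)) := by
  rw [Ffun, Ffun, map_sum]
  refine Finset.sum_congr rfl fun n _ => ?_
  rw [map_mul, map_mul, nuF_real h, char_inv_conj, ← map_neg, conj_nat_cpow, Complex.conj_conj]

lemma Tfun_conj (h : IsRealChar χ) (s : ℂ) :
    Tfun D χ ψ⁻¹ s = (starRingEnd ℂ) (Tfun D χ ψ ((starRingEnd ℂ) s)) := by
  rw [Tfun, Tfun, map_sum]
  refine Finset.sum_congr rfl fun n _ => ?_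
  rw [map_mul, map_mul, nuF_real h, char_inv_conj, ← map_neg, conj_nat_cpow, Complex.conj_conj]

lemma FfunBar_eq (s : ℂ) : FfunBar D χ ψ s = Ffun D χ ψ⁻¹ (1 - s) := by
  rw [Ffun, FfunBar]
  refine Finset.sum_congr rfl fun n _ => ?_
  rw [char_inv_conj, neg_sub]

lemma tail_aux (χ : DirichletCharacter ℂ D) (ψ : DirichletCharacter ℂ p) (P : ℝ) (hP : 0 < P) (m : ℕ)
    (hmP : P ^ 2 ≤ (m:ℝ)) (s : ℂ) (hs : s.re = 13/2) :
    ‖nuF D χ m * ψ (m : ZMod p) * (m : ℂ) ^ (-s)‖ ≤ P⁻¹ ^ 7 * (1 / (m:ℝ)^2) := by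
  have hm0 : (0:ℝ) < m := lt_of_lt_of_le (by positivity) hmP
  rw [norm_mul, Complex.norm_natCast_cpow_of_pos (by exact_mod_cast hm0), Complex.neg_re, hs]
  calc _ ≤ (m:ℝ) * (m:ℝ)^(-(13/2) : ℝ) := mul_le_mul_of_nonneg_right (cf_bound χ ψ m) (by positivity)
    _ = (m:ℝ)^(-(7/2) : ℝ) * (1 / (m:ℝ)^2) := by
      rw [one_div, ← Real.rpow_natCast, ← Real.rpow_neg hm0.le, ← Real.rpow_add hm0]
      nth_rewrite 1 [← Real.rpow_one (m:ℝ)]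
      rw [← Real.rpow_add hm0]; norm_num
    _ ≤ (P ^ 2)^(-(7/2) : ℝ) * (1 / (m:ℝ)^2) := by
      refine mul_le_mul_of_nonneg_right ?_ (by positivity)
      exact Real.rpow_le_rpow_of_nonpos (by positivity) hmP (by norm_num)
    _ = _ := by
      congr 1
      rw [← Real.rpow_natCast P 2, ← Real.rpow_mul hP.le, inv_pow, ← Real.rpow_natCast, ← Real.rpow_neg hP.le]
      norm_num

lemma split_aux (f : ℕ → ℂ) (h0 : f 0 = 0) (M Y : ℕ) (h : M ≤ Y) :
    ∑ n ∈ Finset.Icc 1 M, f n + ∑ n ∈ Finset.Ioc M Y, f n = ∑ n ∈ Finset.range (Y+1), f n := by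
  have e : Finset.range (Y+1) = insert 0 (Finset.Icc 1 M ∪ Finset.Ioc M Y) := by
    ext n; simp only [Finset.mem_range, Finset.mem_insert, Finset.mem_union, Finset.mem_Icc, Finset.mem_Ioc]; omega
  have hd : Disjoint (Finset.Icc 1 M) (Finset.Ioc M Y) := by
    rw [Finset.disjoint_left]; intro n; simp only [Finset.mem_Icc, Finset.mem_Ioc]; omega
  rw [e, Finset.sum_insert (by simp), Finset.sum_union hd, h0, zero_add]

lemma pi2 : Real.pi^2/6 ≤ 2 := by 
  have h1 := Real.pi_lt_d2
  have h2 := Real.pi_pos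
  have : Real.pi^2 ≤ 3.15^2 := pow_le_pow_left₀ h2.le h1.le 2
  norm_num at this ⊢
  linarith
lemma tail_le (Y : ℕ) : ∑' n : ℕ, 1 / ((n + (Y+1) : ℕ):ℝ)^2 ≤ 2 := by
    have hz2 : HasSum (fun n : ℕ => 1 / (n:ℝ)^2) (Real.pi^2/6) := hasSum_zeta_two
    have h1 := hz2.summable.sum_add_tsum_nat_add (Y+1)
    rw [hz2.tsum_eq] at h1
    have h2 : 0 ≤ ∑ n ∈ Finset.range (Y+1), 1 / (n:ℝ)^2 := Finset.sum_nonneg fun n _ => by positivity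
    linarith [pi2]
lemma tail_summ (Y : ℕ) : Summable (fun n : ℕ => 1 / ((n + (Y+1) : ℕ):ℝ)^2) := 
   (summable_nat_add_iff (f := fun n : ℕ => 1 / (n:ℝ)^2) (Y+1)).mpr hasSum_zeta_two.summable

lemma tail_sum (f : ℕ → ℂ) (S : ℂ) (hf : HasSum f S) (Y : ℕ) (c : ℝ) (hc : 0 ≤ c)
    (hb : ∀ m : ℕ, Y + 1 ≤ m → ‖f m‖ ≤ c * (1 / (m:ℝ)^2)) : ‖S - ∑ n ∈ Finset.range (Y+1), f n‖ ≤ 2 * c := by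
  have hdiff : S - ∑ n ∈ Finset.range (Y+1), f n = ∑' n, f (n + (Y+1)) := by
    have := hf.summable.sum_add_tsum_nat_add (Y+1)
    rw [hf.tsum_eq] at this
    rw [← this]; ring
  rw [hdiff]
  have := tsum_of_norm_bounded (f := fun n => f (n + (Y+1))) (g := fun n : ℕ => c * (1 / ((n + (Y+1) : ℕ):ℝ)^2)) ((tail_summ Y).hasSum.mul_left c) (fun n => hb (n + (Y+1)) (by omega))
  refine this.trans ?_
  rw [mul_comm]
  exact mul_le_mul_of_nonneg_right (tail_le Y) hc

lemma tail_bound (h : Hyp D χ ψ) (hDP : (D:ℝ) ^ 4 ≤ bigP D ^ 2) (s : ℂ) (hs : s.re = 13/2) :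
    ‖LL D χ ψ s - Ffun D χ ψ s - Tfun D χ ψ s‖ ≤ 2 * (bigP D)⁻¹ ^ 7 := by
  have hP : 0 < bigP D := Real.exp_pos _
  set Y := ⌊bigP D ^ 2⌋₊ with hY
  have hDY : D ^ 4 ≤ Y := Nat.le_floor (by push_cast; exact hDP)
  set f := (fun n : ℕ => nuF D χ n * ψ (n : ZMod p) * (n : ℂ) ^ (-s)) with hf
  have hsum := LL_series h s (by rw [hs]; norm_num)
  have hfin : Ffun D χ ψ s + Tfun D χ ψ s = ∑ n ∈ Finset.range (Y+1), f n := by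
    rw [Ffun, Tfun]
    exact split_aux f (by simp [hf, nuF]) _ _ hDY
  rw [sub_sub, hfin]
  refine tail_sum f _ hsum Y _ (by positivity) fun m hm => tail_aux χ ψ (bigP D) hP m ?_ s hs
  refine (Nat.lt_floor_add_one (bigP D ^ 2)).le.trans ?_
  rw [← hY]; exact_mod_cast hm
end PartNo5

section PartNo6

lemma psum (c : ℕ → ℂ) (h0 : c 0 = 0) (b : ℝ) (hb : 1 ≤ b) (q : ℝ) (hq : 0 ≤ q) (v : ℂ) (hv : -q ≤ v.re) :
    ‖∑ n ∈ Finset.Icc 0 ⌊b⌋₊, (n:ℂ)^(-v) * c n‖ ≤ b ^ q * (1 + ‖v‖) *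
      (‖∑ n ∈ Finset.Icc 0 ⌊b⌋₊, c n‖ + ∫ x in (1:ℝ)..b, ‖∑ n ∈ Finset.Icc 0 ⌊x⌋₊, c n‖ / x) := by
  set S : ℝ → ℂ := fun x => ∑ n ∈ Finset.Icc 0 ⌊x⌋₊, c n with hS
  have hder : ∀ t : ℝ, 1 ≤ t → HasDerivAt (fun x : ℝ => (x:ℂ)^(-v)) (-v * (t:ℂ)^(-v-1)) t := by
    intro t ht
    have := (hasDerivAt_id (t:ℂ)).cpow_const (c := -v) (Or.inl (by simpa using (by linarith : (0:ℝ) < t)))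
    simpa using this.comp_ofReal
  have hbq : ∀ t : ℝ, 1 ≤ t → t ≤ b → ‖(t:ℂ)^(-v)‖ ≤ b ^ q := by
    intro t ht htb
    rw [Complex.norm_cpow_eq_rpow_re_of_pos (by linarith)]
    calc t ^ ((-v).re) ≤ t ^ q := Real.rpow_le_rpow_of_exponent_le ht (by simp; linarith)
      _ ≤ b ^ q := Real.rpow_le_rpow (by linarith) htb hq
  have hbq1 : ∀ t : ℝ, 1 ≤ t → t ≤ b → ‖(t:ℂ)^(-v-1)‖ ≤ b ^ q / t := by
    intro t ht htb
    have h0 : (t:ℂ) ≠ 0 := by simpa using (by linarith : t ≠ 0)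
    rw [Complex.cpow_sub _ _ h0, Complex.cpow_one, norm_div, Complex.norm_real, Real.norm_eq_abs, abs_of_pos (by linarith)]
    exact div_le_div_of_nonneg_right (hbq t ht htb) (by linarith)
  have hcont : ContinuousOn (fun t : ℝ => -v * (t:ℂ)^(-v-1)) (Set.Icc 1 b) := by
    intro t ht
    have h0 : (t:ℂ) ∈ Complex.slitPlane := by
      have : (0:ℝ) < t := by linarith [ht.1]
      exact Complex.ofReal_mem_slitPlane.mpr this
    refine ContinuousAt.continuousWithinAt ?_
    refine continuousAt_const.mul ?_
    exact (continuousAt_cpow_const h0).comp (Complex.continuous_ofReal.continuousAt)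
  have hintg : MeasureTheory.IntegrableOn (deriv (fun x : ℝ => (x:ℂ)^(-v))) (Set.Icc 1 b) := by
    refine (hcont.integrableOn_compact isCompact_Icc).congr_fun ?_ measurableSet_Icc
    intro t ht; exact (hder t ht.1).deriv.symm
  have key := sum_mul_eq_sub_integral_mul₀ c (f := fun x : ℝ => (x:ℂ)^(-v)) h0 b (fun t ht => (hder t ht.1).differentiableAt) hintg
  have e1 : ∑ n ∈ Finset.Icc 0 ⌊b⌋₊, (n:ℂ)^(-v) * c n = ∑ n ∈ Finset.Icc 0 ⌊b⌋₊, (((n:ℝ)):ℂ)^(-v) * c n := by simp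
  rw [e1]
  rw [key]
  have hSb : ∀ x ∈ Set.Ioc 1 b, ‖S x‖ ≤ ∑ n ∈ Finset.Icc 0 ⌊b⌋₊, ‖c n‖ := by
    intro x hx
    refine (norm_sum_le _ _).trans ?_
    refine Finset.sum_le_sum_of_subset_of_nonneg ?_ fun _ _ _ => norm_nonneg _
    exact Finset.Icc_subset_Icc_right (Nat.floor_mono hx.2)
  have hmeasS : Measurable S := (measurable_from_nat (f := fun m : ℕ => ∑ n ∈ Finset.Icc 0 m, c n)).comp Nat.measurable_floor
  have hSint : MeasureTheory.IntegrableOn (fun x => ‖S x‖ / x) (Set.Ioc 1 b) := by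
    refine MeasureTheory.Measure.integrableOn_of_bounded (M := ∑ n ∈ Finset.Icc 0 ⌊b⌋₊, ‖c n‖) (by simp) ?_ ?_
    · exact (hmeasS.norm.div measurable_id).aestronglyMeasurable
    · refine (MeasureTheory.ae_restrict_iff' measurableSet_Ioc).mpr (Filter.Eventually.of_forall fun x hx => ?_)
      rw [norm_div, norm_norm, Real.norm_eq_abs, abs_of_pos (by linarith [hx.1])]
      refine (div_le_self (norm_nonneg _) hx.1.le).trans (hSb x hx)
  have hI : ‖∫ t in Set.Ioc 1 b, deriv (fun x : ℝ => (x:ℂ)^(-v)) t * S t‖ ≤ b^q * ‖v‖ * ∫ x in (1:ℝ)..b, ‖S x‖ / x := by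
    rw [intervalIntegral.integral_of_le hb, ← MeasureTheory.integral_const_mul]
    refine MeasureTheory.norm_integral_le_of_norm_le (hSint.const_mul _) ?_
    refine (MeasureTheory.ae_restrict_iff' measurableSet_Ioc).mpr (Filter.Eventually.of_forall fun x hx => ?_)
    rw [(hder x hx.1.le).deriv, norm_mul, norm_mul, norm_neg]
    have := hbq1 x hx.1.le hx.2
    calc ‖v‖ * ‖(x:ℂ)^(-v-1)‖ * ‖S x‖ ≤ ‖v‖ * (b^q/x) * ‖S x‖ := by gcongr
      _ = _ := by ring
  have hI0 : 0 ≤ ∫ x in (1:ℝ)..b, ‖S x‖ / x := by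
    refine intervalIntegral.integral_nonneg hb fun x hx => div_nonneg (norm_nonneg _) (by linarith [hx.1])
  have hb0 : 0 ≤ b ^ q := by positivity
  calc _ ≤ ‖(b:ℂ)^(-v)‖ * ‖S b‖ + ‖∫ t in Set.Ioc 1 b, deriv (fun x : ℝ => (x:ℂ)^(-v)) t * S t‖ := by
        refine (norm_sub_le _ _).trans ?_
        rw [norm_mul]
    _ ≤ b^q * ‖S b‖ + b^q * ‖v‖ * ∫ x in (1:ℝ)..b, ‖S x‖ / x := add_le_add (mul_le_mul_of_nonneg_right (hbq b hb le_rfl) (norm_nonneg _)) hI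
    _ ≤ _ := by
        have h1 := mul_nonneg (mul_nonneg hb0 (norm_nonneg v)) (norm_nonneg (S b))
        have h2 := mul_nonneg hb0 hI0
        nlinarith

lemma psum_a (c : ℕ → ℂ) (N : ℕ) (hN : 1 ≤ N) (h0 : ∀ n ≤ N, c n = 0) (b : ℝ) (hb : (N:ℝ) ≤ b) (q : ℝ) (hq : 0 ≤ q) (v : ℂ) (hv : -q ≤ v.re) :
    ‖∑ n ∈ Finset.Ioc N ⌊b⌋₊, (n:ℂ)^(-v) * c n‖ ≤ b ^ q * (1 + ‖v‖) *
      (‖∑ n ∈ Finset.Ioc N ⌊b⌋₊, c n‖ + ∫ x in (N:ℝ)..b, ‖∑ n ∈ Finset.Ioc N ⌊x⌋₊, c n‖ / x) := by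
  have hN' : (1:ℝ) ≤ N := by exact_mod_cast hN
  have hsum : ∀ (f : ℕ → ℂ), (∀ n ≤ N, f n = 0) → ∀ m : ℕ, ∑ n ∈ Finset.Icc 0 m, f n = ∑ n ∈ Finset.Ioc N m, f n := by
    intro f hf m
    refine (Finset.sum_subset ?_ ?_).symm
    · intro n hn; simp at hn ⊢; omega
    · intro n hn hn'; refine hf n ?_
      simp at hn hn'; omega
  have key := psum c (h0 0 (by omega)) b (by linarith) q hq v hv
  rw [hsum c h0, hsum (fun n => (n:ℂ)^(-v) * c n) (fun n hn => by simp [h0 n hn])] at key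
  simp_rw [hsum c h0] at key
  refine key.trans (le_of_eq ?_)
  congr 2
  set g : ℝ → ℝ := fun x => ‖∑ n ∈ Finset.Ioc N ⌊x⌋₊, c n‖ / x with hg
  have hz : ∀ x ≤ (N:ℝ), g x = 0 := by
    intro x hx
    have : ⌊x⌋₊ ≤ N := Nat.floor_le_of_le hx
    simp [hg, Finset.Ioc_eq_empty_of_le this]
  rw [intervalIntegral.integral_of_le (by linarith), intervalIntegral.integral_of_le hb]
  rw [MeasureTheory.setIntegral_eq_of_subset_of_forall_sdiff_eq_zero measurableSet_Ioc (Set.Ioc_subset_Ioc_left hN')]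
  intro x hx
  refine hz x ?_
  by_contra hc
  exact hx.2 ⟨not_le.mp hc, hx.1.2⟩

/-- product of finite Dirichlet polynomials -/
lemma dprod (g : ℕ → ℂ) (hg : ∀ m n, g (m*n) = g m * g n) (f h : ArithmeticFunction ℂ) (N M : ℕ)
    (hf : ∀ n, N < n → f n = 0) (hh : ∀ n, M < n → h n = 0) :
    (∑ n ∈ Finset.Icc 1 (N*M), (f*h) n * g n = (∑ n ∈ Finset.Icc 1 N, f n * g n) * ∑ n ∈ Finset.Icc 1 M, h n * g n)
    ∧ ∀ n, N*M < n → (f*h) n = 0 := by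
  constructor
  · rw [Finset.sum_mul_sum, ← Finset.sum_product']
    have hmaps : ∀ x ∈ Finset.Icc 1 N ×ˢ Finset.Icc 1 M, x.1*x.2 ∈ Finset.Icc 1 (N*M) := by
      intro x hx
      simp only [Finset.mem_product, Finset.mem_Icc] at hx ⊢
      exact ⟨Nat.mul_pos hx.1.1 hx.2.1, Nat.mul_le_mul hx.1.2 hx.2.2⟩
    rw [← Finset.sum_fiberwise_of_maps_to hmaps]
    refine Finset.sum_congr rfl fun n hn => ?_
    rw [ArithmeticFunction.mul_apply, Finset.sum_mul]
    symm
    simp only [Finset.mem_Icc] at hn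
    have : ∀ x ∈ n.divisorsAntidiagonal, f x.1 * h x.2 * g n = f x.1 * g x.1 * (h x.2 * g x.2) := by
      intro x hx
      rw [← (Nat.mem_divisorsAntidiagonal.mp hx).1, hg]; ring
    rw [Finset.sum_congr rfl this]
    refine Finset.sum_subset ?_ ?_
    · intro x hx
      simp only [Finset.mem_filter, Finset.mem_product, Finset.mem_Icc] at hx
      rw [Nat.mem_divisorsAntidiagonal]; exact ⟨hx.2, by omega⟩
    · intro x hx hx'
      rw [Nat.mem_divisorsAntidiagonal] at hx
      have h1 : x.1 ≠ 0 := by rintro h; rw [h] at hx; simp at hx; omega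
      have h2 : x.2 ≠ 0 := by rintro h; rw [h] at hx; simp at hx; omega
      by_cases hN : N < x.1
      · rw [hf _ hN]; simp
      by_cases hM : M < x.2
      · rw [hh _ hM]; simp
      exfalso; apply hx'
      simp only [Finset.mem_filter, Finset.mem_product, Finset.mem_Icc]
      refine ⟨⟨⟨by omega, by omega⟩, by omega, by omega⟩, hx.1⟩
  · intro n hn
    rw [ArithmeticFunction.mul_apply]
    refine Finset.sum_eq_zero fun x hx => ?_
    rw [Nat.mem_divisorsAntidiagonal] at hx
    by_cases hN : N < x.1
    · rw [hf _ hN]; simp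
    by_cases hM : M < x.2
    · rw [hh _ hM]; simp
    exfalso
    have := Nat.mul_le_mul (not_lt.mp hN) (not_lt.mp hM)
    omega

lemma dpow (g : ℕ → ℂ) (hg : ∀ m n, g (m*n) = g m * g n) (hg1 : g 1 = 1) (f : ArithmeticFunction ℂ) (N : ℕ)
    (hf : ∀ n, N < n → f n = 0) (k : ℕ) :
    (∑ n ∈ Finset.Icc 1 (N^k), (f^k) n * g n = (∑ n ∈ Finset.Icc 1 N, f n * g n)^k)
    ∧ ∀ n, N^k < n → (f^k) n = 0 := by
  induction k with
  | zero => 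
    refine ⟨by simp [hg1], fun n hn => ?_⟩
    simp at hn
    simp [ArithmeticFunction.one_apply, show n ≠ 1 by omega]
  | succ k ih =>
    rw [pow_succ, pow_succ, pow_succ]
    have := dprod g hg (f^k) f (N^k) N ih.2 hf
    rw [ih.1] at this
    exact this
end PartNo6

section PartNo7
variable {D p : ℕ} {χ : DirichletCharacter ℂ D} {ψ : DirichletCharacter ℂ p}

lemma S_int (c : ℕ → ℂ) (b : ℝ) (hb : 1 ≤ b) :
    IntervalIntegrable (fun x : ℝ => ‖∑ n ∈ Finset.Icc 1 ⌊x⌋₊, c n‖ / x) MeasureTheory.volume 1 b := by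
  rw [intervalIntegrable_iff_integrableOn_Ioc_of_le hb]
  refine MeasureTheory.Measure.integrableOn_of_bounded (M := ∑ n ∈ Finset.Icc 1 ⌊b⌋₊, ‖c n‖) (by simp) ?_ ?_
  · have hmeasS : Measurable (fun x : ℝ => ∑ n ∈ Finset.Icc 1 ⌊x⌋₊, c n) :=
      (measurable_from_nat (f := fun m : ℕ => ∑ n ∈ Finset.Icc 1 m, c n)).comp Nat.measurable_floor
    exact (hmeasS.norm.div measurable_id).aestronglyMeasurable
  · refine (MeasureTheory.ae_restrict_iff' measurableSet_Ioc).mpr (Filter.Eventually.of_forall fun x hx => ?_)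
    rw [norm_div, norm_norm, Real.norm_eq_abs, abs_of_pos (by linarith [hx.1])]
    refine (div_le_self (norm_nonneg _) hx.1.le).trans ?_
    refine (norm_sum_le _ _).trans ?_
    refine Finset.sum_le_sum_of_subset_of_nonneg ?_ fun _ _ _ => norm_nonneg _
    exact Finset.Icc_subset_Icc_right (Nat.floor_mono hx.2)

lemma Icc01 (f : ℕ → ℂ) (h0 : f 0 = 0) (m : ℕ) : ∑ n ∈ Finset.Icc 0 m, f n = ∑ n ∈ Finset.Icc 1 m, f n := by
  refine (Finset.sum_subset ?_ ?_).symm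
  · intro n hn; simp at hn ⊢; omega
  · intro n hn hn'
    simp at hn hn'
    have : n = 0 := by omega
    rw [this, h0]

lemma psum_1 (c : ℕ → ℂ) (h0 : c 0 = 0) (b : ℝ) (hb : 1 ≤ b) (q : ℝ) (hq : 0 ≤ q) (v : ℂ) (hv : -q ≤ v.re) :
    ‖∑ n ∈ Finset.Icc 1 ⌊b⌋₊, (n:ℂ)^(-v) * c n‖ ≤ b ^ q * (1 + ‖v‖) *
      (‖∑ n ∈ Finset.Icc 1 ⌊b⌋₊, c n‖ + ∫ x in (1:ℝ)..b, ‖∑ n ∈ Finset.Icc 1 ⌊x⌋₊, c n‖ / x) := by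
  have key := psum c h0 b hb q hq v hv
  rw [Icc01 c h0, Icc01 (fun n => (n:ℂ)^(-v) * c n) (by simp [h0])] at key
  simp_rw [Icc01 c h0] at key
  exact key

/-- the completely multiplicative weight -/
def gw (ψ : DirichletCharacter ℂ p) (z : ℂ) (n : ℕ) : ℂ := ψ (n : ZMod p) * (n:ℂ)^(-z)

lemma gw_mul (z : ℂ) (m n : ℕ) : gw ψ z (m*n) = gw ψ z m * gw ψ z n := by
  simp only [gw, Nat.cast_mul, map_mul, Complex.natCast_mul_natCast_cpow]; ring

lemma gw_one (z : ℂ) : gw ψ z 1 = 1 := by simp [gw]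

lemma nuT_van (n : ℕ) (h : D^4 < n) : nuT D χ n = 0 := by
  simp [nuT, not_le.mpr h]
lemma upsT_van (n : ℕ) (h : D^4 < n) : upsT D χ n = 0 := by
  simp [upsT, not_le.mpr h]

lemma F_gw (z : ℂ) : Ffun D χ ψ z = ∑ n ∈ Finset.Icc 1 (D^4), nuT D χ n * gw ψ z n := by
  rw [Ffun]; refine Finset.sum_congr rfl fun n hn => ?_
  simp only [Finset.mem_Icc] at hn
  simp [nuT, gw, hn.2, show n ≠ 0 by omega, mul_assoc]
lemma G_gw (z : ℂ) : Gfun D χ ψ z = ∑ n ∈ Finset.Icc 1 (D^4), upsT D χ n * gw ψ z n := by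
  rw [Gfun]; refine Finset.sum_congr rfl fun n hn => ?_
  simp only [Finset.mem_Icc] at hn
  simp [upsT, gw, hn.2, show n ≠ 0 by omega, mul_assoc]

lemma shift_term (a : ℂ) (z s : ℂ) (n : ℕ) (hn : 1 ≤ n) :
    (n:ℂ)^(-(z-s)) * (a * ψ (n : ZMod p) * (n:ℂ)^(-s)) = a * gw ψ z n := by
  have h0 : (n:ℂ) ≠ 0 := by exact_mod_cast (by omega : n ≠ 0)
  have : (n:ℂ)^(-z) = (n:ℂ)^(-(z-s)) * (n:ℂ)^(-s) := by
    rw [← Complex.cpow_add _ _ h0]; congr 1; ring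
  rw [gw, this]; ring

/-- 20th power bound, generic. -/
lemma pow20 (f : ArithmeticFunction ℂ) (hf : ∀ n, D^4 < n → f n = 0) (hD : 1 ≤ D) (z s : ℂ) (q : ℝ) (hq : 0 ≤ q)
    (hz : -q ≤ (z - s).re) :
    ‖∑ n ∈ Finset.Icc 1 (D^4), f n * gw ψ z n‖^20 ≤ ((D:ℝ)^80)^q * (1 + ‖z - s‖) *
      (‖∑ n ∈ Finset.Icc 1 ⌊(D:ℝ)^80⌋₊, (f^20) n * ψ (n : ZMod p) * (n:ℂ)^(-s)‖ +
        ∫ x in (1:ℝ)..((D:ℝ)^80), ‖∑ n ∈ Finset.Icc 1 ⌊x⌋₊, (f^20) n * ψ (n : ZMod p) * (n:ℂ)^(-s)‖ / x) := by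
  have h1 := (dpow (gw ψ z) (gw_mul z) (gw_one z) f (D^4) hf 20).1
  rw [← norm_pow, ← h1]
  have hD' : (1:ℝ) ≤ D := by exact_mod_cast hD
  have h2 := psum_1 (fun n => (f^20) n * ψ (n : ZMod p) * (n:ℂ)^(-s)) (by simp) ((D:ℝ)^80) (one_le_pow₀ hD') q hq (z-s) hz
  have hfl : ⌊(D:ℝ)^80⌋₊ = (D^4)^20 := by
    rw [← pow_mul, ← Nat.cast_pow, Nat.floor_natCast]
  refine le_trans (le_of_eq ?_) h2
  congr 1
  rw [hfl]
  refine Finset.sum_congr rfl fun n hn => ?_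
  rw [Finset.mem_Icc] at hn
  exact (shift_term _ z s n hn.1).symm

structure Big (L : ℝ) : Prop where
  h1 : 10^40 ≤ L
  h2 : 10^6 * Real.log L + 1000 * (KK + 1) ≤ L

structure Ctx (D : ℕ) {p : ℕ} (χ : DirichletCharacter ℂ D) (ψ : DirichletCharacter ℂ p) : Prop extends Hyp D χ ψ where
  big : Big (bigL D)
  i1 : Ineq1 D χ ψ
  i2 : Ineq2 D χ ψ
  i3 : Ineq3 D χ ψ
  hP1 : bigP D < p
  hP2 : (p:ℝ) < 2 * bigP D

lemma D_exp (h : 1 < D) : (D:ℝ) = Real.exp (bigL D) := by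
  rw [bigL, Real.exp_log]; exact_mod_cast (by omega : 0 < D)

lemma Dpow_exp (h : 1 < D) (k : ℕ) (q : ℝ) : ((D:ℝ)^k)^q = Real.exp (k * bigL D * q) := by
  rw [D_exp h, ← Real.exp_nat_mul, ← Real.exp_mul]

lemma Ctx.FG20 (h : Ctx D χ ψ) (z : ℂ) (q : ℝ) (hq : 0 ≤ q) (hz : 1/2 - q ≤ z.re) (hz2 : ‖z - s0 D‖ ≤ 2 * bigL D ^ 405) :
    ‖Ffun D χ ψ z‖^20 ≤ Real.exp (80 * bigL D * q) * (3 * bigL D ^ 1576) ∧ 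
    ‖Gfun D χ ψ z‖^20 ≤ Real.exp (80 * bigL D * q) * (3 * bigL D ^ 1576) := by
  have hL : 1 ≤ bigL D := le_trans (by norm_num) h.big.h1
  have hre : -q ≤ (z - s0 D).re := by
    simp [s0]; linarith
  have hD1 : (1:ℝ) ≤ D := by exact_mod_cast h.hD.le
  have hD80 : (1:ℝ) ≤ (D:ℝ)^80 := one_le_pow₀ hD1
  have hi := h.i1
  rw [Ineq1] at hi
  have int1 : IntervalIntegrable (fun x => ‖X1 D χ ψ x‖ / x) MeasureTheory.volume 1 ((D:ℝ)^80) := S_int _ _ hD80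
  have int2 : IntervalIntegrable (fun x => ‖X2 D χ ψ x‖ / x) MeasureTheory.volume 1 ((D:ℝ)^80) := S_int _ _ hD80
  have e : (∫ x in (1 : ℝ)..((D : ℝ) ^ 80), (‖X1 D χ ψ x‖ + ‖X2 D χ ψ x‖) / x) = 
     (∫ x in (1 : ℝ)..((D : ℝ) ^ 80), ‖X1 D χ ψ x‖ / x) + ∫ x in (1 : ℝ)..((D : ℝ) ^ 80), ‖X2 D χ ψ x‖ / x := by
    rw [← intervalIntegral.integral_add int1 int2]; simp_rw [add_div]
  rw [e] at hi
  have n1 : 0 ≤ ∫ x in (1 : ℝ)..((D : ℝ) ^ 80), ‖X1 D χ ψ x‖ / x := 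
    intervalIntegral.integral_nonneg hD80 fun x hx => div_nonneg (norm_nonneg _) (by linarith [hx.1])
  have n2 : 0 ≤ ∫ x in (1 : ℝ)..((D : ℝ) ^ 80), ‖X2 D χ ψ x‖ / x := 
    intervalIntegral.integral_nonneg hD80 fun x hx => div_nonneg (norm_nonneg _) (by linarith [hx.1])
  have n3 := norm_nonneg (X1 D χ ψ ((D:ℝ)^80))
  have n4 := norm_nonneg (X2 D χ ψ ((D:ℝ)^80))
  have hL405 : 1 ≤ bigL D ^ 405 := one_le_pow₀ hL
  have fin : ∀ B : ℝ, 0 ≤ B → B ≤ bigL D ^ 1171 → ((D:ℝ)^80)^q * (1 + ‖z - s0 D‖) * B ≤ Real.exp (80 * bigL D * q) * (3 * bigL D ^ 1576) := by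
    intro B hB0 hB
    rw [Dpow_exp h.hD]
    push_cast
    rw [mul_assoc]
    refine mul_le_mul_of_nonneg_left ?_ (Real.exp_pos _).le
    calc (1 + ‖z - s0 D‖) * B ≤ (3 * bigL D ^ 405) * bigL D ^ 1171 := by
          refine mul_le_mul (by linarith) hB hB0 (by positivity)
      _ = _ := by ring
  constructor
  · rw [F_gw]
    refine (pow20 (nuT D χ) nuT_van h.hD.le z (s0 D) q hq hre).trans ?_
    exact fin _ (add_nonneg n3 n1) (show ‖X1 D χ ψ ((D:ℝ)^80)‖ + (∫ x in (1 : ℝ)..((D : ℝ) ^ 80), ‖X1 D χ ψ x‖ / x) ≤ _ by linarith)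
  · rw [G_gw]
    refine (pow20 (upsT D χ) upsT_van h.hD.le z (s0 D) q hq hre).trans ?_
    exact fin _ (add_nonneg n4 n2) (show ‖X2 D χ ψ ((D:ℝ)^80)‖ + (∫ x in (1 : ℝ)..((D : ℝ) ^ 80), ‖X2 D χ ψ x‖ / x) ≤ _ by linarith)

lemma Ctx.FG (h : Ctx D χ ψ) (z : ℂ) (q : ℝ) (hq : 0 ≤ q) (hz : 1/2 - q ≤ z.re) (hz2 : ‖z - s0 D‖ ≤ 2 * bigL D ^ 405) :
    ‖Ffun D χ ψ z‖ ≤ Real.exp (4 * bigL D * q) * bigL D ^ 79 ∧ 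
    ‖Gfun D χ ψ z‖ ≤ Real.exp (4 * bigL D * q) * bigL D ^ 79 := by
  have hL : 10^40 ≤ bigL D := h.big.h1
  have hL0 : 0 < bigL D := lt_of_lt_of_le (by norm_num) hL
  have key : Real.exp (80 * bigL D * q) * (3 * bigL D ^ 1576) ≤ (Real.exp (4 * bigL D * q) * bigL D ^ 79)^20 := by
    rw [mul_pow, ← Real.exp_nat_mul, ← pow_mul]
    have e1 : ((20:ℕ):ℝ) * (4 * bigL D * q) = 80 * bigL D * q := by push_cast; ring
    rw [e1]
    refine mul_le_mul_of_nonneg_left ?_ (Real.exp_pos _).le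
    have h4 : 3 ≤ bigL D ^ 4 := le_trans (by norm_num) (pow_le_pow_left₀ (by norm_num) hL 4)
    calc 3 * bigL D ^ 1576 ≤ bigL D ^ 4 * bigL D ^ 1576 := mul_le_mul_of_nonneg_right h4 (by positivity)
      _ = _ := by ring
  have h20 := h.FG20 z q hq hz hz2
  constructor
  · exact le_of_pow_le_pow_left₀ (by norm_num) (by positivity) (h20.1.trans key)
  · exact le_of_pow_le_pow_left₀ (by norm_num) (by positivity) (h20.2.trans key)

lemma sumIoc (f : ℕ → ℂ) (N : ℕ) (m : ℕ) : ∑ n ∈ Finset.Ioc N m, (if n ≤ N then 0 else f n) = ∑ n ∈ Finset.Ioc N m, f n := by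
  refine Finset.sum_congr rfl fun n hn => ?_
  rw [Finset.mem_Ioc] at hn
  rw [if_neg (by omega)]

lemma psum_b (f : ℕ → ℂ) (N : ℕ) (hN : 1 ≤ N) (b : ℝ) (hb : (N:ℝ) ≤ b) (q : ℝ) (hq : 0 ≤ q) (z s : ℂ) (hv : -q ≤ (z-s).re) :
    ‖∑ n ∈ Finset.Ioc N ⌊b⌋₊, f n * gw ψ z n‖ ≤ b ^ q * (1 + ‖z-s‖) *
      (‖∑ n ∈ Finset.Ioc N ⌊b⌋₊, f n * ψ (n : ZMod p) * (n:ℂ)^(-s)‖ + ∫ x in (N:ℝ)..b, ‖∑ n ∈ Finset.Ioc N ⌊x⌋₊, f n * ψ (n : ZMod p) * (n:ℂ)^(-s)‖ / x) := by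
  have := psum_a (fun n => if n ≤ N then 0 else f n * ψ (n : ZMod p) * (n:ℂ)^(-s)) N hN (fun n hn => by simp [hn]) b hb q hq (z-s) hv
  simp_rw [sumIoc] at this
  refine le_trans (le_of_eq ?_) this
  congr 1
  refine Finset.sum_congr rfl fun n hn => ?_
  rw [Finset.mem_Ioc] at hn
  rw [if_neg (by omega)]
  exact (shift_term _ z s n (by omega)).symm

lemma Ctx.D4 (h : Ctx D χ ψ) : (D:ℝ)^4 ≤ bigP D ^ 2 := by
  have hL : 10^40 ≤ bigL D := h.big.h1
  have hL0 : 0 < bigL D := lt_of_lt_of_le (by norm_num) hL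
  rw [bigP, D_exp h.hD, ← Real.exp_nat_mul, ← Real.exp_nat_mul, Real.exp_le_exp]
  push_cast
  have h8 : (10^40)^8 ≤ bigL D ^ 8 := pow_le_pow_left₀ (by norm_num) hL 8
  calc 4 * bigL D ≤ 2 * (bigL D ^ 8 * bigL D) := by nlinarith
    _ = _ := by ring

lemma Ctx.T (h : Ctx D χ ψ) (z : ℂ) (q : ℝ) (hq : 0 ≤ q) (hz : 1/2 - q ≤ z.re) (hz2 : ‖z - s0 D‖ ≤ 2 * bigL D ^ 405) :
    ‖Tfun D χ ψ z‖ ≤ Real.exp (2 * bigL D^9 * q) * (3 * bigL D ^ (-180 : ℤ)) := by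
  have hL : 1 ≤ bigL D := le_trans (by norm_num) h.big.h1
  have hre : -q ≤ (z - s0 D).re := by
    simp [s0]; linarith
  have hN : 1 ≤ D^4 := Nat.one_le_pow _ _ (by have := h.hD; omega)
  have key := psum_b (ψ := ψ) (nuF D χ) (D^4) hN (bigP D ^ 2) (by push_cast; exact h.D4) q hq z (s0 D) hre
  have hi := h.i2
  rw [Ineq2] at hi
  have hT : Tfun D χ ψ z = ∑ n ∈ Finset.Ioc (D^4) ⌊bigP D ^ 2⌋₊, nuF D χ n * gw ψ z n := by
    rw [Tfun]; refine Finset.sum_congr rfl fun n _ => by rw [gw, mul_assoc]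
  rw [hT]
  refine key.trans ?_
  have hP : (bigP D ^ 2)^q = Real.exp (2 * bigL D^9 * q) := by
    rw [bigP, ← Real.exp_nat_mul, ← Real.exp_mul]; push_cast; rfl
  rw [hP, mul_assoc]
  refine mul_le_mul_of_nonneg_left ?_ (Real.exp_pos _).le
  have hL405 : 1 ≤ bigL D ^ 405 := one_le_pow₀ hL
  have hz585 : 0 ≤ bigL D ^ (-585:ℤ) := by positivity
  calc _ ≤ (1 + ‖z - s0 D‖) * bigL D ^ (-585:ℤ) := by
        refine mul_le_mul_of_nonneg_left ?_ (by positivity)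
        push_cast
        exact hi.le
    _ ≤ (3 * bigL D ^ 405) * bigL D ^ (-585:ℤ) := mul_le_mul_of_nonneg_right (by linarith) hz585
    _ = _ := by
        rw [mul_assoc, ← zpow_natCast, ← zpow_add₀ (by linarith)]; norm_num

lemma sig_conv (n : ℕ) (_hn : n ≠ 0) : sigF D χ n = (nuT D χ * upsT D χ) n := by
  rw [ArithmeticFunction.mul_apply, Nat.sum_divisorsAntidiagonal (f := fun i j => nuT D χ i * upsT D χ j), sigF]
  refine Finset.sum_congr rfl fun d hd => ?_
  have h1 : d ≠ 0 := by have := Nat.pos_of_mem_divisors hd; omega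
  have h2 : n / d ≠ 0 := by
    have := Nat.div_pos (Nat.divisor_le hd) (Nat.pos_of_mem_divisors hd); omega
  simp only [nuT, upsT, ArithmeticFunction.coe_mk, if_neg h1, if_neg h2]
  split_ifs <;> simp_all

/-- arithmetic function version of chi -/
def chiA (χ : DirichletCharacter ℂ D) : ArithmeticFunction ℂ := ⟨fun n => if n = 0 then 0 else χ (n : ZMod D), by simp⟩
def muChiA (χ : DirichletCharacter ℂ D) : ArithmeticFunction ℂ :=
  ⟨fun n => if n = 0 then 0 else ((ArithmeticFunction.moebius n : ℤ) : ℂ) * χ (n : ZMod D), by simp⟩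

lemma chiA_mu : chiA χ * muChiA χ = 1 := by
  ext n
  rcases eq_or_ne n 0 with rfl | hn
  · simp
  have h : (((ArithmeticFunction.zeta : ArithmeticFunction ℂ) * (ArithmeticFunction.moebius : ArithmeticFunction ℂ) : ArithmeticFunction ℂ)) n = (1 : ArithmeticFunction ℂ) n := by
    rw [ArithmeticFunction.coe_zeta_mul_coe_moebius]
  rw [ArithmeticFunction.mul_apply] at h ⊢
  have : ∀ x ∈ n.divisorsAntidiagonal, chiA χ x.1 * muChiA χ x.2 = χ (n : ZMod D) * (((ArithmeticFunction.zeta : ArithmeticFunction ℂ) x.1) * ((ArithmeticFunction.moebius : ArithmeticFunction ℂ) x.2)) := by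
    intro x hx
    rw [Nat.mem_divisorsAntidiagonal] at hx
    have h1 : x.1 ≠ 0 := by rintro h; rw [h] at hx; simp at hx; omega
    have h2 : x.2 ≠ 0 := by rintro h; rw [h] at hx; simp at hx; omega
    rw [← hx.1]
    simp [chiA, muChiA, h1, h2]
    ring
  rw [Finset.sum_congr rfl this, ← Finset.mul_sum, h]
  by_cases hn1 : n = 1
  · subst hn1; simp
  · simp [hn1]

lemma nu_ups (n : ℕ) (hn : n ≠ 0) : ∑ d ∈ n.divisors, nuF D χ d * upsF D χ (n/d) = if n = 1 then 1 else 0 := by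
  have h1 : ∀ m : ℕ, m ≠ 0 → nuF D χ m = (chiA χ * (ArithmeticFunction.zeta : ArithmeticFunction ℂ)) m := by
    intro m _
    rw [ArithmeticFunction.coe_mul_zeta_apply, nuF]
    refine Finset.sum_congr rfl fun d hd => ?_
    have := Nat.pos_of_mem_divisors hd
    simp [chiA, show d ≠ 0 by omega]
  have h2 : ∀ m : ℕ, m ≠ 0 → upsF D χ m = (muChiA χ * (ArithmeticFunction.moebius : ArithmeticFunction ℂ)) m := by
    intro m _
    rw [ArithmeticFunction.mul_apply, Nat.sum_divisorsAntidiagonal (f := fun i j => muChiA χ i * (ArithmeticFunction.moebius : ArithmeticFunction ℂ) j), upsF]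
    refine Finset.sum_congr rfl fun d hd => ?_
    have := Nat.pos_of_mem_divisors hd
    simp [muChiA, show d ≠ 0 by omega]
    ring
  have h3 : ∑ d ∈ n.divisors, nuF D χ d * upsF D χ (n/d) = ((chiA χ * (ArithmeticFunction.zeta : ArithmeticFunction ℂ)) * (muChiA χ * (ArithmeticFunction.moebius : ArithmeticFunction ℂ))) n := by
    rw [ArithmeticFunction.mul_apply, Nat.sum_divisorsAntidiagonal (f := fun i j => (chiA χ * (ArithmeticFunction.zeta : ArithmeticFunction ℂ)) i * (muChiA χ * (ArithmeticFunction.moebius : ArithmeticFunction ℂ)) j)]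
    refine Finset.sum_congr rfl fun d hd => ?_
    have := Nat.pos_of_mem_divisors hd
    have := Nat.div_pos (Nat.divisor_le hd) (Nat.pos_of_mem_divisors hd)
    rw [h1 d (by omega), h2 (n/d) (by omega)]
  rw [h3, mul_mul_mul_comm, chiA_mu, ArithmeticFunction.coe_zeta_mul_coe_moebius, one_mul, ArithmeticFunction.one_apply]

lemma sig_small (n : ℕ) (hn : n ≠ 0) (h : n ≤ D^4) : sigF D χ n = if n = 1 then 1 else 0 := by
  rw [← nu_ups (χ := χ) n hn, sigF]
  refine Finset.sum_congr rfl fun d hd => ?_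
  rw [if_pos ⟨(Nat.divisor_le hd).trans h, (Nat.div_le_self n d).trans h⟩]

lemma FG_sum (hD : 1 < D) (z : ℂ) : Ffun D χ ψ z * Gfun D χ ψ z = 1 + ∑ n ∈ Finset.Ioc (D^4) (D^8), sigF D χ n * gw ψ z n := by
  have h1 := (dprod (gw ψ z) (gw_mul z) (nuT D χ) (upsT D χ) (D^4) (D^4) nuT_van upsT_van).1
  rw [F_gw, G_gw, ← h1]
  have e : D^4 * D^4 = D^8 := by ring
  rw [e]
  have hN : 1 ≤ D^4 := Nat.one_le_pow _ _ (by omega)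
  have hN2 : D^4 ≤ D^8 := Nat.pow_le_pow_right (by omega) (by norm_num)
  have h2 : ∑ n ∈ Finset.Icc 1 (D^8), (nuT D χ * upsT D χ) n * gw ψ z n = ∑ n ∈ Finset.Icc 1 (D^8), sigF D χ n * gw ψ z n := by
    refine Finset.sum_congr rfl fun n hn => ?_
    rw [Finset.mem_Icc] at hn
    rw [sig_conv n (by omega)]
  rw [h2]
  have h3 : Finset.Icc 1 (D^8) = Finset.Icc 1 (D^4) ∪ Finset.Ioc (D^4) (D^8) := by
    ext n; simp only [Finset.mem_union, Finset.mem_Icc, Finset.mem_Ioc]; omega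
  have hd : Disjoint (Finset.Icc 1 (D^4)) (Finset.Ioc (D^4) (D^8)) := by
    rw [Finset.disjoint_left]; intro n; simp only [Finset.mem_Icc, Finset.mem_Ioc]; omega
  rw [h3, Finset.sum_union hd]
  congr 1
  rw [Finset.sum_eq_single_of_mem 1 (by simp; omega)]
  · rw [sig_small 1 (by norm_num) hN, gw_one]; simp
  · intro n hn hn1
    rw [Finset.mem_Icc] at hn
    rw [sig_small n (by omega) hn.2, if_neg hn1, zero_mul]

lemma exp_nat_le (k : ℕ) : Real.exp (k:ℝ) ≤ 3 ^ k := by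
  have : Real.exp (k:ℝ) = Real.exp 1 ^ k := by rw [← Real.exp_nat_mul]; simp
  rw [this]
  exact pow_le_pow_left₀ (Real.exp_pos 1).le (by linarith [Real.exp_one_lt_d9]) k

lemma Ctx.FG1 (h : Ctx D χ ψ) (z : ℂ) (hz : 1/2 - (bigL D)⁻¹ ≤ z.re) (hz2 : ‖z - s0 D‖ ≤ 2 * bigL D ^ 405) :
    ‖Ffun D χ ψ z * Gfun D χ ψ z - 1‖ ≤ bigL D ^ (-227 : ℤ) := by
  have hLb : 10^40 ≤ bigL D := h.big.h1
  have hL : 1 ≤ bigL D := le_trans (by norm_num) h.big.h1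
  have hL0 : 0 < bigL D := by linarith
  have hq : 0 ≤ (bigL D)⁻¹ := by positivity
  have hre : -(bigL D)⁻¹ ≤ (z - s0 D).re := by
    simp [s0]; linarith
  have hN : 1 ≤ D^4 := Nat.one_le_pow _ _ (by have := h.hD; omega)
  have hDD : (D:ℝ)^4 ≤ (D:ℝ)^8 := pow_le_pow_right₀ (by exact_mod_cast h.hD.le) (by norm_num)
  have key := psum_b (ψ := ψ) (sigF D χ) (D^4) hN ((D:ℝ)^8) (by push_cast; exact hDD) _ hq z (s0 D) hre
  have hi := h.i3
  rw [Ineq3] at hi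
  rw [FG_sum h.hD, add_sub_cancel_left]
  have hfl : ⌊(D:ℝ)^8⌋₊ = D^8 := by rw [← Nat.cast_pow, Nat.floor_natCast]
  have hT : ∑ n ∈ Finset.Ioc (D^4) (D^8), sigF D χ n * gw ψ z n = ∑ n ∈ Finset.Ioc (D^4) ⌊(D:ℝ)^8⌋₊, sigF D χ n * gw ψ z n := by rw [hfl]
  rw [hT]
  refine key.trans ?_
  rw [Dpow_exp h.hD]
  have e8 : Real.exp (((8:ℕ):ℝ) * bigL D * (bigL D)⁻¹) ≤ 3^8 := by
    rw [mul_assoc, mul_inv_cancel₀ hL0.ne', mul_one]; exact exp_nat_le 8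
  have hL405 : 1 ≤ bigL D ^ 405 := one_le_pow₀ hL
  have hz585 : 0 ≤ bigL D ^ (-633:ℤ) := by positivity
  calc _ ≤ 3^8 * (1 + ‖z - s0 D‖) * bigL D ^ (-633:ℤ) := by
        refine mul_le_mul (mul_le_mul_of_nonneg_right e8 (by positivity)) ?_ ?_ (by positivity)
        · push_cast; exact hi.le
        · refine add_nonneg (norm_nonneg _) (intervalIntegral.integral_nonneg (by push_cast; exact hDD) fun x hx => div_nonneg (norm_nonneg _) ?_)
          exact le_trans (by positivity) hx.1
    _ ≤ 3^8 * (3 * bigL D ^ 405) * bigL D ^ (-633:ℤ) := mul_le_mul_of_nonneg_right (mul_le_mul_of_nonneg_left (by linarith) (by norm_num)) hz585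
    _ ≤ bigL D * bigL D ^ 405 * bigL D ^ (-633:ℤ) := by
        refine mul_le_mul_of_nonneg_right ?_ hz585
        nlinarith
    _ = _ := by
        rw [mul_assoc, ← zpow_natCast, ← zpow_add₀ (by linarith), mul_comm, ← zpow_add_one₀ (by linarith)]; norm_num
end PartNo7

section PartNo8
open Complex

lemma int_inv_abs (η H : ℝ) (hη : 0 < η) (hH : 0 < H) :
    ∫ y in (-H)..H, (η + |y|)⁻¹ = 2 * Real.log ((η + H)/η) := by
  have hc : Continuous (fun y : ℝ => (η + |y|)⁻¹) := by
    refine Continuous.inv₀ (by fun_prop) fun y => ?_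
    have := abs_nonneg y; linarith
  have h1 : ∫ y in (0:ℝ)..H, (η + |y|)⁻¹ = Real.log ((η + H)/η) := by
    have : ∫ y in (0:ℝ)..H, (η + |y|)⁻¹ = ∫ y in (0:ℝ)..H, (η + y)⁻¹ := by
      refine intervalIntegral.integral_congr fun y hy => ?_
      rw [Set.uIcc_of_le hH.le] at hy
      simp only [abs_of_nonneg hy.1]
    rw [this, intervalIntegral.integral_comp_add_left (fun x => x⁻¹), integral_inv_of_pos (by linarith) (by linarith), add_zero]
  have h2 : ∫ y in (-H)..0, (η + |y|)⁻¹ = ∫ y in (0:ℝ)..H, (η + |y|)⁻¹ := by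
    have := intervalIntegral.integral_comp_neg (a := 0) (b := H) (fun y => (η + |y|)⁻¹)
    simp only [abs_neg, neg_zero] at this
    exact this.symm
  rw [← intervalIntegral.integral_add_adjacent_intervals (hc.intervalIntegrable _ 0) (hc.intervalIntegrable 0 _), h2, h1]; ring

lemma line_cont (f : ℂ → ℂ) (a b H x : ℝ) (hx : x ∈ Set.Icc a b) (hH : 0 ≤ H)
    (hd : DifferentiableOn ℂ f (Set.Icc a b ×ℂ Set.Icc (-H) H)) :
    ContinuousOn (fun y : ℝ => f (x + y * I)) (Set.uIcc (-H) H) := by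
  refine hd.continuousOn.comp (by fun_prop) ?_
  intro y hy
  rw [Set.uIcc_of_le (by linarith)] at hy
  rw [Complex.mem_reProdIm]
  simpa using ⟨hx, hy⟩

lemma norm_ge_re (x y : ℝ) : |x| ≤ ‖(x:ℂ) + y * I‖ := by
  have := Complex.abs_re_le_norm ((x:ℂ) + y * I); simpa using this
lemma norm_ge_im (x y : ℝ) : |y| ≤ ‖(x:ℂ) + y * I‖ := by
  have := Complex.abs_im_le_norm ((x:ℂ) + y * I); simpa using this

lemma log_line (f : ℂ → ℂ) (x H B : ℝ) (hx : x ≠ 0) (hH : 0 < H)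
    (hB : ∀ y ∈ Set.Icc (-H) H, ‖f (x + y*I)‖ ≤ B) :
    ‖∫ y in (-H)..H, f (x + y*I) / (x + y*I)‖ ≤ 4 * B * Real.log ((|x| + H)/|x|) := by
  have hx' : 0 < |x| := abs_pos.mpr hx
  have hc : Continuous (fun y : ℝ => (|x| + |y|)⁻¹) := by
    refine Continuous.inv₀ (by fun_prop) fun y => ?_
    have := abs_nonneg y; linarith
  have hB0 : 0 ≤ B := le_trans (norm_nonneg _) (hB 0 ⟨by linarith, by linarith⟩)
  have : ‖∫ y in (-H)..H, f (x + y*I) / (x + y*I)‖ ≤ ∫ y in (-H)..H, 2 * B * (|x| + |y|)⁻¹ := by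
    refine intervalIntegral.norm_integral_le_of_norm_le (by linarith) (Filter.Eventually.of_forall fun y hy => ?_) ((continuous_const.mul hc).intervalIntegrable _ _)
    rw [norm_div, div_eq_mul_inv]
    have h1 := norm_ge_re x y
    have h2 := norm_ge_im x y
    have h3 : 0 ≤ |y| := abs_nonneg y
    have h4 : ‖(x:ℂ) + y*I‖⁻¹ ≤ 2 * (|x| + |y|)⁻¹ := by
      rw [inv_le_comm₀ (by linarith) (by positivity), mul_inv, inv_inv]; linarith
    calc _ ≤ B * (2 * (|x| + |y|)⁻¹) := mul_le_mul (hB y ⟨hy.1.le, hy.2⟩) h4 (by positivity) hB0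
      _ = _ := by ring
  refine this.trans ?_
  rw [intervalIntegral.integral_const_mul, int_inv_abs _ _ hx' hH]
  linarith

lemma AFE_abs (g T1 T2 : ℂ → ℂ) (a b H η B ε : ℝ) (ha : a ≤ -1) (hb : 1 ≤ b) (hH : 1 ≤ H) (hη : 0 < η) (hη1 : η < 1)
    (hg : DifferentiableOn ℂ g (Set.Icc a b ×ℂ Set.Icc (-H) H))
    (hT1 : DifferentiableOn ℂ T1 (Set.Icc a b ×ℂ Set.Icc (-H) H))
    (hT2 : DifferentiableOn ℂ T2 (Set.Icc a b ×ℂ Set.Icc (-H) H))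
    (r1 : ∀ y ∈ Set.Icc (-H) H, ‖g (b + y*I) - T1 (b + y*I)‖ ≤ ε)
    (r2 : ∀ y ∈ Set.Icc (-H) H, ‖g (a + y*I) - T2 (a + y*I)‖ ≤ ε)
    (e : ∀ x ∈ Set.Icc a b, ∀ y : ℝ, |y| = H → ‖g (x + y*I)‖ ≤ ε ∧ ‖T1 (x + y*I)‖ ≤ ε ∧ ‖T2 (x + y*I)‖ ≤ ε)
    (b1 : ∀ y ∈ Set.Icc (-H) H, ‖T1 (η + y*I)‖ ≤ B)
    (b2 : ∀ y ∈ Set.Icc (-H) H, ‖T2 ((-η : ℝ) + y*I)‖ ≤ B) :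
    2 * Real.pi * ‖g 0‖ ≤ 4 * H * ε + 6 * (b - a) * ε + 8 * B * Real.log ((η + H)/η) := by
  have hH0 : 0 < H := by linarith
  have hε : 0 ≤ ε := le_trans (norm_nonneg _) (r1 0 ⟨by linarith, by linarith⟩)
  have dv : ∀ f : ℂ → ℂ, ∀ w : ℂ, 1 ≤ ‖w‖ → ‖f w‖ ≤ ε → ‖f w / w‖ ≤ ε := by
    intro f w hw hf
    rw [norm_div]; exact (div_le_self (norm_nonneg _) hw).trans hf
  have hor : ∀ f : ℂ → ℂ, (∀ x ∈ Set.Icc a b, ∀ y : ℝ, |y| = H → ‖f (x + y*I)‖ ≤ ε) → ∀ x ∈ Set.Icc a b, 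
      ‖f (x + ((-H:ℝ):ℂ)*I) / (x + ((-H:ℝ):ℂ)*I)‖ ≤ ε ∧ ‖f (x + (H:ℂ)*I) / (x + (H:ℂ)*I)‖ ≤ ε := by
    intro f hf x hx
    constructor
    · refine dv f _ ?_ (hf x hx (-H) (by rw [abs_neg, abs_of_pos hH0]))
      refine le_trans ?_ (norm_ge_im x (-H)); rw [abs_neg, abs_of_pos hH0]; exact hH
    · refine dv f _ ?_ (hf x hx H (abs_of_pos hH0))
      refine le_trans ?_ (norm_ge_im x (H)); rw [abs_of_pos hH0]; exact hH
  have R := rect_pole g a b H ε (by linarith) (by linarith) hH0 hg (hor g fun x hx y hy => (e x hx y hy).1)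
  -- line integrals
  set J : (ℂ → ℂ) → ℝ → ℂ := fun f x => ∫ y in (-H)..H, f (x + y*I) / (x + y*I) with hJ
  have dd : ∀ f : ℂ → ℂ, DifferentiableOn ℂ f (Set.Icc a b ×ℂ Set.Icc (-H) H) → ∀ a' b' : ℝ, a ≤ a' → b' ≤ b → (∀ x ∈ Set.Icc a' b', x ≠ 0) →
      DifferentiableOn ℂ (fun w => f w / w) (Set.Icc a' b' ×ℂ Set.Icc (-H) H) := by
    intro f hf a' b' ha' hb' hne
    refine (hf.mono ?_).div differentiableOn_id ?_
    · intro w hw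
      rw [Complex.mem_reProdIm] at hw ⊢
      exact ⟨⟨ha'.trans hw.1.1, hw.1.2.trans hb'⟩, hw.2⟩
    · intro w hw h0
      rw [Complex.mem_reProdIm] at hw
      exact hne _ hw.1 (by simp [show w = 0 from h0])
  have ii : ∀ f : ℂ → ℂ, DifferentiableOn ℂ f (Set.Icc a b ×ℂ Set.Icc (-H) H) → ∀ x : ℝ, x ∈ Set.Icc a b → x ≠ 0 →
      IntervalIntegrable (fun y : ℝ => f (x + y*I) / (x + y*I)) MeasureTheory.volume (-H) H := by
    intro f hf x hx hx0
    refine ContinuousOn.intervalIntegrable ?_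
    refine line_cont (fun w => f w / w) x x H x ⟨le_rfl, le_rfl⟩ hH0.le (dd f hf x x hx.1 hx.2 ?_)
    intro x' hx'; rwa [show x' = x from le_antisymm hx'.2 hx'.1]
  have s1 : ‖J T1 b - J T1 η‖ ≤ 2 * (b - η) * ε := by
    refine rect_shift (fun w => T1 w / w) η b H ε (by linarith) hH0.le (dd T1 hT1 _ _ (by linarith) le_rfl ?_) ?_
    · intro x hx; linarith [hx.1]
    · intro x hx; exact hor T1 (fun x hx y hy => (e x hx y hy).2.1) x ⟨by linarith [hx.1], hx.2⟩
  have s2 : ‖J T2 (-η) - J T2 a‖ ≤ 2 * (-η - a) * ε := by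
    refine rect_shift (fun w => T2 w / w) a (-η) H ε (by linarith) hH0.le (dd T2 hT2 _ _ le_rfl (by linarith) ?_) ?_
    · intro x hx; linarith [hx.2]
    · intro x hx; exact hor T2 (fun x hx y hy => (e x hx y hy).2.2) x ⟨hx.1, by linarith [hx.2]⟩
  have v : ∀ T : ℂ → ℂ, DifferentiableOn ℂ T (Set.Icc a b ×ℂ Set.Icc (-H) H) → ∀ x ∈ Set.Icc a b, 1 ≤ |x| →
      (∀ y ∈ Set.Icc (-H) H, ‖g (x + y*I) - T (x + y*I)‖ ≤ ε) → ‖J g x - J T x‖ ≤ 2 * H * ε := by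
    intro T hT x hx hx1 hr
    have hx0 : x ≠ 0 := by intro h; rw [h] at hx1; simp at hx1; linarith
    rw [hJ]
    simp only
    rw [← intervalIntegral.integral_sub (ii g hg x hx hx0) (ii T hT x hx hx0)]
    have := intervalIntegral.norm_integral_le_of_norm_le_const (a := -H) (b := H) (C := ε) (f := fun y : ℝ => g (x + y*I) / (x + y*I) - T (x + y*I) / (x + y*I)) ?_
    · refine this.trans (le_of_eq ?_)
      rw [abs_of_pos (by linarith)]; ring
    · intro y hy
      rw [Set.uIoc_of_le (by linarith)] at hy
      rw [← sub_div]
      exact dv (fun w => g w - T w) _ (hx1.trans (norm_ge_re x y)) (hr y ⟨hy.1.le, hy.2⟩)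
  have v1 := v T1 hT1 b ⟨by linarith, le_rfl⟩ (by rw [abs_of_pos (by linarith)]; exact hb) r1
  have v2 := v T2 hT2 a ⟨le_rfl, by linarith⟩ (by rw [abs_of_neg (by linarith)]; linarith) r2
  have l1 : ‖J T1 η‖ ≤ 4 * B * Real.log ((η + H)/η) := by
    have := log_line T1 η H B hη.ne' hH0 b1
    rwa [abs_of_pos hη] at this
  have l2 : ‖J T2 (-η)‖ ≤ 4 * B * Real.log ((η + H)/η) := by
    have := log_line T2 (-η) H B (by linarith) hH0 b2
    rwa [abs_neg, abs_of_pos hη] at this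
  have R' : ‖J g b - J g a - 2 * Real.pi * g 0‖ ≤ 2 * (b - a) * ε := R
  have id1 : (2 * Real.pi * g 0 : ℂ) = -(J g b - J g a - 2 * Real.pi * g 0) + (J g b - J T1 b) + (J T1 b - J T1 η) + J T1 η
      - (J g a - J T2 a) + (J T2 (-η) - J T2 a) - J T2 (-η) := by ring
  have nn : ‖(2 * Real.pi * g 0 : ℂ)‖ = 2 * Real.pi * ‖g 0‖ := by
    rw [norm_mul, norm_mul, Complex.norm_real, Real.norm_eq_abs, abs_of_pos Real.pi_pos]; simp
  rw [← nn, id1]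
  have tri : ∀ u1 u2 u3 u4 u5 u6 u7 : ℂ, ‖-u1 + u2 + u3 + u4 - u5 + u6 - u7‖ ≤ ‖u1‖ + ‖u2‖ + ‖u3‖ + ‖u4‖ + ‖u5‖ + ‖u6‖ + ‖u7‖ := by
    intro u1 u2 u3 u4 u5 u6 u7
    have a1 := norm_sub_le (-u1 + u2 + u3 + u4 - u5 + u6) u7
    have a2 := norm_add_le (-u1 + u2 + u3 + u4 - u5) u6
    have a3 := norm_sub_le (-u1 + u2 + u3 + u4) u5
    have a4 := norm_add_le (-u1 + u2 + u3) u4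
    have a5 := norm_add_le (-u1 + u2) u3
    have a6 := norm_add_le (-u1) u2
    rw [norm_neg] at a6
    linarith
  refine (tri _ _ _ _ _ _ _).trans ?_
  have hηε : 0 ≤ η * ε := by positivity
  nlinarith
end PartNo8

section PartNo9
open Complex
variable {D p : ℕ} {χ : DirichletCharacter ℂ D} {ψ : DirichletCharacter ℂ p}

def Near (D : ℕ) (z : ℂ) : Prop := |z.im - 2 * Real.pi * t0 D| ≤ bigL D ^ 405 + 2 + bigL D ^ 10

lemma Big.pos {L : ℝ} (h : Big L) : 0 < L := lt_of_lt_of_le (by norm_num) h.h1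
lemma Big.one {L : ℝ} (h : Big L) : 1 ≤ L := le_trans (by norm_num) h.h1
lemma Big.log {L : ℝ} (h : Big L) : 10^6 * Real.log L ≤ L := by
  have := h.h2; have := KK_nonneg; linarith
lemma Big.step {L : ℝ} (h : Big L) (k : ℕ) : 10^40 * L^k ≤ L^(k+1) := by
  rw [pow_succ, mul_comm]; exact mul_le_mul_of_nonneg_left h.h1 (by have := h.pos; positivity)
lemma Big.AL {L : ℝ} (h : Big L) : 10^40 * L ≤ L^9 := by
  have h1 := h.step 1
  have h2 : L^(1+1) ≤ L^9 := pow_le_pow_right₀ h.one (by norm_num)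
  simp only [pow_one] at h1
  linarith

lemma near_norm (h : Big (bigL D)) (z : ℂ) (hz : Near D z) (hr : |z.re - 1/2| ≤ 20) : ‖z - s0 D‖ ≤ 2 * bigL D ^ 405 := by
  have h1 := Complex.norm_le_abs_re_add_abs_im (z - s0 D)
  have e1 : (z - s0 D).re = z.re - 1/2 := by simp [s0]
  have e2 : (z - s0 D).im = z.im - 2 * Real.pi * t0 D := by simp [s0]
  rw [e1, e2] at h1
  have := hz
  rw [Near] at this
  have h2 : 10^40 * bigL D ^ 10 ≤ bigL D ^ 405 := (h.step 10).trans (pow_le_pow_right₀ h.one (by norm_num))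
  have h3 : 1 ≤ bigL D ^ 10 := one_le_pow₀ h.one
  linarith

lemma near_im (h : Big (bigL D)) (z : ℂ) (hz : Near D z) : t0 D ≤ z.im ∧ z.im ≤ 10 * t0 D ∧ 10^40 ≤ t0 D := by
  rw [Near, abs_le] at hz
  have h2 : 10^40 * bigL D ^ 10 ≤ bigL D ^ 519 := (h.step 10).trans (pow_le_pow_right₀ h.one (by norm_num))
  have h4 : 10^40 * bigL D ^ 405 ≤ bigL D ^ 519 := (h.step 405).trans (pow_le_pow_right₀ h.one (by norm_num))
  have h3 : 1 ≤ bigL D ^ 10 := one_le_pow₀ h.one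
  have e : t0 D = bigL D ^ 519 := rfl
  have hp1 := Real.pi_gt_three
  have hp2 := Real.pi_lt_d2
  have ht : 0 < t0 D := by rw [e]; linarith
  have h5 : 6 * t0 D ≤ 2 * Real.pi * t0 D := by nlinarith
  have h6 : 2 * Real.pi * t0 D ≤ 7 * t0 D := by nlinarith
  rw [← e] at h2 h4
  refine ⟨by linarith, by linarith, by linarith⟩

lemma Ctx.logp (h : Ctx D χ ψ) : bigL D ^ 9 ≤ Real.log p ∧ Real.log p ≤ bigL D ^ 9 + 1 := by
  have hP : 0 < bigP D := Real.exp_pos _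
  have e : Real.log (bigP D) = bigL D ^ 9 := Real.log_exp _
  constructor
  · rw [← e]; exact Real.log_le_log hP h.hP1.le
  · have := Real.log_le_log (lt_trans hP h.hP1) h.hP2.le
    rw [Real.log_mul (by norm_num) hP.ne', e] at this
    linarith [Real.log_two_lt_d9]

lemma Ctx.Zt_log (h : Ctx D χ ψ) (s : ℂ) (hs : |s.re - 1/2| ≤ 6) (hn : Near D s) :
    |Real.log ‖Ztilde D χ ψ s‖ + (s.re - 1/2) * (2 * bigL D ^ 9 + bigL D)| ≤ |s.re - 1/2| * bigL D := by
  obtain ⟨t1, t2, t3⟩ := near_im h.big s hn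
  have him : |s.im| = s.im := abs_of_nonneg (by linarith)
  have key := Zt_norm h.toHyp s (by rw [him]; linarith) hs
  obtain ⟨p1, p2⟩ := h.logp
  have hlogt : Real.log (|s.im|/2 + 4) ≤ 520 * Real.log (bigL D) := by
    rw [him]
    have : s.im / 2 + 4 ≤ bigL D ^ 520 := by
      have e : t0 D = bigL D ^ 519 := rfl
      have : 10^40 * bigL D ^ 519 ≤ bigL D ^ 520 := h.big.step 519
      rw [← e] at this; linarith
    have h2 := Real.log_le_log (by linarith) this
    rwa [Real.log_pow] at h2
  have hK := KK_nonneg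
  have hlpi : Real.log Real.pi ≤ 3 := by
    have := Real.log_le_sub_one_of_pos Real.pi_pos; linarith [Real.pi_lt_d2]
  have hbig := h.big.h2
  have hL1 := h.big.h1
  have hlogL : 0 ≤ Real.log (bigL D) := Real.log_nonneg h.big.one
  set u := s.re - 1/2
  set d := Real.log p - bigL D ^ 9
  have hd : |u * (2*d)| ≤ |u| * 2 := by
    rw [abs_mul]; refine mul_le_mul_of_nonneg_left ?_ (abs_nonneg _)
    rw [abs_of_nonneg (by simp only [d]; linarith)]; simp only [d]; linarith
  have e : Real.log ‖Ztilde D χ ψ s‖ + u * (2 * bigL D ^ 9 + bigL D) = 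
     (Real.log ‖Ztilde D χ ψ s‖ + u * (Real.log D + 2 * Real.log p)) - u * (2 * d) := by
    simp only [d, bigL]; ring
  rw [e]
  refine (abs_sub _ _).trans ?_
  have h3 : |u| * (2 * Real.log (|s.im|/2 + 4) + 40 * KK + 2 * Real.log Real.pi) ≤ |u| * (bigL D - 2) :=
    mul_le_mul_of_nonneg_left (by linarith) (abs_nonneg _)
  linarith

lemma Ctx.Zt_pos (h : Ctx D χ ψ) (s : ℂ) (hn : Near D s) : Ztilde D χ ψ s ≠ 0 := by
  obtain ⟨t1, t2, t3⟩ := near_im h.big s hn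
  exact Zt_ne h.toHyp s (by linarith)

lemma Ctx.Zt_up (h : Ctx D χ ψ) (s : ℂ) (hs : |s.re - 1/2| ≤ 6) (hn : Near D s) :
    ‖Ztilde D χ ψ s‖ ≤ Real.exp (-(s.re - 1/2) * (2 * bigL D ^ 9 + bigL D) + |s.re - 1/2| * bigL D) := by
  rw [← Real.log_le_iff_le_exp (norm_pos_iff.mpr (h.Zt_pos s hn))]
  have := (abs_le.mp (h.Zt_log s hs hn)).2
  linarith

lemma Ctx.Zt_low (h : Ctx D χ ψ) (s : ℂ) (hs : |s.re - 1/2| ≤ 6) (hn : Near D s) :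
    ‖(Ztilde D χ ψ s)⁻¹‖ ≤ Real.exp ((s.re - 1/2) * (2 * bigL D ^ 9 + bigL D) + |s.re - 1/2| * bigL D) := by
  rw [← Real.log_le_iff_le_exp (norm_pos_iff.mpr (inv_ne_zero (h.Zt_pos s hn))), norm_inv, Real.log_inv]
  have := (abs_le.mp (h.Zt_log s hs hn)).1
  linarith

lemma crude (ψ : DirichletCharacter ℂ p) (S : Finset ℕ) (X : ℝ) (hX : 1 ≤ X) (hS : ∀ n ∈ S, 1 ≤ n ∧ (n:ℝ) ≤ X) (z : ℂ) (hz : -6 ≤ z.re) :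
    ‖∑ n ∈ S, nuF D χ n * ψ (n : ZMod p) * (n : ℂ) ^ (-z)‖ ≤ X ^ 8 := by
  have hcard : (S.card : ℝ) ≤ X := by
    have : S ⊆ Finset.Icc 1 ⌊X⌋₊ := by
      intro n hn
      rw [Finset.mem_Icc]; exact ⟨(hS n hn).1, Nat.le_floor (hS n hn).2⟩
    have h2 := Finset.card_le_card this
    rw [Nat.card_Icc] at h2
    have h3 : (S.card : ℝ) ≤ ⌊X⌋₊ := by exact_mod_cast (by omega : S.card ≤ ⌊X⌋₊)
    exact h3.trans (Nat.floor_le (by linarith))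
  refine (norm_sum_le_of_le S (f := _) (n := fun _ => X^7) ?_).trans ?_
  · intro n hn
    obtain ⟨h1, h2⟩ := hS n hn
    have h1' : (1:ℝ) ≤ n := by exact_mod_cast h1
    rw [norm_mul, Complex.norm_natCast_cpow_of_pos (by omega)]
    calc _ ≤ (n:ℝ) * (n:ℝ)^(6:ℝ) := by
          refine mul_le_mul (cf_bound χ ψ n) ?_ (by positivity) (by positivity)
          exact Real.rpow_le_rpow_of_exponent_le h1' (by simp; linarith)
      _ = (n:ℝ)^7 := by
          rw [show (6:ℝ) = ((6:ℕ):ℝ) by norm_num, Real.rpow_natCast]; ring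
      _ ≤ X^7 := pow_le_pow_left₀ (by positivity) h2 7
  · rw [Finset.sum_const, nsmul_eq_mul]
    calc _ ≤ X * X^7 := mul_le_mul_of_nonneg_right hcard (by positivity)
      _ = _ := by ring

lemma F_crude (hD : 1 < D) (ψ : DirichletCharacter ℂ p) (z : ℂ) (hz : -6 ≤ z.re) : ‖Ffun D χ ψ z‖ ≤ Real.exp (32 * bigL D) := by
  have hD1 : (1:ℝ) ≤ D := by exact_mod_cast hD.le
  have := crude (χ := χ) ψ (Finset.Icc 1 (D^4)) ((D:ℝ)^4) (one_le_pow₀ hD1) (fun n hn => by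
    rw [Finset.mem_Icc] at hn
    exact ⟨hn.1, by exact_mod_cast hn.2⟩) z hz
  refine this.trans (le_of_eq ?_)
  rw [D_exp hD, ← pow_mul, ← Real.exp_nat_mul]
  norm_num

lemma T_crude (hb : 0 ≤ bigL D) (ψ : DirichletCharacter ℂ p) (z : ℂ) (hz : -6 ≤ z.re) : ‖Tfun D χ ψ z‖ ≤ Real.exp (16 * bigL D ^ 9) := by
  have hP1 : (1:ℝ) ≤ bigP D := Real.one_le_exp (by positivity)
  have := crude (χ := χ) ψ (Finset.Ioc (D^4) ⌊bigP D ^ 2⌋₊) (bigP D ^ 2) (one_le_pow₀ hP1) (fun n hn => by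
    rw [Finset.mem_Ioc] at hn
    refine ⟨by omega, ?_⟩
    exact (Nat.cast_le.mpr hn.2).trans (Nat.floor_le (by positivity))) z hz
  refine this.trans (le_of_eq ?_)
  rw [bigP, ← pow_mul, ← Real.exp_nat_mul]
  norm_num

lemma exp_big (h : Big (bigL D)) : bigL D ^ 600 ≤ Real.exp (bigL D) := by
  have hp := h.pos
  rw [← Real.log_le_iff_le_exp (by positivity), Real.log_pow]
  have := h.log
  have := Real.log_nonneg h.one
  push_cast; linarith

lemma LL_crude1 (h : Hyp D χ ψ) (hb : Big (bigL D)) (hP2 : (p:ℝ) < 2 * bigP D) (z : ℂ) (hz : 1/2 ≤ z.re) (hz2 : z.re ≤ 7) (hn : |z.im| ≤ 10 * t0 D) : 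
    ‖LL D χ ψ z‖ ≤ Real.exp (3 * bigL D ^ 9) := by
  refine (LL_bound h z hz).trans ?_
  have hL := hb.h1
  have h1 : ‖z‖ ≤ Real.exp (bigL D) := by
    refine le_trans ?_ (exp_big hb)
    have h1 := Complex.norm_le_abs_re_add_abs_im z
    rw [abs_of_nonneg (by linarith : 0 ≤ z.re)] at h1
    have e : t0 D = bigL D ^ 519 := rfl
    have h2 := (hb.step 519).trans (pow_le_pow_right₀ hb.one (by norm_num : 519+1 ≤ 600))
    have h3 : 1 ≤ bigL D ^ 519 := one_le_pow₀ hb.one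
    rw [e] at hn; linarith
  have h2 : (4:ℝ) ≤ Real.exp (bigL D) := by
    have := Real.add_one_le_exp (bigL D); linarith
  have hDe := D_exp h.hD
  calc 4 * (D:ℝ) * (p:ℝ)^2 * ‖z‖^2 ≤ Real.exp (bigL D) * Real.exp (bigL D) * (Real.exp (bigL D) * bigP D)^2 * Real.exp (bigL D) ^ 2 := by
        rw [← hDe] at h1 h2 ⊢
        have : (p:ℝ) ≤ D * bigP D := hP2.le.trans (mul_le_mul_of_nonneg_right (by linarith) (Real.exp_pos _).le)
        gcongr
    _ = Real.exp (6 * bigL D + 2 * bigL D ^ 9) := by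
        rw [bigP, ← Real.exp_add, ← Real.exp_add, ← Real.exp_nat_mul, ← Real.exp_nat_mul, ← Real.exp_add, ← Real.exp_add]
        congr 1; push_cast; ring
    _ ≤ _ := by
        rw [Real.exp_le_exp]; have := hb.AL; linarith

lemma Ctx.LL_crude (h : Ctx D χ ψ) (z : ℂ) (hz : -11/2 ≤ z.re) (hz2 : z.re ≤ 13/2) (hn : Near D z) : 
    ‖LL D χ ψ z‖ ≤ Real.exp (16 * bigL D ^ 9) := by
  obtain ⟨t1, t2, t3⟩ := near_im h.big z hn
  have him : |z.im| ≤ 10 * t0 D := by rw [abs_of_nonneg (by linarith)]; exact t2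
  have hA := h.big.AL
  have hLp := h.big.pos
  by_cases hc : 1/2 ≤ z.re
  · refine (LL_crude1 h.toHyp h.big h.hP2 z hc (by linarith) him).trans ?_
    rw [Real.exp_le_exp]; linarith
  · rw [not_le] at hc
    rw [LL_FE h.toHyp z (by linarith), norm_mul]
    have h1 := h.Zt_up z (by rw [abs_le]; constructor <;> linarith) hn
    have h2 := LL_crude1 h.toHyp.inv h.big h.hP2 (1 - z) (by simp; linarith) (by simp; linarith) (by simpa using him)
    refine (mul_le_mul h1 h2 (norm_nonneg _) (Real.exp_pos _).le).trans ?_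
    rw [← Real.exp_add, Real.exp_le_exp]
    rw [abs_of_neg (by linarith)]
    nlinarith
end PartNo9

section PartNo10
open Complex
variable {D p : ℕ} {χ : DirichletCharacter ℂ D} {ψ : DirichletCharacter ℂ p}

def ker (A : ℝ) (w : ℂ) : ℂ := Complex.exp (A * w + w^2)

lemma ker_norm (A x y : ℝ) : ‖ker A (x + y * I)‖ = Real.exp (A * x + x^2 - y^2) := by
  rw [ker, Complex.norm_exp]; congr 1
  simp [pow_two]; ring

lemma ker_diff (A : ℝ) : Differentiable ℂ (ker A) := by
  unfold ker; fun_prop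

lemma dpoly_diff (S : Finset ℕ) (hS : ∀ n ∈ S, n ≠ 0) (c : ℕ → ℂ) : Differentiable ℂ (fun z : ℂ => ∑ n ∈ S, c n * (n:ℂ)^(-z)) := by
  refine Differentiable.fun_sum fun n hn => ?_
  refine (differentiable_const _).mul ?_
  exact (differentiable_neg_iff.mpr differentiable_id).const_cpow (Or.inl (by exact_mod_cast hS n hn))

lemma F_diff (ψ : DirichletCharacter ℂ p) : Differentiable ℂ (Ffun D χ ψ) :=
  dpoly_diff _ (fun n hn => by rw [Finset.mem_Icc] at hn; omega) (fun n => nuF D χ n * ψ (n : ZMod p))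

lemma T_diff (ψ : DirichletCharacter ℂ p) : Differentiable ℂ (Tfun D χ ψ) :=
  dpoly_diff _ (fun n hn => by rw [Finset.mem_Ioc] at hn; omega) (fun n => nuF D χ n * ψ (n : ZMod p))

/-- the error function -/
def gE (D : ℕ) (χ : DirichletCharacter ℂ D) {p : ℕ} (ψ : DirichletCharacter ℂ p) (z : ℂ) : ℂ :=
  LL D χ ψ z - Ffun D χ ψ z - Ztilde D χ ψ z * Ffun D χ ψ⁻¹ (1 - z)

def T2 (D : ℕ) (χ : DirichletCharacter ℂ D) {p : ℕ} (ψ : DirichletCharacter ℂ p) (z : ℂ) : ℂ :=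
  Ztilde D χ ψ z * Tfun D χ ψ⁻¹ (1 - z)

lemma exp3 {a b : ℝ} (h : a + 2 ≤ b) : 3 * Real.exp a ≤ Real.exp b := by
  calc 3 * Real.exp a ≤ Real.exp 2 * Real.exp a := by
        refine mul_le_mul_of_nonneg_right ?_ (Real.exp_pos _).le
        have := Real.add_one_le_exp (2:ℝ); linarith
    _ = Real.exp (2 + a) := (Real.exp_add _ _).symm
    _ ≤ _ := by rw [Real.exp_le_exp]; linarith

lemma Ctx.right (h : Ctx D χ ψ) (z : ℂ) (hz : z.re = 13/2) (hn : Near D z) :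
    ‖gE D χ ψ z - Tfun D χ ψ z‖ ≤ Real.exp (-7 * bigL D ^ 9 + 2) := by
  have h1 := tail_bound h.toHyp h.D4 z hz
  have h2 := h.Zt_up z (by rw [hz]; norm_num) hn
  have h3 := F_crude (χ := χ) h.hD ψ⁻¹ (1 - z) (by simp; rw [hz]; norm_num)
  have e : gE D χ ψ z - Tfun D χ ψ z = (LL D χ ψ z - Ffun D χ ψ z - Tfun D χ ψ z) - Ztilde D χ ψ z * Ffun D χ ψ⁻¹ (1 - z) := by
    rw [gE]; ring
  rw [e]
  refine (norm_sub_le _ _).trans ?_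
  rw [norm_mul]
  have hA := h.big.AL
  have hL := h.big.h1
  have e7 : (bigP D)⁻¹ ^ 7 = Real.exp (-7 * bigL D ^ 9) := by
    rw [bigP, ← Real.exp_neg, ← Real.exp_nat_mul]; congr 1; push_cast; ring
  rw [e7] at h1
  have h4 : ‖Ztilde D χ ψ z‖ * ‖Ffun D χ ψ⁻¹ (1 - z)‖ ≤ Real.exp (-7 * bigL D ^ 9) := by
    refine (mul_le_mul h2 h3 (norm_nonneg _) (Real.exp_pos _).le).trans ?_
    rw [← Real.exp_add, Real.exp_le_exp, hz]
    rw [abs_of_nonneg (by norm_num)]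
    nlinarith
  have h5 := exp3 (le_refl (-7 * bigL D ^ 9 + 2))
  linarith

lemma Ctx.left (h : Ctx D χ ψ) (z : ℂ) (hz : z.re = -11/2) (hn : Near D z) :
    ‖gE D χ ψ z - T2 D χ ψ z‖ ≤ Real.exp (5 * bigL D ^ 9 + 12 * bigL D + 2) := by
  obtain ⟨t1, t2, t3⟩ := near_im h.big z hn
  have h1 := tail_bound h.toHyp.inv h.D4 (1 - z) (by simp; rw [hz]; norm_num)
  have h2 := h.Zt_up z (by rw [hz]; norm_num [abs_of_neg]) hn
  have h3 := F_crude (χ := χ) h.hD ψ z (by rw [hz]; norm_num)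
  have e : gE D χ ψ z - T2 D χ ψ z = Ztilde D χ ψ z * (LL D χ ψ⁻¹ (1 - z) - Ffun D χ ψ⁻¹ (1 - z) - Tfun D χ ψ⁻¹ (1 - z)) - Ffun D χ ψ z := by
    rw [gE, T2, LL_FE h.toHyp z (by linarith)]; ring
  rw [e]
  refine (norm_sub_le _ _).trans ?_
  rw [norm_mul]
  have hA := h.big.AL
  have hL := h.big.h1
  have e7 : (bigP D)⁻¹ ^ 7 = Real.exp (-7 * bigL D ^ 9) := by
    rw [bigP, ← Real.exp_neg, ← Real.exp_nat_mul]; congr 1; push_cast; ring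
  rw [e7] at h1
  have h4 : ‖Ztilde D χ ψ z‖ * ‖LL D χ ψ⁻¹ (1 - z) - Ffun D χ ψ⁻¹ (1 - z) - Tfun D χ ψ⁻¹ (1 - z)‖ ≤ 2 * Real.exp (5 * bigL D ^ 9 + 12 * bigL D) := by
    refine (mul_le_mul h2 h1 (norm_nonneg _) (Real.exp_pos _).le).trans ?_
    rw [mul_left_comm, ← Real.exp_add]
    refine mul_le_mul_of_nonneg_left ?_ (by norm_num)
    rw [Real.exp_le_exp, hz]
    rw [abs_of_neg (by norm_num)]
    nlinarith
  have h5 := exp3 (le_refl (5 * bigL D ^ 9 + 12 * bigL D + 2))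
  have h6 : Real.exp (32 * bigL D) ≤ Real.exp (5 * bigL D ^ 9 + 12 * bigL D) := by
    rw [Real.exp_le_exp]; linarith
  linarith

lemma Ctx.horiz (h : Ctx D χ ψ) (z : ℂ) (hz : -11/2 ≤ z.re) (hz2 : z.re ≤ 13/2) (hn : Near D z) :
    ‖gE D χ ψ z‖ ≤ Real.exp (30 * bigL D ^ 9) ∧ ‖Tfun D χ ψ z‖ ≤ Real.exp (30 * bigL D ^ 9) ∧ ‖T2 D χ ψ z‖ ≤ Real.exp (30 * bigL D ^ 9) := by
  have hA := h.big.AL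
  have hL := h.big.h1
  have h1 := h.LL_crude z hz hz2 hn
  have h2 : ‖Ztilde D χ ψ z‖ ≤ Real.exp (13 * bigL D ^ 9) := by
    refine (h.Zt_up z (by rw [abs_le]; constructor <;> linarith) hn).trans ?_
    rw [Real.exp_le_exp]
    have : |z.re - 1/2| ≤ 6 := by rw [abs_le]; constructor <;> linarith
    nlinarith
  have h3 := F_crude (χ := χ) h.hD ψ z (by linarith)
  have h4 := F_crude (χ := χ) h.hD ψ⁻¹ (1-z) (by simp; linarith)
  have h5 := T_crude (χ := χ) h.big.pos.le ψ z (by linarith)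
  have h6 := T_crude (χ := χ) h.big.pos.le ψ⁻¹ (1-z) (by simp; linarith)
  refine ⟨?_, ?_, ?_⟩
  · have h7 : ‖Ztilde D χ ψ z * Ffun D χ ψ⁻¹ (1 - z)‖ ≤ Real.exp (16 * bigL D ^ 9) := by
      rw [norm_mul]
      refine (mul_le_mul h2 h4 (norm_nonneg _) (Real.exp_pos _).le).trans ?_
      rw [← Real.exp_add, Real.exp_le_exp]; linarith
    have h8 : Real.exp (32 * bigL D) ≤ Real.exp (16 * bigL D ^ 9) := by
      rw [Real.exp_le_exp]; linarith
    have h9 := exp3 (show 16 * bigL D ^ 9 + 2 ≤ 30 * bigL D ^ 9 by linarith)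
    have h10 := norm_sub_le (LL D χ ψ z - Ffun D χ ψ z) (Ztilde D χ ψ z * Ffun D χ ψ⁻¹ (1 - z))
    have h11 := norm_sub_le (LL D χ ψ z) (Ffun D χ ψ z)
    rw [gE]; linarith
  · refine h5.trans ?_
    rw [Real.exp_le_exp]; linarith
  · rw [T2, norm_mul]
    refine (mul_le_mul h2 h6 (norm_nonneg _) (Real.exp_pos _).le).trans ?_
    rw [← Real.exp_add, Real.exp_le_exp]; linarith

lemma conj_sub_re (z : ℂ) : ((starRingEnd ℂ) (1 - z)).re = 1 - z.re := by simp
lemma conj_sub_near (z : ℂ) (h : Near D z) : Near D ((starRingEnd ℂ) (1 - z)) := by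
  simpa [Near] using h

lemma Ctx.T2_mid (h : Ctx D χ ψ) (z : ℂ) (hz : 1/2 - 2 * (bigL D ^ 9)⁻¹ ≤ z.re) (hz2 : z.re ≤ 1) (hn : Near D z) :
    ‖T2 D χ ψ z‖ ≤ Real.exp 5 * (3 * bigL D ^ (-180:ℤ)) := by
  have hA := h.big.AL
  have hL := h.big.h1
  have hA0 : 0 < bigL D ^ 9 := by linarith
  have hAi : (bigL D ^ 9)⁻¹ ≤ 1 := inv_le_one_of_one_le₀ (by linarith)
  have hAi0 : 0 < (bigL D ^ 9)⁻¹ := by positivity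
  have hAA : bigL D ^ 9 * (bigL D ^ 9)⁻¹ = 1 := mul_inv_cancel₀ hA0.ne'
  have h1 := h.Zt_up z (by rw [abs_le]; constructor <;> linarith) hn
  rw [T2, Tfun_conj h.hreal, norm_mul, RCLike.norm_conj]
  have h2 := h.T ((starRingEnd ℂ) (1 - z)) (max 0 (z.re - 1/2)) (le_max_left _ _) (by
      rw [conj_sub_re]; have := le_max_right 0 (z.re - 1/2); linarith)
      (near_norm h.big _ (conj_sub_near z hn) (by rw [conj_sub_re, abs_le]; constructor <;> linarith))
  refine (mul_le_mul h1 h2 (norm_nonneg _) (Real.exp_pos _).le).trans ?_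
  rw [← mul_assoc, ← Real.exp_add]
  refine mul_le_mul_of_nonneg_right ?_ (by have := h.big.pos; positivity)
  rw [Real.exp_le_exp]
  have hLA : bigL D * (bigL D ^ 9)⁻¹ ≤ 1/10 := by
    calc _ ≤ (1/10 * bigL D ^ 9) * (bigL D ^ 9)⁻¹ := mul_le_mul_of_nonneg_right (by linarith) hAi0.le
      _ = _ := by rw [mul_assoc, hAA, mul_one]
  rcases le_total 0 (z.re - 1/2) with hc | hc
  · rw [max_eq_right hc, abs_of_nonneg hc]; nlinarith
  · rw [max_eq_left hc, abs_of_nonpos hc]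
    have h5 : -(z.re - 1/2) ≤ 2 * (bigL D ^ 9)⁻¹ := by linarith
    have h6 : -(z.re - 1/2) * (2 * bigL D ^ 9 + 2 * bigL D) ≤ 2 * (bigL D ^ 9)⁻¹ * (2 * bigL D ^ 9 + 2 * bigL D) :=
      mul_le_mul_of_nonneg_right h5 (by linarith)
    have h7 : 2 * (bigL D ^ 9)⁻¹ * (2 * bigL D ^ 9 + 2 * bigL D) = 4 * (bigL D ^ 9 * (bigL D ^ 9)⁻¹) + 4 * (bigL D * (bigL D ^ 9)⁻¹) := by ring
    rw [h7, hAA] at h6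
    linarith

lemma Ctx.AFE (h : Ctx D χ ψ) (s : ℂ) (hs : 1/2 - (bigL D ^ 9)⁻¹ ≤ s.re) (hs2 : s.re ≤ 1) (hn : |s.im - 2 * Real.pi * t0 D| ≤ bigL D ^ 405 + 2) :
    ‖gE D χ ψ s‖ ≤ bigL D ^ (-179:ℤ) := by
  have hA := h.big.AL
  have hL := h.big.h1
  have hL1 := h.big.one
  have hL0 := h.big.pos
  set A := bigL D ^ 9 with hAdef
  set H := bigL D ^ 10 with hHdef
  have hA0 : 0 < A := by linarith
  have hη0 : 0 < A⁻¹ := by positivity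
  have hη1 : A⁻¹ ≤ 1/100 := by rw [inv_le_comm₀ hA0 (by norm_num)]; linarith
  have hAA : A * A⁻¹ = 1 := mul_inv_cancel₀ hA0.ne'
  have hH1 : 1 ≤ H := one_le_pow₀ hL1
  have hH2 : 100 * A ≤ H^2 := by
    have h1 : 10^40 * A ≤ H := h.big.step 9
    nlinarith
  have near : ∀ x y : ℝ, |y| ≤ H → Near D (s + (x + y * I)) := by
    intro x y hy
    have : (s + (x + y * I)).im - 2 * Real.pi * t0 D = (s.im - 2 * Real.pi * t0 D) + y := by simp; ring
    rw [Near, this]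
    exact (abs_add_le _ _).trans (by linarith)
  have yH : ∀ y ∈ Set.Icc (-H) H, |y| ≤ H := fun y hy => abs_le.mpr hy
  have re : ∀ x y : ℝ, (s + (x + y * I)).re = s.re + x := by intro x y; simp
  set a := -11/2 - s.re with ha
  set b := 13/2 - s.re with hb
  have dshift : ∀ f : ℂ → ℂ, (∀ z, z.im ≠ 0 → DifferentiableAt ℂ f z) → 
      DifferentiableOn ℂ (fun w => f (s + w) * ker A w) (Set.Icc a b ×ℂ Set.Icc (-H) H) := by
    intro f hf w hw
    rw [Complex.mem_reProdIm] at hw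
    have hnw := near w.re w.im (yH _ hw.2)
    rw [Complex.re_add_im] at hnw
    obtain ⟨t1, t2, t3⟩ := near_im h.big _ hnw
    refine DifferentiableAt.differentiableWithinAt ?_
    refine DifferentiableAt.mul ?_ (ker_diff A w)
    exact (hf (s + w) (by linarith)).comp w ((differentiableAt_const s).add differentiableAt_id)
  have dF' : ∀ f : ℂ → ℂ, Differentiable ℂ f → Differentiable ℂ (fun z => f (1 - z)) := fun f hf => hf.comp ((differentiable_const _).sub differentiable_id)
  have key := AFE_abs (fun w => gE D χ ψ (s + w) * ker A w) (fun w => Tfun D χ ψ (s + w) * ker A w) (fun w => T2 D χ ψ (s + w) * ker A w)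
    a b H A⁻¹ (Real.exp 7 * (3 * bigL D ^ (-180:ℤ))) (Real.exp (-A/2)) (by linarith) (by linarith) hH1 hη0 (by linarith)
    (dshift _ fun z hz => (((LL_diff h.toHyp) z).sub ((F_diff ψ) z)).sub ((Zt_diff h.toHyp z hz).mul (dF' _ (F_diff ψ⁻¹) z)))
    (dshift _ fun z hz => T_diff ψ z)
    (dshift _ fun z hz => ((Zt_diff h.toHyp z hz).mul (dF' _ (T_diff ψ⁻¹) z)))
    (by
      intro y hy
      rw [← sub_mul, norm_mul, ker_norm]
      refine (mul_le_mul_of_nonneg_right (h.right _ (by rw [re]; simp [hb]) (near b y (yH y hy))) (Real.exp_pos _).le).trans ?_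
      rw [← Real.exp_add, Real.exp_le_exp]
      have h1 : A * b ≤ 6 * A + 1 := by
        have : b ≤ 6 + A⁻¹ := by linarith
        nlinarith
      have h2 : b^2 ≤ 49 := by nlinarith
      have h3 := sq_nonneg y
      linarith)
    (by
      intro y hy
      rw [← sub_mul, norm_mul, ker_norm]
      refine (mul_le_mul_of_nonneg_right (h.left _ (by rw [re]; simp [ha]) (near a y (yH y hy))) (Real.exp_pos _).le).trans ?_
      rw [← Real.exp_add, Real.exp_le_exp]
      have h1 : A * a ≤ -6 * A + 1 := by
        have : a ≤ -6 + A⁻¹ := by linarith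
        nlinarith
      have h2 : a^2 ≤ 49 := by nlinarith
      have h3 := sq_nonneg y
      linarith)
    (by
      intro x hx y hy
      obtain ⟨g1, g2, g3⟩ := h.horiz (s + (x + y * I)) (by rw [re]; linarith [hx.1]) (by rw [re]; linarith [hx.2]) (near x y hy.le)
      have hk : Real.exp (30 * A) * ‖ker A (x + y * I)‖ ≤ Real.exp (-A/2) := by
        rw [ker_norm, ← Real.exp_add, Real.exp_le_exp]
        have h1 : y^2 = H^2 := by rw [← sq_abs, hy]
        have hx1 : x ≤ 7 := by linarith [hx.2]
        have hx2 : -7 ≤ x := by linarith [hx.1]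
        have h2 : x^2 ≤ 49 := by nlinarith
        have h3 : A * x ≤ 7 * A := by nlinarith
        rw [h1]; linarith
      refine ⟨?_, ?_, ?_⟩ <;> rw [norm_mul]
      · exact (mul_le_mul_of_nonneg_right g1 (norm_nonneg _)).trans hk
      · exact (mul_le_mul_of_nonneg_right g2 (norm_nonneg _)).trans hk
      · exact (mul_le_mul_of_nonneg_right g3 (norm_nonneg _)).trans hk)
    (by
      intro y hy
      rw [norm_mul, ker_norm]
      have h1 := h.T (s + ((A⁻¹ : ℝ) + y * I)) 0 le_rfl (by rw [re]; linarith) (near_norm h.big _ (near _ y (yH y hy)) (by rw [re, abs_le]; constructor <;> linarith))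
      simp only [mul_zero, Real.exp_zero, one_mul] at h1
      refine (mul_le_mul_of_nonneg_right h1 (Real.exp_pos _).le).trans ?_
      rw [mul_comm]
      refine mul_le_mul_of_nonneg_right ?_ (by positivity)
      rw [Real.exp_le_exp, hAA]
      have h3 := sq_nonneg y
      nlinarith)
    (by
      intro y hy
      rw [norm_mul, ker_norm]
      have h1 := h.T2_mid (s + (((-A⁻¹ : ℝ):ℂ) + y * I)) (by rw [re]; linarith) (by rw [re]; linarith) (near _ y (yH y hy))
      refine (mul_le_mul_of_nonneg_right h1 (Real.exp_pos _).le).trans ?_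
      rw [mul_right_comm, ← Real.exp_add]
      refine mul_le_mul_of_nonneg_right ?_ (by positivity)
      rw [Real.exp_le_exp]
      have h3 := sq_nonneg y
      nlinarith)
  simp only [add_zero] at key
  have hk0 : ker A 0 = 1 := by simp [ker]
  rw [hk0, mul_one] at key
  have hlog : Real.log ((A⁻¹ + H)/A⁻¹) ≤ 20 * Real.log (bigL D) := by
    have e : (A⁻¹ + H)/A⁻¹ = 1 + H * A := by field_simp
    rw [e]
    have : 1 + H * A ≤ bigL D ^ 20 := by
      have h1 : H * A = bigL D ^ 19 := by rw [hHdef, hAdef]; ring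
      have h2 : 10^40 * bigL D ^ 19 ≤ bigL D ^ 20 := h.big.step 19
      have h3 : 1 ≤ bigL D ^ 19 := one_le_pow₀ hL1
      rw [h1]; linarith
    have h2 := Real.log_le_log (by positivity) this
    rwa [Real.log_pow] at h2
  have hsmall : (4 * H + 6 * (b - a)) * Real.exp (-A/2) ≤ bigL D ^ (-179:ℤ) := by
    have h1 : Real.exp (-A/2) ≤ Real.exp (-(bigL D)) := by rw [Real.exp_le_exp]; linarith
    have h2 : Real.exp (-(bigL D)) ≤ (bigL D ^ 600)⁻¹ := by
      rw [Real.exp_neg]; exact inv_anti₀ (by positivity) (exp_big h.big)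
    have h3 : 4 * H + 6 * (b - a) ≤ bigL D ^ 11 := by
      have : 10^40 * bigL D ^ 10 ≤ bigL D ^ 11 := h.big.step 10
      linarith
    calc _ ≤ bigL D ^ 11 * (bigL D ^ 600)⁻¹ := mul_le_mul h3 (h1.trans h2) (Real.exp_pos _).le (by positivity)
      _ = bigL D ^ (-589 : ℤ) := by
        rw [← zpow_natCast, ← zpow_natCast, ← zpow_neg, ← zpow_add₀ hL0.ne']; norm_num
      _ ≤ _ := zpow_le_zpow_right₀ hL1 (by norm_num)
  have hmain : 8 * (Real.exp 7 * (3 * bigL D ^ (-180:ℤ))) * Real.log ((A⁻¹ + H)/A⁻¹) ≤ 2 * bigL D ^ (-179:ℤ) := by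
    have e7 : Real.exp 7 ≤ 3^7 := exp_nat_le 7
    have hz : 0 ≤ bigL D ^ (-180:ℤ) := by positivity
    have e : bigL D ^ (-179:ℤ) = bigL D ^ (-180:ℤ) * bigL D := by
      rw [← zpow_add_one₀ hL0.ne']; norm_num
    have hlg := h.big.log
    have hlg0 := Real.log_nonneg hL1
    calc _ ≤ 8 * (3^7 * (3 * bigL D ^ (-180:ℤ))) * (20 * Real.log (bigL D)) := by
          refine mul_le_mul ?_ hlog ?_ (by positivity)
          · refine mul_le_mul_of_nonneg_left ?_ (by norm_num)
            exact mul_le_mul_of_nonneg_right e7 (by positivity)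
          · refine Real.log_nonneg ?_
            rw [le_div_iff₀ hη0]; linarith
      _ = bigL D ^ (-180:ℤ) * (1049760 * Real.log (bigL D)) := by ring
      _ ≤ bigL D ^ (-180:ℤ) * (2 * bigL D) := mul_le_mul_of_nonneg_left (by linarith) hz
      _ = _ := by rw [e]; ring
  have hpi := Real.pi_gt_three
  have hg := norm_nonneg (gE D χ ψ s)
  nlinarith
end PartNo10

section PartNo11
open Complex
variable {D p : ℕ} {χ : DirichletCharacter ℂ D} {ψ : DirichletCharacter ℂ p}

lemma bc_ratio (F : ℂ → ℂ) (hF : Differentiable ℂ F) (c : ℂ) (R M : ℝ) (hR : 0 < R) (hM : 0 < M)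
    (hne : ∀ z ∈ Metric.ball c R, F z ≠ 0) (hb : ∀ z ∈ Metric.ball c R, ‖F z‖ ≤ Real.exp M * ‖F c‖)
    (w : ℂ) (hw : ‖w‖ ≤ R / 2) :
    ‖F (c + w)‖ ≤ Real.exp (4 * M * ‖w‖ / R) * ‖F c‖ ∧ ‖F c‖ ≤ Real.exp (4 * M * ‖w‖ / R) * ‖F (c + w)‖ := by
  have hm : ∀ z ∈ Metric.ball (0:ℂ) R, c + z ∈ Metric.ball c R := by
    intro z hz; simpa using hz
  set f : ℂ → ℂ := fun z => F (c + z) with hf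
  have hfd : Differentiable ℂ f := hF.comp (by fun_prop)
  have hfne : ∀ z ∈ Metric.ball (0:ℂ) R, f z ≠ 0 := fun z hz => hne _ (hm z hz)
  have hq : DifferentiableOn ℂ (fun z => deriv f z / f z) (Metric.ball 0 R) := by
    refine DifferentiableOn.div ?_ hfd.differentiableOn hfne
    exact (hfd.differentiableOn.deriv Metric.isOpen_ball)
  obtain ⟨g, hg0, hg⟩ := (hq.isExactOn_ball).with_val_at 0 0
  have h0 : (0:ℂ) ∈ Metric.ball (0:ℂ) R := by simpa using hR
  have key : ∀ z ∈ Metric.ball (0:ℂ) R, f z * Complex.exp (- g z) = f 0 := by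
    have hd : ∀ z ∈ Metric.ball (0:ℂ) R, HasDerivAt (fun z => f z * Complex.exp (- g z)) 0 z := by
      intro z hz
      have h1 := (hfd z).hasDerivAt.mul ((hg z hz).neg.cexp)
      refine h1.congr_deriv ?_
      have h3 : f z * (deriv f z / f z) = deriv f z := mul_div_cancel₀ _ (hfne z hz)
      linear_combination -Complex.exp (- g z) * h3
    intro z hz
    have := (convex_ball (0:ℂ) R).is_const_of_fderivWithin_eq_zero (𝕜 := ℂ) (f := fun z => f z * Complex.exp (- g z))
      (fun x hx => (hd x hx).differentiableAt.differentiableWithinAt) (fun x hx => by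
        rw [fderivWithin_of_isOpen Metric.isOpen_ball hx]
        ext
        simpa using (hd x hx).deriv) hz h0
    simpa [hg0] using this
  have key2 : ∀ z ∈ Metric.ball (0:ℂ) R, f z = f 0 * Complex.exp (g z) := by
    intro z hz
    rw [← key z hz, mul_assoc, ← Complex.exp_add]; simp
  have fc : f 0 = F c := by simp [hf]
  have fcpos : 0 < ‖F c‖ := norm_pos_iff.mpr (by rw [← fc]; exact hfne 0 h0)
  have hre : Set.MapsTo g (Metric.ball 0 R) {z | z.re ≤ M} := by
    intro z hz
    have h1 := hb _ (hm z hz)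
    have h2 := key2 z hz
    change F (c + z) = _ at h2
    rw [h2, norm_mul, Complex.norm_exp, fc, mul_comm] at h1
    exact Real.exp_le_exp.mp (le_of_mul_le_mul_right h1 fcpos)
  have hwb : w ∈ Metric.ball (0:ℂ) R := by
    rw [mem_ball_zero_iff]; linarith
  have hB := Complex.borelCaratheodory_zero hM (fun z hz => (hg z hz).differentiableAt.differentiableWithinAt) hre hR hwb hg0
  have hB2 : ‖g w‖ ≤ 4 * M * ‖w‖ / R := by
    refine hB.trans ?_
    rw [div_le_div_iff₀ (by linarith) hR]
    have : 0 ≤ M * ‖w‖ := by positivity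
    nlinarith
  have hr := (abs_le.mp ((Complex.abs_re_le_norm (g w)).trans hB2))
  have h2 := key2 w hwb
  change F (c + w) = _ at h2
  rw [h2, norm_mul, Complex.norm_exp, fc]
  constructor
  · rw [mul_comm]; gcongr; exact hr.2
  · rw [← mul_assoc, mul_comm, ← mul_assoc, ← Real.exp_add]
    refine le_mul_of_one_le_left fcpos.le (Real.one_le_exp (by linarith [hr.1]))

lemma zp (L : ℝ) (k : ℕ) : L ^ (-(k:ℤ)) = (L^k)⁻¹ := by rw [zpow_neg, zpow_natCast]

lemma Ctx.Fbd (h : Ctx D χ ψ) (z : ℂ) (hz : 1/2 - (bigL D)⁻¹ ≤ z.re) (hz2 : |z.re - 1/2| ≤ 20) (hn : Near D z) :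
    ‖Ffun D χ ψ z‖ ≤ bigL D ^ 80 ∧ ‖Gfun D χ ψ z‖ ≤ bigL D ^ 80 ∧ (bigL D ^ 81)⁻¹ ≤ ‖Ffun D χ ψ z‖ := by
  have hL := h.big.pos
  have hnn := near_norm h.big z hn hz2
  obtain ⟨h1, h2⟩ := h.FG z (bigL D)⁻¹ (by positivity) hz hnn
  have h3 := h.FG1 z hz hnn
  have e4 : Real.exp (4 * bigL D * (bigL D)⁻¹) * bigL D ^ 79 ≤ bigL D ^ 80 := by
    have : 4 * bigL D * (bigL D)⁻¹ = ((4:ℕ):ℝ) := by field_simp; norm_num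
    rw [this]
    have h5 := exp_nat_le 4
    have h6 := h.big.step 79
    have h7 : (0:ℝ) < bigL D ^ 79 := by positivity
    have h8 : Real.exp ((4:ℕ):ℝ) * bigL D ^ 79 ≤ 3 ^ 4 * bigL D ^ 79 := by gcongr
    norm_num only at h6 h8 ⊢
    linarith
  refine ⟨h1.trans e4, h2.trans e4, ?_⟩
  have h4 : bigL D ^ (-227:ℤ) ≤ 1/2 := by
    have := zp (bigL D) 227
    rw [show (-227:ℤ) = -((227:ℕ):ℤ) by norm_num, this]
    rw [inv_le_comm₀ (by positivity) (by norm_num)]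
    have h6 := h.big.step 226
    have : (1:ℝ) ≤ bigL D ^ 226 := one_le_pow₀ h.big.one
    norm_num at *
    linarith
  have h5 : 1/2 ≤ ‖Ffun D χ ψ z * Gfun D χ ψ z‖ := by
    have := norm_sub_norm_le (1:ℂ) (1 - Ffun D χ ψ z * Gfun D χ ψ z)
    rw [norm_sub_rev 1 (Ffun D χ ψ z * Gfun D χ ψ z)] at this
    simp only [norm_one, sub_sub_cancel] at this
    linarith
  rw [norm_mul] at h5
  have h7 : 1/2 ≤ ‖Ffun D χ ψ z‖ * bigL D ^ 80 := h5.trans (by gcongr; exact h2.trans e4)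
  rw [inv_le_iff_one_le_mul₀ (by positivity), pow_succ]
  have := h.big.h1
  have : (0:ℝ) ≤ ‖Ffun D χ ψ z‖ * bigL D ^ 80 := by positivity
  nlinarith

lemma Ctx.Fbar (h : Ctx D χ ψ) (z : ℂ) : ‖Ffun D χ ψ⁻¹ (1 - z)‖ = ‖Ffun D χ ψ ((starRingEnd ℂ) (1 - z))‖ := by
  rw [Ffun_conj h.hreal]; simp

lemma near_of (hb : Big (bigL D)) (z : ℂ) (hn : |z.im - 2 * Real.pi * t0 D| ≤ bigL D ^ 405 + 2) : Near D z := by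
  have := hb.pos
  have : (0:ℝ) ≤ bigL D ^ 10 := by positivity
  rw [Near]; linarith

lemma Ctx.near_sq (h : Ctx D χ ψ) (c : ℂ) (hc : c.re = 1/2) (hcn : |c.im - 2 * Real.pi * t0 D| ≤ bigL D ^ 405 + 2) (u : ℝ)
    (hu : 0 ≤ u) (hu2 : u ≤ 200 * Real.log (bigL D) / bigL D ^ 9) :
    ‖Ffun D χ ψ (c - u)‖ ≤ 11/10 * ‖Ffun D χ ψ (c + u)‖ := by
  have hL := h.big.pos
  have h1L := h.big.h1
  have hlog := h.big.log
  have hlog1 : 1 ≤ Real.log (bigL D) := by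
    rw [Real.le_log_iff_exp_le hL]
    have := exp_nat_le 1
    norm_num at this
    linarith
  set L := bigL D with hLdef
  have hball : ∀ z ∈ Metric.ball c L⁻¹, 1/2 - L⁻¹ ≤ z.re ∧ |z.re - 1/2| ≤ 20 ∧ Near D z := by
    intro z hz
    rw [mem_ball_iff_norm] at hz
    have h1 := (Complex.abs_re_le_norm (z - c)).trans hz.le
    have h2 := (Complex.abs_im_le_norm (z - c)).trans hz.le
    simp only [Complex.sub_re, Complex.sub_im, hc] at h1 h2
    have hLi : L⁻¹ ≤ 1 := inv_le_one_of_one_le₀ h.big.one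
    refine ⟨by linarith [(abs_le.mp h1).1], by linarith, ?_⟩
    have h10 : (1:ℝ) ≤ L ^ 10 := one_le_pow₀ h.big.one
    rw [Near]
    have := abs_sub_le z.im c.im (2 * Real.pi * t0 D)
    linarith
  have hcb : c ∈ Metric.ball c L⁻¹ := Metric.mem_ball_self (by positivity)
  have hcF := (h.Fbd c (hball c hcb).1 (hball c hcb).2.1 (hball c hcb).2.2).2.2
  have hexp : Real.exp (161 * Real.log L) = L ^ 161 := by
    rw [show (161:ℝ) = ((161:ℕ):ℝ) by norm_num, Real.exp_nat_mul, Real.exp_log hL]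
  have hu3 : u * L ^ 9 ≤ 200 * Real.log L := by rwa [le_div_iff₀ (by positivity)] at hu2
  have hul : u * L ^ 2 * L ≤ 1 / 10^30 * 1 := by
    have : u * L^9 ≤ L := by linarith
    have h8 : u * L^8 ≤ 1 := by
      refine le_of_mul_le_mul_right ?_ hL
      linarith [show u * L^8 * L = u * L^9 by ring]
    have h40 : (10:ℝ)^30 ≤ L^5 := by
      calc (10:ℝ)^30 ≤ L := by linarith
        _ = L^1 := by ring
        _ ≤ L^5 := pow_le_pow_right₀ h.big.one (by norm_num)
    have : 10^30 * (u * L^3) ≤ L^5 * (u * L^3) := by gcongr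
    have e : L^5 * (u * L^3) = u * L^8 := by ring
    have e2 : u * L^2 * L = u * L^3 := by ring
    rw [e2]
    linarith
  have hkey : 4 * (161 * Real.log L) * u / L⁻¹ ≤ 1/100 := by
    rw [div_inv_eq_mul]
    have : Real.log L ≤ L := by linarith
    have : 4 * (161 * Real.log L) * u * L ≤ 4 * (161 * L) * u * L := by gcongr
    have e : 4 * (161 * L) * u * L = 644 * (u * L^2) := by ring
    have : u * L^2 * 1 ≤ u * L^2 * L := by gcongr; exact h.big.one
    linarith
  have hur : u ≤ L⁻¹ / 2 := by
    rw [le_div_iff₀ (by norm_num), ← one_div, le_div_iff₀ hL]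
    have : u * L * 1 ≤ u * L * L := by gcongr; exact h.big.one
    have : u * L * L * 1 ≤ u * L * L * L := by gcongr; exact h.big.one
    nlinarith
  have hB := fun w => bc_ratio (Ffun D χ ψ) (F_diff ψ) c L⁻¹ (161 * Real.log L) (by positivity) (by positivity)
    (fun z hz => by
      obtain ⟨a, b, d⟩ := hball z hz
      have := (h.Fbd z a b d).2.2
      exact norm_pos_iff.mp (lt_of_lt_of_le (by positivity) this))
    (fun z hz => by
      obtain ⟨a, b, d⟩ := hball z hz
      refine (h.Fbd z a b d).1.trans ?_
      rw [hexp]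
      calc L ^ 80 = L^161 * (L^81)⁻¹ := by field_simp
        _ ≤ _ := by gcongr) w
  have hnu : ‖(u:ℂ)‖ = u := by simp [abs_of_nonneg hu]
  have h1 := (hB u (by rw [hnu]; exact hur)).2
  have h2 := (hB (-u) (by rw [norm_neg, hnu]; exact hur)).1
  rw [norm_neg] at h2
  rw [hnu] at h1 h2
  have he : Real.exp (4 * (161 * Real.log L) * u / L⁻¹) ≤ 102/100 := by
    refine (Real.exp_le_exp.mpr hkey).trans ?_
    have := Real.exp_bound_div_one_sub_of_interval (x := 1/100) (by norm_num) (by norm_num)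
    refine this.trans (by norm_num)
  rw [sub_eq_add_neg]
  calc _ ≤ _ := h2
    _ ≤ 102/100 * ‖Ffun D χ ψ c‖ := by gcongr
    _ ≤ 102/100 * (102/100 * ‖Ffun D χ ψ (c+u)‖) := by
        gcongr; exact h1.trans (by gcongr)
    _ ≤ _ := by nlinarith [norm_nonneg (Ffun D χ ψ (c+u))]

lemma Ctx.zero_right (h : Ctx D χ ψ) (ρ : ℂ) (h1 : 1/2 ≤ ρ.re) (h2 : ρ.re ≤ 1)
    (hn : |ρ.im - 2 * Real.pi * t0 D| ≤ bigL D ^ 405 + 2) (hz : LL D χ ψ ρ = 0) : ρ.re - 1/2 ≤ (bigL D ^ 9)⁻¹ := by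
  have hL := h.big.pos
  have h1L := h.big.h1
  have hlog := h.big.log
  have hAL := h.big.AL
  have hAi : 0 < (bigL D ^ 9)⁻¹ := by positivity
  have hLi : 0 < (bigL D)⁻¹ := by positivity
  have hN := near_of h.big ρ hn
  have hAFE := h.AFE ρ (by linarith) h2 hn
  rw [gE, hz, show (-179:ℤ) = -((179:ℕ):ℤ) by norm_num, zp] at hAFE
  have hF := (h.Fbd ρ (by linarith) (by rw [abs_of_nonneg] <;> linarith) hN).2.2
  have hZ := h.Zt_up ρ (by rw [abs_of_nonneg] <;> linarith) hN
  obtain ⟨u, hu⟩ : ∃ u, u = ρ.re - 1/2 := ⟨_, rfl⟩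
  rw [← hu] at hZ ⊢
  have hu0 : 0 ≤ u := by linarith
  rw [abs_of_nonneg hu0, show -u * (2 * bigL D ^ 9 + bigL D) + u * bigL D = -(2 * u * bigL D ^ 9) by ring] at hZ
  have hFb := h.Fbar ρ
  have hmain : ‖Ffun D χ ψ ρ‖ ≤ Real.exp (-(2 * u * bigL D ^ 9)) * ‖Ffun D χ ψ ((starRingEnd ℂ) (1 - ρ))‖ + (bigL D ^ 179)⁻¹ := by
    have e : Ffun D χ ψ ρ = -(Ztilde D χ ψ ρ * Ffun D χ ψ⁻¹ (1 - ρ)) - (0 - Ffun D χ ψ ρ - Ztilde D χ ψ ρ * Ffun D χ ψ⁻¹ (1 - ρ)) := by ring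
    calc ‖Ffun D χ ψ ρ‖ ≤ ‖Ztilde D χ ψ ρ * Ffun D χ ψ⁻¹ (1 - ρ)‖ + ‖0 - Ffun D χ ψ ρ - Ztilde D χ ψ ρ * Ffun D χ ψ⁻¹ (1 - ρ)‖ := by
          conv_lhs => rw [e]
          refine (norm_sub_le _ _).trans ?_
          rw [norm_neg]
      _ ≤ _ := by
          rw [norm_mul, hFb]
          gcongr
  set L := bigL D with hLdef
  have hsmall : (L^179)⁻¹ ≤ 1/100 * (L^81)⁻¹ := by
    rw [show L^179 = L^98 * L^81 by ring, mul_inv]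
    gcongr
    rw [inv_le_comm₀ (by positivity) (by norm_num)]
    have : L^1 ≤ L^98 := pow_le_pow_right₀ h.big.one (by norm_num)
    norm_num at *
    linarith
  by_cases hc : u ≤ 200 * Real.log L / L ^ 9
  · have hr := h.near_sq (1/2 + ρ.im * I) (by simp) (by simpa using hn) u hu0 hc
    have e1 : (1/2 + ρ.im * I - u : ℂ) = (starRingEnd ℂ) (1 - ρ) := by
      apply Complex.ext <;> simp [hu]; ring
    have e2 : (1/2 + ρ.im * I + u : ℂ) = ρ := by
      apply Complex.ext <;> simp [hu]
    rw [e1, e2] at hr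
    have hFpos : 0 < ‖Ffun D χ ψ ρ‖ := lt_of_lt_of_le (by positivity) hF
    by_contra hcon
    push Not at hcon
    have h8 : 1 ≤ u * L^9 := by
      rw [inv_lt_iff_one_lt_mul₀ (by positivity)] at hcon; exact hcon.le
    have he : Real.exp (-(2 * u * L ^ 9)) ≤ 1/2 := by
      calc _ ≤ Real.exp (-1) := Real.exp_le_exp.mpr (by linarith)
        _ ≤ 1/2 := by
          rw [Real.exp_neg, inv_le_comm₀ (Real.exp_pos _) (by norm_num)]
          have := Real.add_one_le_exp 1
          norm_num at *; linarith
    have : ‖Ffun D χ ψ ρ‖ ≤ 1/2 * (11/10 * ‖Ffun D χ ψ ρ‖) + 1/100 * ‖Ffun D χ ψ ρ‖ := by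
      refine hmain.trans ?_
      gcongr
      exact hsmall.trans (by gcongr)
    linarith
  · exfalso
    push Not at hc
    have hFG := (h.FG ((starRingEnd ℂ) (1 - ρ)) u hu0 (by simp [hu]; linarith)
      (near_norm h.big _ (conj_sub_near ρ hN) (by rw [conj_sub_re, abs_le]; constructor <;> linarith))).1
    have hcl : 200 * Real.log L < u * L^9 := by rwa [div_lt_iff₀ (by positivity)] at hc
    have h9 : Real.exp (-(2 * u * L ^ 9)) * (Real.exp (4 * L * u) * L^79) ≤ (L^121)⁻¹ := by
      rw [← mul_assoc, ← Real.exp_add]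
      have : -(2 * u * L ^ 9) + 4 * L * u ≤ -(200 * Real.log L) := by nlinarith
      calc _ ≤ Real.exp (-(200 * Real.log L)) * L^79 := by gcongr
        _ = (L^200)⁻¹ * L^79 := by
          rw [Real.exp_neg, show (200:ℝ) = ((200:ℕ):ℝ) by norm_num, Real.exp_nat_mul, Real.exp_log hL]
        _ = _ := by field_simp
    have h10 : (L^121)⁻¹ ≤ 1/100 * (L^81)⁻¹ := by
      rw [show L^121 = L^40 * L^81 by ring, mul_inv]
      gcongr
      rw [inv_le_comm₀ (by positivity) (by norm_num)]
      have : L^1 ≤ L^40 := pow_le_pow_right₀ h.big.one (by norm_num)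
      norm_num at *
      linarith
    have : (0:ℝ) < (L^81)⁻¹ := by positivity
    have : Real.exp (-(2 * u * L ^ 9)) * ‖Ffun D χ ψ ((starRingEnd ℂ) (1 - ρ))‖ ≤ Real.exp (-(2 * u * L ^ 9)) * (Real.exp (4 * L * u) * L^79) := by gcongr
    linarith

lemma Ctx.zero_near (h : Ctx D χ ψ) (ρ : ℂ) (h1 : |ρ.re - 1/2| ≤ 1/2)
    (hn : |ρ.im - 2 * Real.pi * t0 D| ≤ bigL D ^ 405 + 2) (hz : LL D χ ψ ρ = 0) : |ρ.re - 1/2| ≤ (bigL D ^ 9)⁻¹ := by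
  have hL := h.big.pos
  obtain ⟨ha, hb⟩ := abs_le.mp h1
  have hAi : 0 < (bigL D ^ 9)⁻¹ := by positivity
  have hN := near_of h.big ρ hn
  have him := near_im h.big ρ hN
  rw [abs_le]
  rcases le_total (1/2) ρ.re with hc | hc
  · have := h.zero_right ρ hc (by linarith) hn hz
    constructor <;> linarith
  · have hz2 : LL D χ ψ ((starRingEnd ℂ) (1 - ρ)) = 0 := by
      have hfe := LL_FE h.toHyp ρ (by intro h0; linarith)
      rw [hz] at hfe
      have h3 := (mul_eq_zero.mp hfe.symm).resolve_left (h.Zt_pos ρ hN)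
      rw [← LL_conj h.toHyp] at h3
      simpa using h3
    have := h.zero_right ((starRingEnd ℂ) (1 - ρ)) (by rw [conj_sub_re]; linarith) (by rw [conj_sub_re]; linarith) (by simpa using hn) hz2
    rw [conj_sub_re] at this
    constructor <;> linarith

lemma Ctx.final (h : Ctx D χ ψ) (ρ : ℂ) (h1 : |ρ.re - 1/2| ≤ 1/2)
    (hn : |ρ.im - 2 * Real.pi * t0 D| ≤ bigL D ^ 405 + 2) (hz : LL D χ ψ ρ = 0) :
    Ztilde D χ ψ ρ ≠ 0 ∧ ‖(Ztilde D χ ψ ρ)⁻¹ + Gfun D χ ψ ρ * FfunBar D χ ψ ρ‖ ≤ 200 * bigL D ^ (-100 : ℤ) := by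
  have hL := h.big.pos
  have hu := h.zero_near ρ h1 hn hz
  have hAL := h.big.AL
  have h1L := h.big.h1
  have hN := near_of h.big ρ hn
  have hZ := h.Zt_pos ρ hN
  refine ⟨hZ, ?_⟩
  obtain ⟨ha, hb⟩ := abs_le.mp hu
  have hiA : (bigL D ^ 9)⁻¹ ≤ (bigL D)⁻¹ := by gcongr; linarith
  have hAFE := h.AFE ρ (by linarith) (by linarith [(abs_le.mp h1).2]) hn
  have hnn := near_norm h.big ρ hN (by linarith)
  have hFG1 := h.FG1 ρ (by linarith) hnn
  have hZl := h.Zt_low ρ (by linarith) hN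
  have hG := (h.FG ρ (bigL D ^ 9)⁻¹ (by positivity) (by linarith) hnn).2
  have e : (Ztilde D χ ψ ρ)⁻¹ + Gfun D χ ψ ρ * FfunBar D χ ψ ρ =
      (Ztilde D χ ψ ρ)⁻¹ * (-(Ffun D χ ψ ρ * Gfun D χ ψ ρ - 1) - Gfun D χ ψ ρ * gE D χ ψ ρ) := by
    rw [FfunBar_eq, gE, hz]
    field_simp
    ring
  set L := bigL D with hLdef
  have hA : 0 < L^9 := by positivity
  have huA : (ρ.re - 1/2) * L^9 ≤ 1 := by
    calc _ ≤ (L^9)⁻¹ * L^9 := by gcongr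
      _ = 1 := by field_simp
  have huL : |ρ.re - 1/2| * L ≤ 1/4 := by
    calc _ ≤ (L^9)⁻¹ * L := by gcongr
      _ ≤ 1/4 := by rw [inv_mul_le_iff₀ hA]; linarith
  have huL2 : (ρ.re - 1/2) * L ≤ 1/4 := le_trans (by gcongr; exact le_abs_self _) huL
  have hZ3 : ‖(Ztilde D χ ψ ρ)⁻¹‖ ≤ 27 := by
    refine hZl.trans ((Real.exp_le_exp.mpr (?_ : _ ≤ ((3:ℕ):ℝ))).trans ((exp_nat_le 3).trans (by norm_num)))
    push_cast
    linarith
  have hG3 : ‖Gfun D χ ψ ρ‖ ≤ 3 * L^79 := by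
    refine hG.trans ?_
    gcongr
    refine (Real.exp_le_exp.mpr (?_ : _ ≤ ((1:ℕ):ℝ))).trans ((exp_nat_le 1).trans (by norm_num))
    rw [mul_inv_le_iff₀ hA]; push_cast; linarith
  rw [e, norm_mul]
  have e100 : L ^ (-100:ℤ) = (L^100)⁻¹ := by rw [show (-100:ℤ) = -((100:ℕ):ℤ) by norm_num, zp]
  have e179 : L ^ (-179:ℤ) = (L^179)⁻¹ := by rw [show (-179:ℤ) = -((179:ℕ):ℤ) by norm_num, zp]
  have e227 : L ^ (-227:ℤ) ≤ (L^100)⁻¹ := by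
    rw [show (-227:ℤ) = -((227:ℕ):ℤ) by norm_num, zp]
    gcongr
    · exact h.big.one
    · norm_num
  rw [e179] at hAFE
  rw [e100]
  have hin : ‖-(Ffun D χ ψ ρ * Gfun D χ ψ ρ - 1) - Gfun D χ ψ ρ * gE D χ ψ ρ‖ ≤ 4 * (L^100)⁻¹ := by
    refine (norm_sub_le _ _).trans ?_
    rw [norm_neg, norm_mul]
    have : ‖Gfun D χ ψ ρ‖ * ‖gE D χ ψ ρ‖ ≤ 3 * L^79 * (L^179)⁻¹ := by gcongr
    have e5 : 3 * L^79 * (L^179)⁻¹ = 3 * (L^100)⁻¹ := by field_simp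
    linarith
  calc _ ≤ 27 * (4 * (L^100)⁻¹) := by gcongr
    _ ≤ _ := by
      have : 0 < (L^100)⁻¹ := by positivity
      linarith

lemma big_eventually : ∃ D₀ : ℕ, ∀ D : ℕ, D₀ ≤ D → Big (bigL D) := by
  have h1 : ∀ᶠ L : ℝ in Filter.atTop, Big L := by
    have ho := Real.isLittleO_log_id_atTop.def (c := 1 / (2 * 10^6)) (by norm_num)
    filter_upwards [ho, Filter.eventually_ge_atTop (10^40), Filter.eventually_ge_atTop (2 * (1000 * (KK + 1))), Filter.eventually_ge_atTop 0] with L a b c d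
    refine ⟨b, ?_⟩
    simp only [id, Real.norm_eq_abs, abs_of_nonneg d] at a
    have := (le_abs_self _).trans a
    linarith
  have h2 : Filter.Tendsto (fun D : ℕ => bigL D) Filter.atTop Filter.atTop := by
    unfold bigL
    exact Real.tendsto_log_atTop.comp tendsto_natCast_atTop_atTop
  exact Filter.eventually_atTop.mp (h2.eventually h1)

lemma mk_ctx (hb : Big (bigL D)) (hr : IsRealChar χ) (hχ : χ.IsPrimitive) (hm : MemPsi1 D χ ψ) : Ctx D χ ψ := by
  obtain ⟨⟨hp, hp1, hp2⟩, hψ, i1, i2, i3⟩ := hm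
  have hL := hb.pos
  have hD : 1 < D := by
    by_contra hc
    have : D = 0 ∨ D = 1 := by omega
    rcases this with rfl | rfl <;> simp [bigL] at hL
  have hDP : (D:ℝ) < p := by
    refine lt_of_le_of_lt ?_ hp1
    rw [D_exp hD, bigP]
    apply Real.exp_le_exp.mpr
    linarith [hb.AL]
  refine ⟨⟨hD, hp.one_lt, ?_, hr, hχ, hψ⟩, hb, i1, i2, i3, hp1, ?_⟩
  · rw [Nat.coprime_comm, hp.coprime_iff_not_dvd]
    intro hd
    have := Nat.le_of_dvd (by omega) hd
    have : (p:ℝ) ≤ D := by exact_mod_cast this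
    linarith
  · refine lt_of_lt_of_le hp2 ?_
    have hP : 0 < bigP D := Real.exp_pos _
    have : bigL D ^ (-68:ℤ) ≤ 1 := zpow_le_one_of_nonpos₀ hb.one (by norm_num)
    nlinarith


end PartNo11

theorem statement13 :
    ∃ C : ℝ, 0 < C ∧ ∃ D₀ : ℕ, ∀ D : ℕ, D₀ ≤ D → ∀ χ : DirichletCharacter ℂ D,
      IsRealChar χ → χ.IsPrimitive →
        ∀ (p : ℕ) (ψ : DirichletCharacter ℂ p), MemPsi1 D χ ψ →
          ∀ ρ : ℂ, InOmega D ρ → Lfun ψ ρ * Lfun (chiPsi D χ ψ) ρ = 0 →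
            Ztilde D χ ψ ρ ≠ 0 ∧
            ‖(Ztilde D χ ψ ρ)⁻¹ + Gfun D χ ψ ρ * FfunBar D χ ψ ρ‖ ≤
              C * bigL D ^ (-100 : ℤ) := by
  obtain ⟨D₀, hD₀⟩ := big_eventually
  refine ⟨200, by norm_num, D₀, ?_⟩
  intro D hD χ hr hχ p ψ hm ρ hΩ hz
  have h := mk_ctx (hD₀ D hD) hr hχ hm
  obtain ⟨h1, h2⟩ := hΩ
  have e1 : (ρ - s0 D).re = ρ.re - 1/2 := by simp [s0]
  have e2 : (ρ - s0 D).im = ρ.im - 2 * Real.pi * t0 D := by simp [s0]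
  rw [e1] at h1
  rw [e2, bigL1] at h2
  exact h.final ρ h1.le h2.le hz
end
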